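/- Let 1<p≤2 and ε>0. There is a constant C_{ε,p} depending only on ε, p, b, c_+, c_- such that for every nonempty U⊂(0,∞), ‖𝓜^U‖_{L^p→L^p} ≤ C_{ε,p} · sup_{0<δ<1} δ^{-ε} 𝒦_p(U,δ); in particular if the right-hand side is finite then ‖𝓜^U f‖_{L^p(ℝ²)} ≤ C_{ε,p} (sup_{0<δ<1} δ^{-ε}𝒦_p(U,δ)) ‖f‖_{L^p(ℝ²)} for all Schwartz f. -/

import Mathlib

open MeasureTheory Filter Set Topology
open scoped ENNReal NNReal Topology Classical

noncomputable section

/-- The homogeneous curve of degree `b`: `γ_b(t) = c₊ t^b` for `t > 0`,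
`γ_b(t) = c₋ (-t)^b` for `t < 0`, `γ_b(0) = 0`. -/
def curve (b cp cm t : ℝ) : ℝ :=
  if 0 < t then cp * t ^ b else if t < 0 then cm * (-t) ^ b else 0

/-- The maximal function along the curve `(t, u γ_b(t))`. -/
def Mu (b cp cm u : ℝ) (f : ℝ × ℝ → ℝ) (x : ℝ × ℝ) : ℝ :=
  ⨆ R : {R : ℝ // 0 < R},
    ((R : ℝ))⁻¹ * ∫ t in (0:ℝ)..(R : ℝ), |f (x - (t, u * curve b cp cm t))|

/-- The maximal function `𝓜^U f = sup_{u ∈ U} M^{(u)} f`. -/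
def calM (b cp cm : ℝ) (U : Set ℝ) (f : ℝ × ℝ → ℝ) (x : ℝ × ℝ) : ℝ :=
  ⨆ u : U, Mu b cp cm (u : ℝ) f x

/-- The Hilbert transform along the curve `(t, u γ_b(t))` (principal value). -/
def Hu (b cp cm u : ℝ) (f : ℝ × ℝ → ℝ) (x : ℝ × ℝ) : ℝ :=
  limUnder (𝓝[>] (0:ℝ)) fun ε : ℝ =>
    ∫ t in {t : ℝ | ε < |t| ∧ |t| < ε⁻¹}, f (x - (t, u * curve b cp cm t)) / t

/-- The maximal function `𝓗^U f = sup_{u ∈ U} |H^{(u)} f|`, valued in `ℝ≥0∞`. -/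
def calH (b cp cm : ℝ) (U : Set ℝ) (f : ℝ × ℝ → ℝ) (x : ℝ × ℝ) : ℝ≥0∞ :=
  ⨆ u : U, ENNReal.ofReal |Hu b cp cm (u : ℝ) f x|

/-- The `L^p` norm of an `ℝ≥0∞`-valued function on `ℝ²`. -/
def lpN (g : ℝ × ℝ → ℝ≥0∞) (p : ℝ) : ℝ≥0∞ :=
  (∫⁻ x : ℝ × ℝ, g x ^ p) ^ (1 / p)

def eN (p : ℝ) : ℝ≥0∞ := ENNReal.ofReal p

/-- `U^r = r⁻¹ U ∩ [1,2] = {ρ ∈ [1,2] : rρ ∈ U}`. -/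
def UrSet (U : Set ℝ) (r : ℝ) : Set ℝ := {ρ : ℝ | ρ ∈ Icc (1:ℝ) 2 ∧ r * ρ ∈ U}

/-- `N(A,δ)`: minimal number of intervals of length `δ` needed to cover `A`. -/
def covN (A : Set ℝ) (δ : ℝ) : ℕ :=
  sInf {n : ℕ | ∃ F : Finset ℝ, F.card = n ∧ A ⊆ ⋃ a ∈ F, Icc a (a + δ)}

/-- `𝒦_p(U,δ) = δ^{1-1/p} sup_{r>0} N(U^r,δ)^{1/p}`. -/
def Kp (U : Set ℝ) (δ p : ℝ) : ℝ :=
  δ ^ (1 - 1 / p) * ⨆ r : {r : ℝ // 0 < r}, ((covN (UrSet U (r : ℝ)) δ : ℝ)) ^ (1 / p)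

/-- `p_cr(U) = 1 + limsup_{δ→0+} sup_{r>0} log N(U^r,δ) / log(1/δ)`. -/
def pcr (U : Set ℝ) : ℝ :=
  1 + limsup (fun δ : ℝ =>
      (⨆ r : {r : ℝ // 0 < r}, Real.log (covN (UrSet U (r : ℝ)) δ)) / Real.log δ⁻¹)
    (𝓝[>] (0:ℝ))

/-- `𝔑(U) = 1 + #{n ∈ ℤ : [2ⁿ, 2ⁿ⁺¹] ∩ U ≠ ∅}`. -/
def frakN (U : Set ℝ) : ℕ∞ :=
  1 + Set.encard {n : ℤ | (Icc ((2:ℝ) ^ n) ((2:ℝ) ^ (n + 1)) ∩ U).Nonempty}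

/-- `√(log 𝔑(U))`, valued in `ℝ≥0∞` (equal to `∞` if `𝔑(U) = ∞`). -/
def sqrtLogN (U : Set ℝ) : ℝ≥0∞ :=
  if frakN U = ⊤ then ⊤
  else ENNReal.ofReal (Real.sqrt (Real.log ((frakN U).toNat : ℝ)))

/-- The `L^p → L^p` operator norm of `𝓜^U` (smallest admissible constant, possibly `∞`). -/
def opNormM (b cp cm : ℝ) (U : Set ℝ) (p : ℝ) : ℝ≥0∞ :=
  sInf {C : ℝ≥0∞ | ∀ f : SchwartzMap (ℝ × ℝ) ℝ,
    eLpNorm (calM b cp cm U ⇑f) (eN p) volume ≤ C * eLpNorm ⇑f (eN p) volume}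

/-- The `L^p → L^p` operator norm of `𝓗^U` (smallest admissible constant, possibly `∞`). -/
def opNormH (b cp cm : ℝ) (U : Set ℝ) (p : ℝ) : ℝ≥0∞ :=
  sInf {C : ℝ≥0∞ | ∀ f : SchwartzMap (ℝ × ℝ) ℝ,
    lpN (calH b cp cm U ⇑f) p ≤ C * eLpNorm ⇑f (eN p) volume}

/-- `θ_{p,ℓ}`. -/
def theta (p : ℝ) (l : ℕ) : ℝ :=
  if (l : ℝ) ≤ (p - 1)⁻¹ then (p - 1) ^ (3 - 10 / p) else (l : ℝ) ^ (7 * (2 / p - 1))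

/-- `Σ_{ℓ≥1} θ_{p,ℓ} 𝒦_p(U, 2^{-ℓ})`, valued in `ℝ≥0∞`. -/
def KpSum (U : Set ℝ) (p : ℝ) : ℝ≥0∞ :=
  ∑' l : ℕ, ENNReal.ofReal (theta p (l + 1) * Kp U ((2:ℝ) ^ (-((l : ℝ) + 1))) p)

namespace CurveMax

section

/-- The plane, on which all operators act by translation. -/
abbrev G := ℝ × ℝ

variable {E : Type*} [NormedAddCommGroup E] [NormedSpace ℝ E]

/-- Bounded, compactly supported, strongly measurable functions. -/
def Nice (f : G → E) : Prop :=
  StronglyMeasurable f ∧ (∃ M, ∀ x, ‖f x‖ ≤ M) ∧ ∃ R, ∀ x, R < ‖x‖ → f x = 0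

/-- Compactly supported probability measures. -/
structure CProb (ν : Measure G) : Prop where
  prob : IsProbabilityMeasure ν
  supp : ∃ R, ∀ᵐ y ∂ν, ‖y‖ ≤ R

/-- Convolution with a measure. -/
def avg (ν : Measure G) (f : G → E) (x : G) : E := ∫ y, f (x - y) ∂ν

/-- Convolution of an extended nonnegative function with a measure. -/
def lavg (ν : Measure G) (F : G → ℝ≥0∞) (x : G) : ℝ≥0∞ := ∫⁻ y, F (x - y) ∂ν

namespace Nice

theorem zero : Nice (fun _ : G => (0 : E)) :=
  ⟨stronglyMeasurable_const, ⟨0, by simp⟩, ⟨0, by simp⟩⟩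

theorem add {f g : G → E} (hf : Nice f) (hg : Nice g) : Nice (fun x => f x + g x) := by
  obtain ⟨mf, ⟨M, hM⟩, R, hR⟩ := hf
  obtain ⟨mg, ⟨M', hM'⟩, R', hR'⟩ := hg
  refine ⟨mf.add mg, ⟨M + M', fun x => (norm_add_le _ _).trans (add_le_add (hM x) (hM' x))⟩,
    max R R', fun x hx => ?_⟩
  show f x + g x = 0
  rw [hR x ((le_max_left _ _).trans_lt hx), hR' x ((le_max_right _ _).trans_lt hx), add_zero]

theorem smul {f : G → E} (hf : Nice f) (c : ℝ) : Nice (fun x => c • f x) := by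
  obtain ⟨mf, ⟨M, hM⟩, R, hR⟩ := hf
  refine ⟨mf.const_smul c, ⟨‖c‖ * M, fun x => ?_⟩, R, fun x hx => by simp [hR x hx]⟩
  rw [norm_smul]
  exact mul_le_mul_of_nonneg_left (hM x) (norm_nonneg _)

theorem sub {f g : G → E} (hf : Nice f) (hg : Nice g) : Nice (fun x => f x - g x) := by
  have := hf.add (hg.smul (-1))
  simpa [sub_eq_add_neg] using this

theorem indicator {f : G → E} (hf : Nice f) {s : Set G} (hs : MeasurableSet s) :
    Nice (s.indicator f) := by
  obtain ⟨mf, ⟨M, hM⟩, R, hR⟩ := hf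
  refine ⟨mf.indicator hs, ⟨M, fun x => (norm_indicator_le_norm_self f x).trans (hM x)⟩, R,
    fun x hx => ?_⟩
  by_cases h : x ∈ s <;> simp [h, hR x hx]

theorem memLp {f : G → E} (hf : Nice f) (p : ℝ≥0∞) : MemLp f p := by
  obtain ⟨mf, ⟨M, hM⟩, R, hR⟩ := hf
  have h1 : f = (Metric.closedBall (0 : G) R).indicator f := by
    ext x
    by_cases h : x ∈ Metric.closedBall (0 : G) R
    · simp [h]
    · rw [Set.indicator_of_notMem h]
      exact hR x (by simpa using h)
  rw [h1, memLp_indicator_iff_restrict measurableSet_closedBall]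
  have : IsFiniteMeasure (volume.restrict (Metric.closedBall (0 : G) R)) :=
    ⟨by simpa using measure_closedBall_lt_top⟩
  exact MemLp.of_bound mf.aestronglyMeasurable M (Eventually.of_forall hM)

theorem integrable {f : G → E} (hf : Nice f) : Integrable f := memLp_one_iff_integrable.1 (hf.memLp 1)

theorem integrable_sub {f : G → E} (hf : Nice f) {ν : Measure G} (hν : CProb ν) (x : G) :
    Integrable (fun y => f (x - y)) ν := by
  have := hν.prob
  obtain ⟨mf, ⟨M, hM⟩, -⟩ := hf
  exact Integrable.of_bound (mf.comp_measurable (by fun_prop)).aestronglyMeasurable M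
    (Eventually.of_forall fun y => hM _)

theorem avg {f : G → E} (hf : Nice f) {ν : Measure G} (hν : CProb ν) : Nice (avg ν f) := by
  have := hν.prob
  obtain ⟨R', hR'⟩ := hν.supp
  obtain ⟨mf, ⟨M, hM⟩, R, hR⟩ := hf
  refine ⟨?_, ⟨M, fun x => ?_⟩, R + R', fun x hx => ?_⟩
  · refine StronglyMeasurable.integral_prod_right (f := fun x y => f (x - y)) ?_
    exact mf.comp_measurable (g := fun z : G × G => z.1 - z.2) (by fun_prop)
  · refine (norm_integral_le_of_norm_le_const (Eventually.of_forall fun y => hM (x - y))).trans ?_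
    simp
  · refine integral_eq_zero_of_ae ?_
    filter_upwards [hR'] with y hy
    refine hR _ ?_
    have := norm_sub_norm_le x y
    linarith

end Nice

theorem measurable_lavg {ν : Measure G} [SFinite ν] {F : G → ℝ≥0∞} (hF : Measurable F) :
    Measurable (lavg ν F) := by
  unfold lavg
  exact Measurable.lintegral_prod_right' (f := fun z : G × G => F (z.1 - z.2)) (by fun_prop)

theorem lavg_mono {ν : Measure G} {F F' : G → ℝ≥0∞} (h : ∀ x, F x ≤ F' x) (x : G) :
    lavg ν F x ≤ lavg ν F' x := lintegral_mono fun _ => h _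

theorem enorm_avg_le (ν : Measure G) (f : G → E) (x : G) :
    ‖avg ν f x‖ₑ ≤ lavg ν (fun y => ‖f y‖ₑ) x := enorm_integral_le_lintegral_enorm _

theorem enorm_avg_eq {ν : Measure G} (hν : CProb ν) {f : G → ℝ} (hf : Nice f)
    (h0 : ∀ x, 0 ≤ f x) (x : G) : ‖avg ν f x‖ₑ = lavg ν (fun y => ‖f y‖ₑ) x := by
  unfold avg lavg
  rw [Real.enorm_of_nonneg (integral_nonneg fun y => h0 _),
    ofReal_integral_eq_lintegral_ofReal (hf.integrable_sub hν x) (Eventually.of_forall fun y => h0 _)]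
  exact lintegral_congr fun y => (Real.enorm_of_nonneg (h0 _)).symm

theorem lintegral_lavg {ν : Measure G} (hν : CProb ν) {F : G → ℝ≥0∞} (hF : Measurable F) :
    ∫⁻ x, lavg ν F x = ∫⁻ x, F x := by
  have := hν.prob
  unfold lavg
  rw [lintegral_lintegral_swap (by fun_prop)]
  simp_rw [lintegral_sub_right_eq_self]
  simp

theorem lavg_rpow_le {ν : Measure G} (hν : CProb ν) {F : G → ℝ≥0∞} (hF : Measurable F) {p : ℝ}
    (hp : 1 ≤ p) (x : G) : lavg ν F x ^ p ≤ lavg ν (fun y => F y ^ p) x := by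
  have := hν.prob
  have h2 := eLpNorm_le_eLpNorm_of_exponent_le (μ := ν) (p := 1) (q := ENNReal.ofReal p)
    (f := fun y => F (x - y)) (by simpa using hp) (Measurable.aestronglyMeasurable (by fun_prop))
  have hp0 : 0 < p := by linarith
  rw [eLpNorm_one_eq_lintegral_enorm, eLpNorm_eq_lintegral_rpow_enorm_toReal (by simpa using hp0) (by simp),
    ENNReal.toReal_ofReal hp0.le] at h2
  simp only [enorm_eq_self] at h2
  calc lavg ν F x ^ p ≤ ((∫⁻ y, F (x - y) ^ p ∂ν) ^ (1 / p)) ^ p :=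
        ENNReal.rpow_le_rpow h2 hp0.le
    _ = lavg ν (fun y => F y ^ p) x := by
        rw [← ENNReal.rpow_mul, one_div_mul_cancel hp0.ne', ENNReal.rpow_one]; rfl

theorem lintegral_avg_rpow_le {ν : Measure G} (hν : CProb ν) {f : G → E} (hf : Nice f) {p : ℝ}
    (hp : 1 ≤ p) : ∫⁻ x, ‖avg ν f x‖ₑ ^ p ≤ ∫⁻ x, ‖f x‖ₑ ^ p := by
  have hm : Measurable fun x => ‖f x‖ₑ := hf.1.enorm
  calc ∫⁻ x, ‖avg ν f x‖ₑ ^ p ≤ ∫⁻ x, lavg ν (fun y => ‖f y‖ₑ ^ p) x :=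
        lintegral_mono fun x => (ENNReal.rpow_le_rpow (enorm_avg_le ν f x) (by linarith)).trans
          (lavg_rpow_le hν hm hp x)
    _ = _ := lintegral_lavg hν (hm.pow_const p)

theorem avg_add {ν : Measure G} (hν : CProb ν) {f g : G → E} (hf : Nice f) (hg : Nice g) (x : G) :
    avg ν (fun y => f y + g y) x = avg ν f x + avg ν g x :=
  integral_add (hf.integrable_sub hν x) (hg.integrable_sub hν x)

theorem avg_sub {ν : Measure G} (hν : CProb ν) {f g : G → E} (hf : Nice f) (hg : Nice g) (x : G) :
    avg ν (fun y => f y - g y) x = avg ν f x - avg ν g x :=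
  integral_sub (hf.integrable_sub hν x) (hg.integrable_sub hν x)

theorem avg_nonneg {ν : Measure G} {f : G → ℝ} (h : ∀ x, 0 ≤ f x) (x : G) : 0 ≤ avg ν f x :=
  integral_nonneg fun _ => h _

/-! Layer cake and interpolation. -/

theorem rpow_eq_lintegral (y : ℝ≥0∞) {p : ℝ} (hp : 0 < p) :
    y ^ p = ∫⁻ t in Ioi (0 : ℝ), ENNReal.ofReal (p * t ^ (p - 1)) *
      {t : ℝ | ENNReal.ofReal t < y}.indicator 1 t := by
  have key : ∀ r : ℝ, 0 ≤ r → ∫⁻ t in Ioo 0 r, ENNReal.ofReal (p * t ^ (p - 1)) =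
      ENNReal.ofReal r ^ p := by
    intro r hr
    have hi : IntervalIntegrable (fun t : ℝ => p * t ^ (p - 1)) volume 0 r :=
      (intervalIntegral.intervalIntegrable_rpow' (by linarith)).const_mul p
    rw [setLIntegral_congr Ioo_ae_eq_Ioc, ← ofReal_integral_eq_lintegral_ofReal
      ((intervalIntegrable_iff_integrableOn_Ioc_of_le hr).1 hi), ← intervalIntegral.integral_of_le hr,
      intervalIntegral.integral_const_mul, integral_rpow (Or.inl (by linarith)),
      ENNReal.ofReal_rpow_of_nonneg hr hp.le]
    · congr 1
      rw [sub_add_cancel, Real.zero_rpow hp.ne']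
      field_simp
      ring
    · refine (ae_restrict_iff' measurableSet_Ioc).2 (Eventually.of_forall fun t ht => ?_)
      exact mul_nonneg hp.le (Real.rpow_nonneg ht.1.le _)
  rcases eq_or_ne y ∞ with rfl | hy
  · rw [ENNReal.top_rpow_of_pos hp, eq_comm, eq_top_iff]
    have : ∀ n : ℕ, (n : ℝ≥0∞) ^ p ≤ ∫⁻ t in Ioi (0 : ℝ), ENNReal.ofReal (p * t ^ (p - 1)) *
      {t : ℝ | ENNReal.ofReal t < ∞}.indicator 1 t := by
      intro n
      have := key n (by positivity)
      rw [ENNReal.ofReal_natCast] at this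
      rw [← this]
      simp only [ENNReal.ofReal_lt_top, ofPred_true, indicator_univ, Pi.one_apply, mul_one]
      exact lintegral_mono_set Ioo_subset_Ioi_self
    refine le_of_tendsto' (f := fun n : ℕ => (n : ℝ≥0∞) ^ p) (x := atTop) ?_ this
    rw [← ENNReal.top_rpow_of_pos hp]
    exact (ENNReal.continuous_rpow_const.tendsto _).comp ENNReal.tendsto_nat_nhds_top
  · lift y to ℝ≥0 using hy
    have h1 := key y y.2
    rw [ENNReal.ofReal_coe_nnreal] at h1
    rw [← h1, ← lintegral_indicator measurableSet_Ioo, ← lintegral_indicator measurableSet_Ioi]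
    refine lintegral_congr fun t => ?_
    by_cases h0 : 0 < t
    · have hc : ENNReal.ofReal t < (y : ℝ≥0∞) ↔ t < y := by
        rw [← ENNReal.ofReal_coe_nnreal, ENNReal.ofReal_lt_ofReal_iff_of_nonneg h0.le]
      by_cases h : t < y <;> simp [Set.indicator, h0, h, hc]
    · simp [Set.indicator, h0]

end

section

section LayerCake

variable {α : Type*} [MeasurableSpace α] {μ : Measure α} [SFinite μ]

theorem lintegral_rpow_eq_layer {g : α → ℝ≥0∞} (hg : Measurable g) {p : ℝ} (hp : 0 < p) :
    ∫⁻ x, g x ^ p ∂μ =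
      ∫⁻ t in Ioi (0 : ℝ), ENNReal.ofReal (p * t ^ (p - 1)) * μ {x | ENNReal.ofReal t < g x} := by
  have hm : MeasurableSet {z : α × ℝ | ENNReal.ofReal z.2 < g z.1} :=
    measurableSet_lt (by fun_prop) (by fun_prop)
  calc ∫⁻ x, g x ^ p ∂μ
      = ∫⁻ x, (∫⁻ t in Ioi (0 : ℝ), ENNReal.ofReal (p * t ^ (p - 1)) *
          {z : α × ℝ | ENNReal.ofReal z.2 < g z.1}.indicator 1 (x, t)) ∂μ := by
        refine lintegral_congr fun x => ?_
        rw [rpow_eq_lintegral _ hp]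
        rfl
    _ = ∫⁻ t in Ioi (0 : ℝ), ∫⁻ x, ENNReal.ofReal (p * t ^ (p - 1)) *
          {z : α × ℝ | ENNReal.ofReal z.2 < g z.1}.indicator 1 (x, t) ∂μ := by
        refine lintegral_lintegral_swap (Measurable.aemeasurable ?_)
        exact Measurable.mul (by fun_prop) (measurable_one.indicator hm)
    _ = _ := by
        refine lintegral_congr fun t => ?_
        have hm' : MeasurableSet {x | ENNReal.ofReal t < g x} :=
          measurableSet_lt (by fun_prop) (by fun_prop)
        rw [lintegral_const_mul, ← lintegral_indicator_one hm']
        · rfl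
        · exact measurable_one.indicator hm'

theorem layer_high {F : α → ℝ≥0∞} (hF : Measurable F) {p q c : ℝ} (hq : 0 < q) (hqp : q < p)
    (hc : 0 < c) :
    ∫⁻ t in Ioi (0 : ℝ), ENNReal.ofReal (p * t ^ (p - 1)) *
        (ENNReal.ofReal (t ^ (-q)) * ∫⁻ x in {x | ENNReal.ofReal (c * t) < F x}, F x ^ q ∂μ) ≤
      ENNReal.ofReal (p / (p - q) * c ^ (q - p)) * ∫⁻ x, F x ^ p ∂μ := by
  have hm : MeasurableSet {z : α × ℝ | ENNReal.ofReal (c * z.2) < F z.1} :=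
    measurableSet_lt (by fun_prop) (by fun_prop)
  calc _ = ∫⁻ t in Ioi (0 : ℝ), ∫⁻ x, ENNReal.ofReal (p * t ^ (p - 1 - q)) *
          {z : α × ℝ | ENNReal.ofReal (c * z.2) < F z.1}.indicator (fun z => F z.1 ^ q) (x, t)
            ∂μ := by
        refine setLIntegral_congr_fun measurableSet_Ioi fun t ht => ?_
        have ht : 0 < t := ht
        have hm' : MeasurableSet {x | ENNReal.ofReal (c * t) < F x} :=
          measurableSet_lt (by fun_prop) (by fun_prop)
        have hm2 : Measurable ({x | ENNReal.ofReal (c * t) < F x}.indicator fun x => F x ^ q) :=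
          (hF.pow_const q).indicator hm'
        rw [← mul_assoc, ← ENNReal.ofReal_mul (mul_nonneg (by linarith) (Real.rpow_nonneg ht.le _)),
          mul_assoc, ← Real.rpow_add ht, ← lintegral_indicator hm', ← lintegral_const_mul _ hm2]
        rfl
    _ = ∫⁻ x, (∫⁻ t in Ioi (0 : ℝ), ENNReal.ofReal (p * t ^ (p - 1 - q)) *
          {z : α × ℝ | ENNReal.ofReal (c * z.2) < F z.1}.indicator (fun z => F z.1 ^ q) (x, t)) ∂μ := by
        refine (lintegral_lintegral_swap (Measurable.aemeasurable ?_)).symm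
        exact Measurable.mul (by fun_prop) (Measurable.indicator (by fun_prop) hm)
    _ ≤ ∫⁻ x, ENNReal.ofReal (p / (p - q) * c ^ (q - p)) * F x ^ p ∂μ := by
        refine lintegral_mono fun x => ?_
        have hpq : 0 < p - q := by linarith
        rcases eq_or_ne (F x) ∞ with h | h
        · rw [h, ENNReal.top_rpow_of_pos (hq.trans hqp), ENNReal.mul_top]
          · exact le_top
          · have : 0 < p / (p - q) * c ^ (q - p) :=
              mul_pos (div_pos (by linarith) hpq) (Real.rpow_pos_of_pos hc _)
            simpa using this
        · obtain ⟨r, hr⟩ : ∃ r : ℝ≥0, F x = r := ⟨(F x).toNNReal, (ENNReal.coe_toNNReal h).symm⟩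
          have e := rpow_eq_lintegral (ENNReal.ofReal (r / c)) hpq
          have e2 : ∫⁻ t in Ioi (0 : ℝ), ENNReal.ofReal (p * t ^ (p - 1 - q)) *
              {z : α × ℝ | ENNReal.ofReal (c * z.2) < F z.1}.indicator (fun z => F z.1 ^ q) (x, t)
              = ENNReal.ofReal (p / (p - q)) * F x ^ q *
                ∫⁻ t in Ioi (0 : ℝ), ENNReal.ofReal ((p - q) * t ^ (p - q - 1)) *
                  {t : ℝ | ENNReal.ofReal t < ENNReal.ofReal (r / c)}.indicator 1 t := by
            have hm3 : MeasurableSet {t : ℝ | ENNReal.ofReal t < ENNReal.ofReal (r / c)} :=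
              measurableSet_lt (by fun_prop) (by fun_prop)
            have hm4 : Measurable fun t : ℝ => ENNReal.ofReal ((p - q) * t ^ (p - q - 1)) *
                {t : ℝ | ENNReal.ofReal t < ENNReal.ofReal (r / c)}.indicator 1 t :=
              Measurable.mul (by fun_prop) (measurable_one.indicator hm3)
            rw [← lintegral_const_mul _ hm4]
            refine setLIntegral_congr_fun measurableSet_Ioi fun t ht => ?_
            have ht : 0 < t := ht
            have hiff : ENNReal.ofReal (c * t) < F x ↔ ENNReal.ofReal t < ENNReal.ofReal (r / c) := by
              rw [hr, ← ENNReal.ofReal_coe_nnreal,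
                ENNReal.ofReal_lt_ofReal_iff_of_nonneg (by positivity),
                ENNReal.ofReal_lt_ofReal_iff_of_nonneg ht.le, lt_div_iff₀' hc]
            by_cases hh : ENNReal.ofReal (c * t) < F x
            · have h2 := hiff.1 hh
              simp only [Set.indicator, mem_ofPred_eq, hh, h2, if_true, Pi.one_apply, mul_one]
              rw [show p * t ^ (p - 1 - q) = p / (p - q) * ((p - q) * t ^ (p - q - 1)) by
                rw [← mul_assoc, div_mul_cancel₀ _ hpq.ne']; congr 2; ring,
                ENNReal.ofReal_mul (div_nonneg (by linarith) hpq.le)]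
              ring
            · have h2 : ¬ ENNReal.ofReal t < ENNReal.ofReal (r / c) := fun h => hh (hiff.2 h)
              simp only [Set.indicator, mem_ofPred_eq, hh, h2, if_false, mul_zero]
          rw [e2, ← e, hr, ENNReal.ofReal_mul (div_nonneg (by linarith) hpq.le),
            ← ENNReal.ofReal_coe_nnreal, ENNReal.ofReal_rpow_of_nonneg r.coe_nonneg hq.le,
            ENNReal.ofReal_rpow_of_nonneg r.coe_nonneg (by linarith),
            ENNReal.ofReal_rpow_of_nonneg (by positivity) hpq.le, mul_assoc, mul_assoc,
            ← ENNReal.ofReal_mul (Real.rpow_nonneg r.coe_nonneg _),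
            ← ENNReal.ofReal_mul (Real.rpow_nonneg hc.le _)]
          refine le_of_eq ?_
          congr 2
          rw [Real.div_rpow r.coe_nonneg hc.le, show q - p = -(p - q) by ring, Real.rpow_neg hc.le]
          rcases eq_or_lt_of_le r.coe_nonneg with h0 | h0
          · have : (r : ℝ) = 0 := h0.symm
            simp [this, Real.zero_rpow hq.ne', Real.zero_rpow (hq.trans hqp).ne']
          · have : (r : ℝ) ^ p = (r : ℝ) ^ q * (r : ℝ) ^ (p - q) := by
              rw [← Real.rpow_add h0]; congr 1; ring
            rw [this]
            ring
    _ = _ := lintegral_const_mul _ (by fun_prop)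

theorem layer_low {F : α → ℝ≥0∞} (hF : Measurable F) {p q c : ℝ} (hp : 0 < p) (hqp : p < q)
    (hc : 0 < c) :
    ∫⁻ t in Ioi (0 : ℝ), ENNReal.ofReal (p * t ^ (p - 1)) *
        (ENNReal.ofReal (t ^ (-q)) * ∫⁻ x in {x | F x ≤ ENNReal.ofReal (c * t)}, F x ^ q ∂μ) ≤
      ENNReal.ofReal (p / (q - p) * c ^ (q - p)) * ∫⁻ x, F x ^ p ∂μ := by
  have hm : MeasurableSet {z : α × ℝ | F z.1 ≤ ENNReal.ofReal (c * z.2)} :=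
    measurableSet_le (by fun_prop) (by fun_prop)
  have hq : 0 < q := hp.trans hqp
  calc _ = ∫⁻ t in Ioi (0 : ℝ), ∫⁻ x, ENNReal.ofReal (p * t ^ (p - 1 - q)) *
          {z : α × ℝ | F z.1 ≤ ENNReal.ofReal (c * z.2)}.indicator (fun z => F z.1 ^ q) (x, t)
            ∂μ := by
        refine setLIntegral_congr_fun measurableSet_Ioi fun t ht => ?_
        have ht : 0 < t := ht
        have hm' : MeasurableSet {x | F x ≤ ENNReal.ofReal (c * t)} :=
          measurableSet_le (by fun_prop) (by fun_prop)
        have hm2 : Measurable ({x | F x ≤ ENNReal.ofReal (c * t)}.indicator fun x => F x ^ q) :=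
          (hF.pow_const q).indicator hm'
        rw [← mul_assoc, ← ENNReal.ofReal_mul (mul_nonneg (by linarith) (Real.rpow_nonneg ht.le _)),
          mul_assoc, ← Real.rpow_add ht, ← lintegral_indicator hm', ← lintegral_const_mul _ hm2]
        rfl
    _ = ∫⁻ x, (∫⁻ t in Ioi (0 : ℝ), ENNReal.ofReal (p * t ^ (p - 1 - q)) *
          {z : α × ℝ | F z.1 ≤ ENNReal.ofReal (c * z.2)}.indicator (fun z => F z.1 ^ q) (x, t)) ∂μ := by
        refine (lintegral_lintegral_swap (Measurable.aemeasurable ?_)).symm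
        exact Measurable.mul (by fun_prop) (Measurable.indicator (by fun_prop) hm)
    _ ≤ ∫⁻ x, ENNReal.ofReal (p / (q - p) * c ^ (q - p)) * F x ^ p ∂μ := by
        refine lintegral_mono fun x => ?_
        have hpq : 0 < q - p := by linarith
        rcases eq_or_ne (F x) ∞ with h | h
        · simp [h, Set.indicator, top_le_iff]
        · obtain ⟨r, hr⟩ : ∃ r : ℝ≥0, F x = r := ⟨(F x).toNNReal, (ENNReal.coe_toNNReal h).symm⟩
          rcases eq_or_lt_of_le r.coe_nonneg with h0 | h0
          · have : r = 0 := NNReal.coe_eq_zero.1 h0.symm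
            simp [hr, this, Set.indicator, ENNReal.zero_rpow_of_pos hq]
          have h0' : (0 : ℝ) < r := h0
          have hrc : (0 : ℝ) < r / c := div_pos h0 hc
          have e2 : ∫⁻ t in Ioi (0 : ℝ), ENNReal.ofReal (p * t ^ (p - 1 - q)) *
              {z : α × ℝ | F z.1 ≤ ENNReal.ofReal (c * z.2)}.indicator (fun z => F z.1 ^ q) (x, t)
              = ENNReal.ofReal p * F x ^ q *
                ∫⁻ t in Ici (r / c : ℝ), ENNReal.ofReal (t ^ (p - 1 - q)) := by
            rw [← lintegral_const_mul _ (by fun_prop), ← lintegral_indicator measurableSet_Ioi,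
              ← lintegral_indicator measurableSet_Ici]
            refine lintegral_congr fun t => ?_
            by_cases ht : 0 < t
            · have hiff : F x ≤ ENNReal.ofReal (c * t) ↔ (r / c : ℝ) ≤ t := by
                rw [hr, ← ENNReal.ofReal_coe_nnreal,
                  ENNReal.ofReal_le_ofReal_iff (by positivity), div_le_iff₀' hc]
              by_cases hh : F x ≤ ENNReal.ofReal (c * t)
              · have h2 := hiff.1 hh
                simp only [Set.indicator, mem_ofPred_eq, hh, h2, if_true, mem_Ioi, ht, mem_Ici]
                rw [ENNReal.ofReal_mul hp.le]
                ring
              · have h2 : ¬ (r / c : ℝ) ≤ t := fun h => hh (hiff.2 h)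
                simp only [Set.indicator, mem_ofPred_eq, hh, h2, if_false, mem_Ici, mul_zero, ite_self]
            · have h2 : ¬ (r / c : ℝ) ≤ t := fun h => ht (hrc.trans_le h)
              simp only [Set.indicator, mem_Ioi, ht, mem_Ici, h2, if_false]
          have e3 : ∫⁻ t in Ici (r / c : ℝ), ENNReal.ofReal (t ^ (p - 1 - q)) =
              ENNReal.ofReal ((r / c : ℝ) ^ (p - q) / (q - p)) := by
            rw [setLIntegral_congr Ioi_ae_eq_Ici.symm, ← ofReal_integral_eq_lintegral_ofReal
              (integrableOn_Ioi_rpow_of_lt (by linarith) hrc),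
              integral_Ioi_rpow_of_lt (by linarith) hrc]
            · congr 1
              rw [show p - 1 - q + 1 = -(q - p) by ring, show p - q = -(q - p) by ring]
              field_simp
            · refine (ae_restrict_iff' measurableSet_Ioi).2 (Eventually.of_forall fun t ht => ?_)
              exact Real.rpow_nonneg (hrc.trans ht).le _
          rw [e2, e3, hr, ← ENNReal.ofReal_coe_nnreal, ENNReal.ofReal_rpow_of_nonneg r.coe_nonneg hq.le,
            ENNReal.ofReal_rpow_of_nonneg r.coe_nonneg hp.le, mul_assoc,
            ← ENNReal.ofReal_mul (Real.rpow_nonneg r.coe_nonneg _), ← ENNReal.ofReal_mul hp.le,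
            ← ENNReal.ofReal_mul (mul_nonneg (by positivity) (by positivity))]
          refine le_of_eq ?_
          congr 1
          have : (r : ℝ) ^ q = (r : ℝ) ^ p * (r : ℝ) ^ (q - p) := by
            rw [← Real.rpow_add h0']; congr 1; ring
          rw [this, Real.div_rpow r.coe_nonneg hc.le, show p - q = -(q - p) by ring, Real.rpow_neg r.coe_nonneg,
            Real.rpow_neg hc.le]
          have h3 : (r : ℝ) ^ (q - p) ≠ 0 := (Real.rpow_pos_of_pos h0' _).ne'
          have h4 : (c : ℝ) ^ (q - p) ≠ 0 := (Real.rpow_pos_of_pos hc _).ne'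
          field_simp
    _ = _ := lintegral_const_mul _ (by fun_prop)

theorem chebyshev_rpow {g : α → ℝ≥0∞} (hg : Measurable g) {p t : ℝ} (hp : 0 < p) (ht : 0 < t) :
    μ {x | ENNReal.ofReal t < g x} ≤ ENNReal.ofReal (t ^ (-p)) * ∫⁻ x, g x ^ p ∂μ := by
  have h := mul_meas_ge_le_lintegral (μ := μ) (hg.pow_const p) (ENNReal.ofReal (t ^ p))
  have h1 : ENNReal.ofReal (t ^ (-p)) * ENNReal.ofReal (t ^ p) = 1 := by
    rw [← ENNReal.ofReal_mul (Real.rpow_nonneg ht.le _), ← Real.rpow_add ht]; simp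
  calc μ {x | ENNReal.ofReal t < g x} ≤ μ {x | ENNReal.ofReal (t ^ p) ≤ g x ^ p} := by
        refine measure_mono fun x hx => ?_
        simp only [mem_ofPred_eq] at hx ⊢
        rw [← ENNReal.ofReal_rpow_of_nonneg ht.le hp.le]
        exact ENNReal.rpow_le_rpow hx.le hp.le
    _ = ENNReal.ofReal (t ^ (-p)) * (ENNReal.ofReal (t ^ p) *
          μ {x | ENNReal.ofReal (t ^ p) ≤ g x ^ p}) := by rw [← mul_assoc, h1, one_mul]
    _ ≤ _ := by gcongr

end LayerCake

end

theorem marcinkiewicz_aux (T : (G → ℝ) → G → ℝ≥0∞) {p0 p p1 : ℝ} (h0 : 0 < p0) (h01 : p0 < p)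
    (h1 : p < p1) (hm : ∀ f, Nice f → Measurable (T f))
    (hs : ∀ f g, Nice f → Nice g → ∀ x, T (fun y => f y + g y) x ≤ T f x + T g x)
    {a0 a1 : ℝ≥0∞}
    (hT0 : ∀ f, Nice f → ∫⁻ x, T f x ^ p0 ≤ a0 * ∫⁻ x, ‖f x‖ₑ ^ p0)
    (hT1 : ∀ f, Nice f → ∫⁻ x, T f x ^ p1 ≤ a1 * ∫⁻ x, ‖f x‖ₑ ^ p1)
    {c : ℝ} (hc : 0 < c) {f : G → ℝ} (hf : Nice f) :
    ∫⁻ x, T f x ^ p ≤ (ENNReal.ofReal (2 ^ p0) * a0 * ENNReal.ofReal (p / (p - p0) * c ^ (p0 - p)) +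
      ENNReal.ofReal (2 ^ p1) * a1 * ENNReal.ofReal (p / (p1 - p) * c ^ (p1 - p))) *
        ∫⁻ x, ‖f x‖ₑ ^ p := by
  have hp : 0 < p := h0.trans h01
  have hp1 : 0 < p1 := hp.trans h1
  have hF : Measurable fun x => ‖f x‖ₑ := hf.1.enorm
  rw [lintegral_rpow_eq_layer (hm f hf) hp]
  have key : ∀ t ∈ Ioi (0 : ℝ), volume {x | ENNReal.ofReal t < T f x} ≤
      ENNReal.ofReal (2 ^ p0) * a0 * (ENNReal.ofReal (t ^ (-p0)) *
        ∫⁻ x in {x | ENNReal.ofReal (c * t) < ‖f x‖ₑ}, ‖f x‖ₑ ^ p0) +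
      ENNReal.ofReal (2 ^ p1) * a1 * (ENNReal.ofReal (t ^ (-p1)) *
        ∫⁻ x in {x | ‖f x‖ₑ ≤ ENNReal.ofReal (c * t)}, ‖f x‖ₑ ^ p1) := by
    intro t ht
    have ht : 0 < t := ht
    set s := {x | ENNReal.ofReal (c * t) < ‖f x‖ₑ} with hs_def
    have hsm : MeasurableSet s := measurableSet_lt (by fun_prop) hF
    have hsc : sᶜ = {x | ‖f x‖ₑ ≤ ENNReal.ofReal (c * t)} := by
      ext x; simp [hs_def]
    have hdec : T f = T (fun y => s.indicator f y + sᶜ.indicator f y) := by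
      congr 1; ext y; by_cases h : y ∈ s <;> simp [h]
    have hsub : {x | ENNReal.ofReal t < T f x} ⊆
        {x | ENNReal.ofReal (t / 2) < T (s.indicator f) x} ∪
        {x | ENNReal.ofReal (t / 2) < T (sᶜ.indicator f) x} := by
      intro x hx
      by_contra hcon
      simp only [mem_union, mem_ofPred_eq, not_or, not_lt] at hcon hx
      have := hs _ _ (hf.indicator hsm) (hf.indicator hsm.compl) x
      rw [← hdec] at this
      refine absurd (hx.trans_le (this.trans (add_le_add hcon.1 hcon.2))) ?_
      rw [← ENNReal.ofReal_add (by positivity) (by positivity), add_halves]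
      exact lt_irrefl _
    have hone : ∀ (s : Set G) (hsm : MeasurableSet s) (q : ℝ) (hq : 0 < q) (a : ℝ≥0∞)
        (hT : ∀ f, Nice f → ∫⁻ x, T f x ^ q ≤ a * ∫⁻ x, ‖f x‖ₑ ^ q),
        volume {x | ENNReal.ofReal (t / 2) < T (s.indicator f) x} ≤
          ENNReal.ofReal (2 ^ q) * a * (ENNReal.ofReal (t ^ (-q)) * ∫⁻ x in s, ‖f x‖ₑ ^ q) := by
      intro s hsm q hq a hT
      refine (chebyshev_rpow (hm _ (hf.indicator hsm)) hq (half_pos ht)).trans ?_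
      refine (mul_le_mul_right (hT _ (hf.indicator hsm)) _).trans (le_of_eq ?_)
      have : ∫⁻ x, ‖s.indicator f x‖ₑ ^ q = ∫⁻ x in s, ‖f x‖ₑ ^ q := by
        rw [← lintegral_indicator hsm]
        refine lintegral_congr fun x => ?_
        by_cases h : x ∈ s <;> simp [h, ENNReal.zero_rpow_of_pos hq]
      rw [this, Real.div_rpow ht.le (by norm_num), Real.rpow_neg (x := 2) (by norm_num), div_inv_eq_mul,
        mul_comm (t ^ (-q)), ENNReal.ofReal_mul (by positivity)]
      ring
    refine (measure_mono hsub).trans ((measure_union_le _ _).trans ?_)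
    have e0 := hone s hsm p0 h0 a0 hT0
    have e1 := hone sᶜ hsm.compl p1 hp1 a1 hT1
    rw [hsc] at e1
    rw [← hsc] at e1 ⊢
    exact add_le_add e0 e1
  have hmS : ∀ q : ℝ, Measurable fun t : ℝ =>
      ∫⁻ x in {x | ENNReal.ofReal (c * t) < ‖f x‖ₑ}, ‖f x‖ₑ ^ q := by
    intro q
    have hms : MeasurableSet {z : ℝ × G | ENNReal.ofReal (c * z.1) < ‖f z.2‖ₑ} :=
      measurableSet_lt (by fun_prop) (hF.comp measurable_snd)
    have : (fun t : ℝ => ∫⁻ x in {x | ENNReal.ofReal (c * t) < ‖f x‖ₑ}, ‖f x‖ₑ ^ q) = fun t =>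
        ∫⁻ x, {z : ℝ × G | ENNReal.ofReal (c * z.1) < ‖f z.2‖ₑ}.indicator
          (fun z => ‖f z.2‖ₑ ^ q) (t, x) := by
      ext t
      rw [← lintegral_indicator (measurableSet_lt (by fun_prop) hF)]
      rfl
    rw [this]
    exact Measurable.lintegral_prod_right' (Measurable.indicator
      ((hF.comp measurable_snd).pow_const q) hms)
  calc _ ≤ ∫⁻ t in Ioi (0 : ℝ), (ENNReal.ofReal (2 ^ p0) * a0 * (ENNReal.ofReal (p * t ^ (p - 1)) *
        (ENNReal.ofReal (t ^ (-p0)) *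
          ∫⁻ x in {x | ENNReal.ofReal (c * t) < ‖f x‖ₑ}, ‖f x‖ₑ ^ p0)) +
      ENNReal.ofReal (2 ^ p1) * a1 * (ENNReal.ofReal (p * t ^ (p - 1)) *
        (ENNReal.ofReal (t ^ (-p1)) *
          ∫⁻ x in {x | ‖f x‖ₑ ≤ ENNReal.ofReal (c * t)}, ‖f x‖ₑ ^ p1))) := by
        refine setLIntegral_mono' measurableSet_Ioi fun t ht => ?_
        refine (mul_le_mul_right (key t ht) _).trans (le_of_eq ?_)
        ring
    _ ≤ _ := by
        have hm1 : Measurable fun t : ℝ => ENNReal.ofReal (p * t ^ (p - 1)) *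
          (ENNReal.ofReal (t ^ (-p0)) *
            ∫⁻ x in {x | ENNReal.ofReal (c * t) < ‖f x‖ₑ}, ‖f x‖ₑ ^ p0) :=
          Measurable.mul (by fun_prop) (Measurable.mul (by fun_prop) (hmS p0))
        rw [lintegral_add_left (hm1.const_mul _)]
        rw [lintegral_const_mul _ hm1, add_mul]
        refine add_le_add ?_ ?_
        · rw [mul_assoc (_ * a0)]
          exact mul_le_mul_right (layer_high hF h0 h01 hc) _
        · rw [mul_assoc (_ * a1)]
          refine le_trans ?_ (mul_le_mul_right (layer_low hF hp h1 hc) _)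
          have hmL : Measurable fun t : ℝ =>
              ∫⁻ x in {x | ‖f x‖ₑ ≤ ENNReal.ofReal (c * t)}, ‖f x‖ₑ ^ p1 := by
            have hms : MeasurableSet {z : ℝ × G | ‖f z.2‖ₑ ≤ ENNReal.ofReal (c * z.1)} :=
              measurableSet_le (hF.comp measurable_snd) (by fun_prop)
            have : (fun t : ℝ => ∫⁻ x in {x | ‖f x‖ₑ ≤ ENNReal.ofReal (c * t)}, ‖f x‖ₑ ^ p1) =
                fun t => ∫⁻ x, {z : ℝ × G | ‖f z.2‖ₑ ≤ ENNReal.ofReal (c * z.1)}.indicator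
                  (fun z => ‖f z.2‖ₑ ^ p1) (t, x) := by
              ext t
              rw [← lintegral_indicator (measurableSet_le hF (by fun_prop))]
              rfl
            rw [this]
            exact Measurable.lintegral_prod_right' (Measurable.indicator
              ((hF.comp measurable_snd).pow_const p1) hms)
          have hm2 : Measurable fun t : ℝ => ENNReal.ofReal (p * t ^ (p - 1)) *
              (ENNReal.ofReal (t ^ (-p1)) *
                ∫⁻ x in {x | ‖f x‖ₑ ≤ ENNReal.ofReal (c * t)}, ‖f x‖ₑ ^ p1) :=
            Measurable.mul (by fun_prop) (Measurable.mul (by fun_prop) hmL)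
          rw [lintegral_const_mul _ hm2]

/-- Marcinkiewicz interpolation with explicit dependence on the endpoint constants. -/
theorem marcinkiewicz {p0 p p1 : ℝ} (h0 : 0 < p0) (h01 : p0 < p) (h1 : p < p1) :
    ∃ C : ℝ, 0 < C ∧ ∀ (T : (G → ℝ) → G → ℝ≥0∞), (∀ f, Nice f → Measurable (T f)) →
    (∀ f g, Nice f → Nice g → ∀ x, T (fun y => f y + g y) x ≤ T f x + T g x) →
    ∀ a0 a1 : ℝ, 0 < a0 → 0 < a1 →
    (∀ f, Nice f → ∫⁻ x, T f x ^ p0 ≤ ENNReal.ofReal a0 * ∫⁻ x, ‖f x‖ₑ ^ p0) →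
    (∀ f, Nice f → ∫⁻ x, T f x ^ p1 ≤ ENNReal.ofReal a1 * ∫⁻ x, ‖f x‖ₑ ^ p1) →
    ∀ f, Nice f → ∫⁻ x, T f x ^ p ≤
      ENNReal.ofReal (C * a0 ^ ((p1 - p) / (p1 - p0)) * a1 ^ ((p - p0) / (p1 - p0))) *
        ∫⁻ x, ‖f x‖ₑ ^ p := by
  have hp : 0 < p := h0.trans h01
  have hd : 0 < p1 - p0 := by linarith
  have A1 : 0 < 2 ^ p0 * (p / (p - p0)) := mul_pos (by positivity) (div_pos hp (by linarith))
  have A2 : 0 < 2 ^ p1 * (p / (p1 - p)) := mul_pos (by positivity) (div_pos hp (by linarith))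
  refine ⟨2 ^ p0 * (p / (p - p0)) + 2 ^ p1 * (p / (p1 - p)), by positivity,
    fun T hm hs a0 a1 ha0 ha1 hT0 hT1 f hf => ?_⟩
  set c := (a0 / a1) ^ (1 / (p1 - p0)) with hc_def
  have hc : 0 < c := by positivity
  refine (marcinkiewicz_aux T h0 h01 h1 hm hs hT0 hT1 hc hf).trans ?_
  gcongr
  rw [← ENNReal.ofReal_mul (by positivity), ← ENNReal.ofReal_mul (by positivity),
    ← ENNReal.ofReal_mul (by positivity), ← ENNReal.ofReal_mul (by positivity),
    ← ENNReal.ofReal_add (mul_nonneg (by positivity) (mul_nonneg (div_nonneg hp.le (by linarith))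
      (by positivity))) (mul_nonneg (by positivity) (mul_nonneg (div_nonneg hp.le (by linarith))
      (by positivity)))]
  refine ENNReal.ofReal_le_ofReal (le_of_eq ?_)
  have e1 : a0 * c ^ (p0 - p) = a0 ^ ((p1 - p) / (p1 - p0)) * a1 ^ ((p - p0) / (p1 - p0)) := by
    rw [hc_def, ← Real.rpow_mul (by positivity), Real.div_rpow ha0.le ha1.le, div_eq_mul_inv,
      ← Real.rpow_neg ha1.le, ← mul_assoc]
    nth_rewrite 1 [← Real.rpow_one a0]
    rw [← Real.rpow_add ha0]
    congr 2 <;> field_simp <;> ring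
  have e2 : a1 * c ^ (p1 - p) = a0 ^ ((p1 - p) / (p1 - p0)) * a1 ^ ((p - p0) / (p1 - p0)) := by
    rw [hc_def, ← Real.rpow_mul (by positivity), Real.div_rpow ha0.le ha1.le, div_eq_mul_inv,
      ← Real.rpow_neg ha1.le, mul_left_comm]
    nth_rewrite 1 [← Real.rpow_one a1]
    rw [← Real.rpow_add ha1]
    congr 2 <;> field_simp <;> ring
  linear_combination (2 ^ p0 * (p / (p - p0))) * e1 + (2 ^ p1 * (p / (p1 - p))) * e2

/-! Directional dyadic maximal functions. -/

theorem lintegral_comp_sub_mul {H : ℝ → ℝ≥0∞} (hH : Measurable H) (x : ℝ) {r : ℝ} (hr : r ≠ 0) :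
    ∫⁻ s, H (x - s * r) = ENNReal.ofReal |r⁻¹| * ∫⁻ u, H u := by
  have h1 : ∫⁻ s, H (x - s * r) = ∫⁻ u, H (x - u) ∂(Measure.map (· * r) volume) := by
    rw [lintegral_map (by fun_prop) (by fun_prop)]
  rw [h1, Real.map_volume_mul_right hr, lintegral_smul_measure, lintegral_sub_left_eq_self,
    smul_eq_mul]

theorem setLIntegral_comp_sub_mul {H : ℝ → ℝ≥0∞} (hH : Measurable H) (x : ℝ) {r : ℝ}
    (hr : r ≠ 0) {R : ℝ} : ∫⁻ s in Icc (-R) R, H (x - s * r) =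
      ENNReal.ofReal |r⁻¹| * ∫⁻ u in Metric.closedBall x (R * |r|), H u := by
  rw [← lintegral_indicator measurableSet_closedBall, ← lintegral_indicator measurableSet_Icc,
    ← lintegral_comp_sub_mul (hH.indicator measurableSet_closedBall) x hr]
  refine lintegral_congr fun s => ?_
  have : s ∈ Icc (-R) R ↔ x - s * r ∈ Metric.closedBall x (R * |r|) := by
    rw [Metric.mem_closedBall, Real.dist_eq, mem_Icc, ← abs_le, sub_sub_cancel_left, abs_neg,
      abs_mul, mul_le_mul_iff_left₀ (abs_pos.2 hr)]
  by_cases h : s ∈ Icc (-R) R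
  · rw [indicator_of_mem h, indicator_of_mem (this.1 h)]
  · rw [indicator_of_notMem h, indicator_of_notMem (fun h' => h (this.2 h'))]

/-- One-dimensional dyadic maximal function at base scale `h`. -/
def hl (h : ℝ) (F : ℝ → ℝ≥0∞) (x : ℝ) : ℝ≥0∞ :=
  ⨆ n : ℕ, ∫⁻ s in Icc (-1 : ℝ) 1, F (x - (s * 2 ^ n) * h)

theorem measurable_hl {h : ℝ} {F : ℝ → ℝ≥0∞} (hF : Measurable F) : Measurable (hl h F) := by
  unfold hl
  refine Measurable.iSup fun n => ?_
  exact Measurable.lintegral_prod_right' (f := fun z : ℝ × ℝ => F (z.1 - (z.2 * 2 ^ n) * h))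
    (by fun_prop)

theorem hl_weak {h : ℝ} (hh : h ≠ 0) {F : ℝ → ℝ≥0∞} (hF : Measurable F) {t : ℝ} (ht : 0 < t) :
    volume {x | ENNReal.ofReal t < hl h F x} ≤ ENNReal.ofReal (10 / t) * ∫⁻ x, F x := by
  rcases eq_or_ne (∫⁻ x, F x) ∞ with hI | hI
  · rw [hI, ENNReal.mul_top]
    · exact le_top
    · simpa using ht
  set I := (∫⁻ x, F x).toReal with hIdef
  have hex : ∀ x : {x | ENNReal.ofReal t < hl h F x}, ∃ r : ℝ, 0 < r ∧
      ENNReal.ofReal (t * r) ≤ ∫⁻ u in Metric.closedBall (x : ℝ) r, F u := by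
    rintro ⟨x, hx⟩
    obtain ⟨n, hn⟩ := lt_iSup_iff.1 (show ENNReal.ofReal t < hl h F x from hx)
    have hr : (2 ^ n * h : ℝ) ≠ 0 := by positivity
    have hr' : 0 < |(2 ^ n * h : ℝ)| := abs_pos.2 hr
    refine ⟨|2 ^ n * h|, hr', ?_⟩
    simp_rw [mul_assoc] at hn
    rw [setLIntegral_comp_sub_mul hF x hr, one_mul, abs_inv] at hn
    rw [ENNReal.ofReal_mul ht.le]
    calc _ ≤ (ENNReal.ofReal |2 ^ n * h|⁻¹ * ∫⁻ u in Metric.closedBall x |2 ^ n * h|, F u) *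
          ENNReal.ofReal |2 ^ n * h| := by gcongr
      _ = (ENNReal.ofReal |2 ^ n * h|⁻¹ * ENNReal.ofReal |2 ^ n * h|) *
          ∫⁻ u in Metric.closedBall x |2 ^ n * h|, F u := by ring
      _ = _ := by
          rw [← ENNReal.ofReal_mul (by positivity), inv_mul_cancel₀ hr'.ne']; simp
  choose r hr0 hr using hex
  have hrb : ∀ x, r x ≤ I / t := by
    intro x
    rw [le_div_iff₀' ht, hIdef, ← ENNReal.ofReal_le_iff_le_toReal hI]
    exact (hr x).trans (setLIntegral_le_lintegral _ _)
  obtain ⟨u, -, hdisj, hcov⟩ := Vitali.exists_disjoint_subfamily_covering_enlargement_closedBall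
    (Set.univ : Set {x | ENNReal.ofReal t < hl h F x}) (fun x => (x : ℝ)) r (I / t)
    (fun a _ => hrb a) 5 (by norm_num)
  have hcount : u.Countable := hdisj.countable_of_nonempty_interior fun a _ => by
    rw [interior_closedBall _ (hr0 a).ne']
    exact Metric.nonempty_ball.2 (hr0 a)
  have hsub : {x | ENNReal.ofReal t < hl h F x} ⊆
      ⋃ a ∈ u, Metric.closedBall (a : ℝ) (5 * r a) := by
    intro x hx
    obtain ⟨b, hb, hb'⟩ := hcov ⟨x, hx⟩ (mem_univ _)
    exact mem_biUnion hb (hb' (Metric.mem_closedBall_self (hr0 _).le))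
  calc volume {x | ENNReal.ofReal t < hl h F x}
      ≤ volume (⋃ a ∈ u, Metric.closedBall (a : ℝ) (5 * r a)) := measure_mono hsub
    _ ≤ ∑' a : u, volume (Metric.closedBall ((a : _) : ℝ) (5 * r a)) :=
        measure_biUnion_le _ hcount _
    _ ≤ ∑' a : u, ENNReal.ofReal (10 / t) * ∫⁻ v in Metric.closedBall ((a : _) : ℝ) (r a), F v := by
        refine ENNReal.tsum_le_tsum fun a => ?_
        rw [Real.volume_closedBall]
        refine le_trans ?_ (mul_le_mul_right (hr a) _)
        rw [← ENNReal.ofReal_mul (by positivity)]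
        refine ENNReal.ofReal_le_ofReal (le_of_eq ?_)
        field_simp
        ring
    _ = ENNReal.ofReal (10 / t) * ∫⁻ v in ⋃ a ∈ u, Metric.closedBall (a : ℝ) (r a), F v := by
        rw [ENNReal.tsum_mul_left, lintegral_biUnion hcount (fun _ _ => measurableSet_closedBall) hdisj]
    _ ≤ _ := mul_le_mul_right (setLIntegral_le_lintegral _ _) _

theorem hl_strong {q : ℝ} (hq : 1 < q) : ∃ C : ℝ, 0 < C ∧ ∀ h : ℝ, h ≠ 0 → ∀ F : ℝ → ℝ≥0∞,
    Measurable F → ∫⁻ x, hl h F x ^ q ≤ ENNReal.ofReal C * ∫⁻ x, F x ^ q := by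
  have hq0 : 0 < q := by linarith
  have hq1 : 0 < q - 1 := by linarith
  refine ⟨20 * (q / (q - 1) * (1 / 4) ^ (1 - q)), by positivity, fun h hh F hF => ?_⟩
  rw [lintegral_rpow_eq_layer (measurable_hl hF) hq0]
  have key : ∀ t ∈ Ioi (0 : ℝ), volume {x | ENNReal.ofReal t < hl h F x} ≤
      ENNReal.ofReal 20 * (ENNReal.ofReal (t ^ (-1 : ℝ)) *
        ∫⁻ x in {x | ENNReal.ofReal (1 / 4 * t) < F x}, F x ^ (1 : ℝ)) := by
    intro t ht
    have ht : 0 < t := ht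
    set s := {x | ENNReal.ofReal (1 / 4 * t) < F x} with hs
    have hsm : MeasurableSet s := measurableSet_lt (by fun_prop) hF
    have hsub : {x | ENNReal.ofReal t < hl h F x} ⊆
        {x | ENNReal.ofReal (t / 2) < hl h (s.indicator F) x} := by
      intro x hx
      by_contra hcon
      simp only [mem_ofPred_eq, not_lt] at hx hcon
      refine absurd hx (not_lt.2 ?_)
      refine iSup_le fun n => ?_
      calc ∫⁻ v in Icc (-1 : ℝ) 1, F (x - v * 2 ^ n * h)
          ≤ ∫⁻ v in Icc (-1 : ℝ) 1, (s.indicator F (x - v * 2 ^ n * h) +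
              ENNReal.ofReal (1 / 4 * t)) := by
            refine lintegral_mono fun v => ?_
            by_cases h : x - v * 2 ^ n * h ∈ s
            · simp [h]
            · simp only [h, not_false_eq_true, indicator_of_notMem, zero_add]
              simpa [hs] using h
        _ = (∫⁻ v in Icc (-1 : ℝ) 1, s.indicator F (x - v * 2 ^ n * h)) + ENNReal.ofReal (t / 2) := by
            rw [lintegral_add_right _ measurable_const, setLIntegral_const, Real.volume_Icc,
              ← ENNReal.ofReal_mul (by positivity)]
            congr 2; ring
        _ ≤ ENNReal.ofReal (t / 2) + ENNReal.ofReal (t / 2) := by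
            gcongr
            exact (le_iSup (fun n : ℕ => ∫⁻ v in Icc (-1 : ℝ) 1, s.indicator F (x - v * 2 ^ n * h)) n).trans
              hcon
        _ = _ := by rw [← ENNReal.ofReal_add (by positivity) (by positivity), add_halves]
    refine (measure_mono hsub).trans ((hl_weak hh (hF.indicator hsm) (half_pos ht)).trans (le_of_eq ?_))
    rw [lintegral_indicator hsm, ← mul_assoc, ← ENNReal.ofReal_mul (by norm_num), Real.rpow_neg_one]
    simp_rw [ENNReal.rpow_one]
    congr 2
    field_simp
    norm_num
  calc _ ≤ ∫⁻ t in Ioi (0 : ℝ), ENNReal.ofReal 20 * (ENNReal.ofReal (q * t ^ (q - 1)) *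
        (ENNReal.ofReal (t ^ (-1 : ℝ)) *
        ∫⁻ x in {x | ENNReal.ofReal (1 / 4 * t) < F x}, F x ^ (1 : ℝ))) := by
        refine setLIntegral_mono' measurableSet_Ioi fun t ht => ?_
        refine (mul_le_mul_right (key t ht) _).trans (le_of_eq ?_)
        ring
    _ ≤ ENNReal.ofReal 20 * (ENNReal.ofReal (q / (q - 1) * (1 / 4) ^ (1 - q)) * ∫⁻ x, F x ^ q) := by
        rw [lintegral_const_mul' _ _ ENNReal.ofReal_ne_top]
        exact mul_le_mul_right (layer_high hF one_pos hq (by norm_num)) _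
    _ = _ := by rw [← mul_assoc, ← ENNReal.ofReal_mul (by norm_num)]

/-- Dyadic maximal function in direction `d`. -/
def MD (d : G) (F : G → ℝ≥0∞) (x : G) : ℝ≥0∞ :=
  ⨆ n : ℕ, ∫⁻ s in Icc (-1 : ℝ) 1, F (x - (s * 2 ^ n) • d)

theorem measurable_MD {d : G} {F : G → ℝ≥0∞} (hF : Measurable F) : Measurable (MD d F) := by
  unfold MD
  refine Measurable.iSup fun n => ?_
  exact Measurable.lintegral_prod_right' (f := fun z : G × ℝ => F (z.1 - (z.2 * 2 ^ n) • d))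
    (by fun_prop)

/-- A coordinate direction: nonzero vector on one of the two axes. -/
def IsAxis (d : G) : Prop := (d.1 ≠ 0 ∧ d.2 = 0) ∨ (d.1 = 0 ∧ d.2 ≠ 0)

theorem MD_strong {q : ℝ} (hq : 1 < q) : ∃ C : ℝ, 0 < C ∧ ∀ d : G, IsAxis d → ∀ F : G → ℝ≥0∞,
    Measurable F → ∫⁻ x, MD d F x ^ q ≤ ENNReal.ofReal C * ∫⁻ x, F x ^ q := by
  obtain ⟨C, hC, H⟩ := hl_strong hq
  refine ⟨C, hC, fun d hd F hF => ?_⟩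
  have hm := (measurable_MD (d := d) hF).pow_const q
  rcases hd with ⟨h1, h2⟩ | ⟨h1, h2⟩
  · rw [Measure.volume_eq_prod, lintegral_prod_symm' _ hm, lintegral_prod_symm' _ (hF.pow_const q),
      ← lintegral_const_mul _ (Measurable.lintegral_prod_left' (f := fun z : G => F z ^ q)
        (hF.pow_const q))]
    refine lintegral_mono fun y => ?_
    have := H d.1 h1 (fun x => F (x, y)) (by fun_prop)
    refine le_trans (le_of_eq ?_) this
    refine lintegral_congr fun x => ?_
    simp only [MD, hl]
    congr 3 with n
    congr 1 with s
    congr 1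
    ext <;> simp [h2]
  · rw [Measure.volume_eq_prod, lintegral_prod _ hm.aemeasurable,
      lintegral_prod _ (hF.pow_const q).aemeasurable,
      ← lintegral_const_mul _ (Measurable.lintegral_prod_right' (f := fun z : G => F z ^ q)
        (hF.pow_const q))]
    refine lintegral_mono fun x => ?_
    have := H d.2 h2 (fun y => F (x, y)) (by fun_prop)
    refine le_trans (le_of_eq ?_) this
    refine lintegral_congr fun y => ?_
    simp only [MD, hl]
    congr 3 with n
    congr 1 with s
    congr 1
    ext <;> simp [h1]

section

variable {E : Type*} [NormedAddCommGroup E] [NormedSpace ℝ E]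

/-! Measures on segments and dyadic chains. -/

/-- The segment `[-R, R] d`. -/
def seg (d : G) (R : ℝ) : Set G := (fun v : ℝ => v • d) '' Icc (-R) R

theorem measurableSet_seg (d : G) (R : ℝ) : MeasurableSet (seg d R) :=
  (isCompact_Icc.image (by fun_prop)).measurableSet

theorem norm_le_of_mem_seg {d : G} {R : ℝ} {y : G} (hy : y ∈ seg d R) : ‖y‖ ≤ R * ‖d‖ := by
  obtain ⟨v, hv, rfl⟩ := hy
  simp only [norm_smul]
  exact mul_le_mul_of_nonneg_right (abs_le.2 hv) (norm_nonneg _)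

/-- Probability measures carried by a segment. -/
structure SegProb (d : G) (R : ℝ) (ν : Measure G) : Prop where
  prob : IsProbabilityMeasure ν
  supp : ∀ᵐ y ∂ν, y ∈ seg d R

theorem SegProb.cProb {d : G} {R : ℝ} {ν : Measure G} (h : SegProb d R ν) : CProb ν :=
  ⟨h.prob, R * ‖d‖, h.supp.mono fun _ hy => norm_le_of_mem_seg hy⟩

theorem SegProb.conv {d : G} {R R' : ℝ} {μ ν : Measure G} (hμ : SegProb d R μ)
    (hν : SegProb d R' ν) : SegProb d (R + R') (μ ∗ ν) := by
  have := hμ.prob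
  have := hν.prob
  refine ⟨inferInstance, ?_⟩
  unfold Measure.conv
  refine (ae_map_iff (p := (· ∈ seg d _)) (by fun_prop) (measurableSet_seg d _)).2 ?_
  have h1 : ∀ᵐ z ∂(μ.prod ν), z.1 ∈ seg d R := Measure.quasiMeasurePreserving_fst.ae hμ.supp
  have h2 : ∀ᵐ z ∂(μ.prod ν), z.2 ∈ seg d R' := Measure.quasiMeasurePreserving_snd.ae hν.supp
  filter_upwards [h1, h2] with z ⟨v, hv, hv'⟩ ⟨w, hw, hw'⟩
  exact ⟨v + w, ⟨by linarith [hv.1, hw.1], by linarith [hv.2, hw.2]⟩, by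
    simp only at hv' hw' ⊢; rw [add_smul, hv', hw']⟩

theorem CProb.conv {μ ν : Measure G} (hμ : CProb μ) (hν : CProb ν) : CProb (μ ∗ ν) := by
  have := hμ.prob
  have := hν.prob
  obtain ⟨R, hR⟩ := hμ.supp
  obtain ⟨R', hR'⟩ := hν.supp
  refine ⟨inferInstance, R + R', ?_⟩
  unfold Measure.conv
  rw [ae_map_iff (by fun_prop) (measurableSet_le (by fun_prop) (by fun_prop))]
  filter_upwards [Measure.quasiMeasurePreserving_fst.ae hR,
    Measure.quasiMeasurePreserving_snd.ae hR'] with z h1 h2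
  exact (norm_add_le _ _).trans (add_le_add h1 h2)

theorem lavg_conv {μ ν : Measure G} [SFinite μ] [SFinite ν] {F : G → ℝ≥0∞} (hF : Measurable F)
    (x : G) : lavg (μ ∗ ν) F x = lavg μ (lavg ν F) x := by
  unfold lavg
  rw [Measure.lintegral_conv (by fun_prop)]
  simp_rw [sub_sub]

theorem avg_conv {μ ν : Measure G} (hμ : CProb μ) (hν : CProb ν) {f : G → E} (hf : Nice f) :
    avg (μ ∗ ν) f = avg μ (avg ν f) := by
  have := hμ.prob
  have := hν.prob
  ext x
  unfold avg
  rw [integral_conv (hf.integrable_sub (hμ.conv hν) x)]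
  simp_rw [sub_sub]

/-- Normalized measure on the segment `[-1,1] d`. -/
def box (d : G) : Measure G :=
  Measure.map (fun s : ℝ => s • d) (ENNReal.ofReal (1 / 2) • volume.restrict (Icc (-1) 1))

theorem segProb_box (d : G) (r : ℝ) (hr : 0 ≤ r) : SegProb d r (box (r • d)) := by
  refine ⟨⟨?_⟩, ?_⟩
  · rw [box, Measure.map_apply (by fun_prop) MeasurableSet.univ]
    simp only [preimage_univ, Measure.smul_apply, Measure.restrict_apply_univ, Real.volume_Icc,
      smul_eq_mul]
    rw [← ENNReal.ofReal_mul (by norm_num)]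
    norm_num
  · refine (ae_map_iff (p := (· ∈ seg d _)) (by fun_prop) (measurableSet_seg d _)).2 ?_
    refine Measure.ae_smul_measure ?_ _
    refine (ae_restrict_iff' measurableSet_Icc).2 (Eventually.of_forall fun s hs => ?_)
    exact ⟨s * r, ⟨by nlinarith [hs.1], by nlinarith [hs.2]⟩, mul_smul _ _ _⟩

theorem lavg_box {d : G} {F : G → ℝ≥0∞} (hF : Measurable F) (x : G) :
    lavg (box d) F x = ENNReal.ofReal (1 / 2) * ∫⁻ s in Icc (-1 : ℝ) 1, F (x - s • d) := by
  unfold lavg box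
  rw [lintegral_map (by fun_prop) (by fun_prop), lintegral_smul_measure, smul_eq_mul]

theorem avg_box {d : G} {f : G → E} (hf : Nice f) (x : G) :
    avg (box d) f x = (1 / 2 : ℝ) • ∫ s in Icc (-1 : ℝ) 1, f (x - s • d) := by
  unfold avg box
  rw [integral_map (by fun_prop), integral_smul_measure]
  · simp
  · exact (hf.1.comp_measurable (by fun_prop)).aestronglyMeasurable

/-- The chain of smoothing measures at scales `2^n`. -/
def chain (d : G) : ℕ → Measure G
  | 0 => Measure.dirac 0
  | n + 1 => box ((2 : ℝ) ^ n • d) ∗ (box ((2 : ℝ) ^ n • d) ∗ chain d n)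

theorem segProb_chain (d : G) (n : ℕ) : SegProb d (2 * 2 ^ n) (chain d n) := by
  have aux : SegProb d (2 * (2 ^ n - 1)) (chain d n) := by
    induction n with
    | zero =>
      refine ⟨by unfold chain; infer_instance, ?_⟩
      refine (ae_dirac_iff (p := (· ∈ seg d _)) (measurableSet_seg d _)).2 ?_
      exact ⟨0, by norm_num, by simp⟩
    | succ n ih =>
      have h := segProb_box d (2 ^ n) (by positivity)
      have := h.conv (h.conv ih)
      rw [chain]
      convert this using 1
      ring
  refine ⟨aux.prob, aux.supp.mono fun y hy => ?_⟩
  refine image_mono (Icc_subset_Icc ?_ ?_) hy <;> linarith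

theorem cProb_chain (d : G) (n : ℕ) : CProb (chain d n) := (segProb_chain d n).cProb

theorem cProb_box (d : G) : CProb (box d) := by
  simpa using (segProb_box d 1 zero_le_one).cProb

theorem avg_chain_zero [CompleteSpace E] {d : G} {f : G → E} (hf : Nice f) : avg (chain d 0) f = f := by
  ext x
  unfold avg chain
  rw [integral_dirac' (fun y => f (x - y)) 0 (hf.1.comp_measurable (by fun_prop)), sub_zero]

theorem avg_chain_succ {d : G} {f : G → E} (hf : Nice f) (n : ℕ) : avg (chain d (n + 1)) f =
    avg (box ((2 : ℝ) ^ n • d)) (avg (box ((2 : ℝ) ^ n • d)) (avg (chain d n) f)) := by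
  have h := cProb_box ((2 : ℝ) ^ n • d)
  rw [chain, avg_conv h (h.conv (cProb_chain d n)) hf, avg_conv h (cProb_chain d n) hf]

theorem setLIntegral_line_le {d : G} {F : G → ℝ≥0∞} (hF : Measurable F) (x : G) (m : ℕ) {T : ℝ}
    (hT : T ≤ 2 ^ m) :
    ∫⁻ w in Icc (-T) T, F (x - w • d) ≤ ENNReal.ofReal (2 ^ m) * MD d F x := by
  have h2 : (2 ^ m : ℝ) ≠ 0 := by positivity
  have hH : Measurable fun w : ℝ => F (x + w • d) := by fun_prop
  have h := setLIntegral_comp_sub_mul hH 0 h2 (R := 1)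
  have e : ∫⁻ w in Icc (-T) T, F (x - w • d) ≤
      ∫⁻ w in Metric.closedBall (0 : ℝ) (1 * |2 ^ m|), F (x + w • d) := by
    have h3 := setLIntegral_comp_sub_mul hH 0 (neg_ne_zero.2 one_ne_zero) (R := 2 ^ m)
    simp only [abs_neg, abs_one, mul_one, inv_neg, inv_one, ENNReal.ofReal_one, one_mul, zero_sub,
      mul_neg, neg_neg] at h3
    have h4 := setLIntegral_comp_sub_mul hH 0 one_ne_zero (R := 2 ^ m)
    simp only [mul_one, zero_sub, inv_one, abs_one, ENNReal.ofReal_one, one_mul, neg_smul] at h4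
    rw [one_mul, abs_of_pos (by positivity), ← h4]
    simp_rw [← sub_eq_add_neg]
    exact lintegral_mono_set (Icc_subset_Icc (neg_le_neg hT) hT)
  have h5 : ∫⁻ w in Metric.closedBall (0 : ℝ) (1 * |2 ^ m|), F (x + w • d) =
      ENNReal.ofReal (2 ^ m) * ∫⁻ s in Icc (-1 : ℝ) 1, F (x - (s * 2 ^ m) • d) := by
    simp only [zero_sub, neg_smul, ← sub_eq_add_neg] at h
    rw [h, ← mul_assoc, ← ENNReal.ofReal_mul (by positivity), abs_of_pos (a := ((2 : ℝ) ^ m)⁻¹)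
      (by positivity), mul_inv_cancel₀ h2, ENNReal.ofReal_one, one_mul, one_mul]
  refine e.trans (h5.le.trans ?_)
  gcongr
  exact le_iSup (fun n : ℕ => ∫⁻ s in Icc (-1 : ℝ) 1, F (x - (s * 2 ^ n) • d)) m

theorem lavg_box_seg_le {d : G} {R r t : ℝ} {ν : Measure G} (hν : SegProb d R ν) (hr : 0 < r)
    {F : G → ℝ≥0∞} (hF : Measurable F) {m : ℕ} (h : |t| + r + R ≤ 2 ^ m) (x : G) :
    lavg (box (r • d)) (lavg ν F) (x + t • d) ≤ ENNReal.ofReal (2 ^ m / (2 * r)) * MD d F x := by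
  have := hν.prob
  have hmeas : Measurable (lavg ν F) := measurable_lavg hF
  rw [lavg_box hmeas]
  have e1 : ∫⁻ s in Icc (-1 : ℝ) 1, lavg ν F (x + t • d - s • r • d) =
      ∫⁻ y, (∫⁻ s in Icc (-1 : ℝ) 1, F (x + t • d - s • r • d - y)) ∂ν := by
    unfold lavg
    rw [lintegral_lintegral_swap (by fun_prop)]
  have e2 : ∀ᵐ y ∂ν, ∫⁻ s in Icc (-1 : ℝ) 1, F (x + t • d - s • r • d - y) ≤
      ENNReal.ofReal r⁻¹ * (ENNReal.ofReal (2 ^ m) * MD d F x) := by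
    filter_upwards [hν.supp] with y ⟨v, hv, hvy⟩
    have hH : Measurable fun w : ℝ => F (x + w • d) := by fun_prop
    have := setLIntegral_comp_sub_mul hH (t - v) hr.ne' (R := 1)
    have e3 : ∀ s : ℝ, x + t • d - s • r • d - y = x + (t - v - s * r) • d := by
      intro s
      simp only at hvy
      rw [← hvy, sub_smul, sub_smul, mul_smul]
      abel
    simp_rw [e3]
    rw [this, abs_of_pos (by positivity), abs_of_pos hr, one_mul]
    gcongr
    refine le_trans ?_ (setLIntegral_line_le hF x m le_rfl)
    have h4 := setLIntegral_comp_sub_mul hH 0 one_ne_zero (R := 2 ^ m)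
    simp only [mul_one, zero_sub, inv_one, abs_one, ENNReal.ofReal_one, one_mul, neg_smul] at h4
    simp_rw [← sub_eq_add_neg] at h4
    rw [h4]
    refine lintegral_mono_set (Metric.closedBall_subset_closedBall' ?_)
    rw [Real.dist_eq, sub_zero]
    have := abs_sub t v
    have : |v| ≤ R := abs_le.2 hv
    linarith
  rw [e1]
  calc _ ≤ ENNReal.ofReal (1 / 2) * ∫⁻ _, ENNReal.ofReal r⁻¹ * (ENNReal.ofReal (2 ^ m) * MD d F x) ∂ν := by
        gcongr 1
        exact lintegral_mono_ae e2
    _ = _ := by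
        rw [lintegral_const, measure_univ, mul_one, ← mul_assoc, ← mul_assoc,
          ← ENNReal.ofReal_mul (by norm_num), ← ENNReal.ofReal_mul (by positivity)]
        congr 2
        field_simp

theorem lavg_box_chain_le {d : G} {F : G → ℝ≥0∞} (hF : Measurable F) (n : ℕ) {t : ℝ}
    (ht : |t| ≤ 2 ^ n) (x : G) :
    lavg (box ((2 : ℝ) ^ n • d)) (lavg (chain d n) F) (x + t • d) ≤ 2 * MD d F x := by
  refine (lavg_box_seg_le (segProb_chain d n) (by positivity) hF (m := n + 2) ?_ x).trans
    (le_of_eq ?_)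
  · rw [pow_add]; linarith
  · congr 1
    rw [show ((2 : ℝ) ^ (n + 2) / (2 * 2 ^ n)) = 2 by rw [pow_add]; field_simp; try norm_num]
    simp

theorem lavg_chain_succ_le {d : G} {F : G → ℝ≥0∞} (hF : Measurable F) (n : ℕ) {t : ℝ}
    (ht : |t| ≤ 4 * 2 ^ n) (x : G) :
    lavg (chain d (n + 1)) F (x + t • d) ≤ 4 * MD d F x := by
  have hb := segProb_box d (2 ^ n) (by positivity)
  have := hb.prob
  have := (hb.conv (segProb_chain d n)).prob
  rw [chain, lavg_conv hF]
  refine (lavg_box_seg_le (hb.conv (segProb_chain d n)) (by positivity) hF (m := n + 3) ?_ x).trans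
    (le_of_eq ?_)
  · rw [pow_add]; linarith
  · congr 1
    rw [show ((2 : ℝ) ^ (n + 3) / (2 * 2 ^ n)) = 4 by rw [pow_add]; field_simp; norm_num]
    simp

end

/-! The curve averages and their domination by directional maximal functions. -/

theorem MD_smul_le (d : G) (c : ℕ) (F : G → ℝ≥0∞) (x : G) : MD ((2 : ℝ) ^ c • d) F x ≤ MD d F x := by
  refine iSup_le fun n => ?_
  refine le_trans (le_of_eq ?_)
    (le_iSup (fun n : ℕ => ∫⁻ s in Icc (-1 : ℝ) 1, F (x - (s * 2 ^ n) • d)) (n + c))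
  simp_rw [smul_smul, pow_add, mul_assoc]

theorem MD_mono {d : G} {F F' : G → ℝ≥0∞} (h : ∀ x, F x ≤ F' x) (x : G) : MD d F x ≤ MD d F' x :=
  iSup_mono fun _ => lintegral_mono fun _ => h _

theorem MD_const_mul {d : G} {F : G → ℝ≥0∞} (c : ℝ≥0∞) (hF : Measurable F) (x : G) :
    MD d (fun y => c * F y) x = c * MD d F x := by
  unfold MD
  rw [ENNReal.mul_iSup]
  congr 1
  ext n
  rw [lintegral_const_mul _ (by fun_prop)]

theorem lavg_chain_succ_le' {d : G} {F : G → ℝ≥0∞} (hF : Measurable F) (n m : ℕ) {t : ℝ}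
    (ht : |t| ≤ 2 ^ m * 2 ^ n) (x : G) :
    lavg (chain d (n + 1)) F (x + t • d) ≤ ENNReal.ofReal (2 ^ (m + 2)) * MD d F x := by
  have hb := segProb_box d (2 ^ n) (by positivity)
  have := hb.prob
  have := (hb.conv (segProb_chain d n)).prob
  rw [chain, lavg_conv hF]
  refine (lavg_box_seg_le (hb.conv (segProb_chain d n)) (by positivity) hF (m := n + m + 3) ?_ x).trans
    (le_of_eq ?_)
  · have : (1 : ℝ) ≤ 2 ^ m := one_le_pow₀ (by norm_num)
    have h2 : (0 : ℝ) < 2 ^ n := by positivity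
    rw [pow_add, pow_add]
    nlinarith
  · congr 2
    rw [pow_add, pow_add, pow_add]
    field_simp

/-- The image of arclength-type measure on the curve `(s X, s^b Y)`, `1 ≤ s ≤ 2`. -/
def cur (b X Y : ℝ) : Measure G :=
  Measure.map (fun s : ℝ => ((s * X, s ^ b * Y) : G)) (volume.restrict (Icc 1 2))

theorem measurable_curPar (b X Y : ℝ) : Measurable fun s : ℝ => ((s * X, s ^ b * Y) : G) := by
  fun_prop

theorem rpow_le_two_rpow {b s : ℝ} (hb : 0 ≤ b) (hs : s ∈ Icc (1 : ℝ) 2) : |s ^ b| ≤ 2 ^ b := by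
  have : 0 ≤ s := by linarith [hs.1]
  rw [abs_of_nonneg (by positivity)]
  exact Real.rpow_le_rpow this hs.2 hb

theorem cProb_cur {b : ℝ} (hb : 0 ≤ b) (X Y : ℝ) : CProb (cur b X Y) := by
  refine ⟨⟨?_⟩, max (2 * |X|) (2 ^ b * |Y|), ?_⟩
  · rw [cur, Measure.map_apply (measurable_curPar b X Y) MeasurableSet.univ]
    norm_num
  · unfold cur
    rw [ae_map_iff (measurable_curPar b X Y).aemeasurable
      (measurableSet_le (by fun_prop) (by fun_prop))]
    refine (ae_restrict_iff' measurableSet_Icc).2 (Eventually.of_forall fun s hs => ?_)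
    rw [Prod.norm_def]
    refine max_le_max ?_ ?_
    · simp only [norm_mul, Real.norm_eq_abs]
      rw [abs_of_nonneg (by linarith [hs.1] : (0 : ℝ) ≤ s)]
      exact mul_le_mul_of_nonneg_right hs.2 (abs_nonneg _)
    · simp only [norm_mul, Real.norm_eq_abs]
      exact mul_le_mul_of_nonneg_right (rpow_le_two_rpow hb hs) (abs_nonneg _)

theorem lavg_cur {b X Y : ℝ} {F : G → ℝ≥0∞} (hF : Measurable F) (x : G) :
    lavg (cur b X Y) F x = ∫⁻ s in Icc (1 : ℝ) 2, F (x - (s * X, s ^ b * Y)) := by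
  unfold lavg cur
  rw [lintegral_map (by fun_prop) (measurable_curPar b X Y)]

theorem setLIntegral_rpow_le {b ρ : ℝ} (hb : 1 < b) (hρ : ρ ∈ Icc (1 : ℝ) 4) {g : ℝ → ℝ≥0∞} :
    ∫⁻ s in Icc (1 : ℝ) 2, g (ρ * s ^ b) ≤ ∫⁻ v in Icc (-(4 * 2 ^ b)) (4 * 2 ^ b), g v := by
  have hd : ∀ s ∈ Icc (1 : ℝ) 2, HasDerivWithinAt (fun s : ℝ => ρ * s ^ b)
      (ρ * (b * s ^ (b - 1))) (Icc 1 2) s := fun s hs =>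
    ((Real.hasDerivAt_rpow_const (Or.inl (by linarith [hs.1]))).const_mul ρ).hasDerivWithinAt
  have hinj : InjOn (fun s : ℝ => ρ * s ^ b) (Icc 1 2) := by
    intro s hs t ht h
    have h0 : ρ ≠ 0 := by linarith [hρ.1]
    exact (Real.rpow_left_inj (by linarith [hs.1]) (by linarith [ht.1]) (by linarith)).1
      (mul_left_cancel₀ h0 h)
  have key := lintegral_image_eq_lintegral_abs_deriv_mul measurableSet_Icc hd hinj g
  calc _ ≤ ∫⁻ s in Icc (1 : ℝ) 2, ENNReal.ofReal |ρ * (b * s ^ (b - 1))| * g (ρ * s ^ b) := by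
        refine setLIntegral_mono' measurableSet_Icc fun s hs => ?_
        refine le_mul_of_one_le_left' ?_
        rw [ENNReal.one_le_ofReal]
        refine le_trans ?_ (le_abs_self _)
        have h1 : 1 ≤ s ^ (b - 1) := Real.one_le_rpow hs.1 (by linarith)
        have h2 : 1 ≤ b * s ^ (b - 1) := by nlinarith
        nlinarith [hρ.1]
    _ = _ := key.symm
    _ ≤ _ := by
        refine lintegral_mono_set ?_
        rintro _ ⟨s, hs, rfl⟩
        have h1 := rpow_le_two_rpow (by linarith : 0 ≤ b) hs
        refine abs_le.1 ?_
        rw [abs_mul, abs_of_nonneg (by linarith [hρ.1] : (0:ℝ) ≤ ρ)]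
        exact mul_le_mul hρ.2 h1 (abs_nonneg _) (by norm_num)

/-- A dyadic bound for the size of the curve. -/
theorem exists_curve_exponent (b : ℝ) : ∃ m : ℕ, 4 * (2 : ℝ) ^ b * 2 ≤ 2 ^ m := by
  obtain ⟨m, hm⟩ := pow_unbounded_of_one_lt (4 * (2 : ℝ) ^ b * 2) (by norm_num : (1 : ℝ) < 2)
  exact ⟨m, hm.le⟩

theorem lavg_cur_first_le {b : ℝ} (hb : 1 < b) {m : ℕ} (hm : 4 * (2 : ℝ) ^ b * 2 ≤ 2 ^ m)
    {h1 h2 ρ : ℝ} (hρ : ρ ∈ Icc (1 : ℝ) 4) (a c : ℕ) {F : G → ℝ≥0∞} (hF : Measurable F) (x : G) :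
    lavg (cur b (2 ^ (a + 1) * h1) (ρ * (2 ^ c * h2))) (lavg (chain (h1, 0) (a + 1)) F) x ≤
      ENNReal.ofReal (4 * 2 ^ m) * MD (0, h2) (MD (h1, 0) F) x := by
  have := (cProb_chain (h1, 0) (a + 1)).prob
  rw [lavg_cur (measurable_lavg hF)]
  have hM := measurable_MD (d := (h1, 0)) hF
  calc _ ≤ ∫⁻ s in Icc (1 : ℝ) 2, 4 * MD (h1, 0) F (x - (ρ * s ^ b) • ((2 : ℝ) ^ c • ((0, h2) : G))) := by
        refine setLIntegral_mono' measurableSet_Icc fun s hs => ?_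
        have := lavg_chain_succ_le (d := (h1, 0)) hF a (t := -(s * 2 ^ (a + 1))) ?_
          (x - (ρ * s ^ b) • ((2 : ℝ) ^ c • ((0, h2) : G)))
        · refine le_trans (le_of_eq ?_) this
          congr 1
          ext
          · simp; ring
          · simp; ring
        · rw [abs_neg, abs_of_nonneg (by have := hs.1; positivity), pow_succ]
          have : (0 : ℝ) < 2 ^ a := by positivity
          nlinarith [hs.2]
    _ ≤ ∫⁻ v in Icc (-(4 * 2 ^ b)) (4 * 2 ^ b), 4 * MD (h1, 0) F (x - v • ((2 : ℝ) ^ c • ((0, h2) : G))) :=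
        setLIntegral_rpow_le hb hρ
          (g := fun v => 4 * MD (h1, 0) F (x - v • ((2 : ℝ) ^ c • ((0, h2) : G))))
    _ ≤ 4 * (ENNReal.ofReal (2 ^ m) * MD (0, h2) (MD (h1, 0) F) x) := by
        rw [lintegral_const_mul _ (by fun_prop)]
        gcongr
        refine (setLIntegral_line_le hM x m ?_).trans ?_
        · have : (0 : ℝ) < 2 ^ b := by positivity
          linarith
        · gcongr
          exact MD_smul_le _ _ _ _
    _ = _ := by
        rw [← mul_assoc, ENNReal.ofReal_mul (by norm_num)]
        norm_num

theorem lavg_cur_second_le {b : ℝ} (hb : 1 < b) {m : ℕ} (hm : 4 * (2 : ℝ) ^ b * 2 ≤ 2 ^ m)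
    {h1 h2 ρ : ℝ} (hρ : ρ ∈ Icc (1 : ℝ) 4) (a c : ℕ) {F : G → ℝ≥0∞} (hF : Measurable F) (x : G) :
    lavg (cur b (2 ^ a * h1) (ρ * (2 ^ (c + 1) * h2))) (lavg (chain (0, h2) (c + 1)) F) x ≤
      ENNReal.ofReal (2 ^ (m + 2) * 2) * MD (h1, 0) (MD (0, h2) F) x := by
  have := (cProb_chain (0, h2) (c + 1)).prob
  rw [lavg_cur (measurable_lavg hF)]
  have hM := measurable_MD (d := (0, h2)) hF
  calc _ ≤ ∫⁻ s in Icc (1 : ℝ) 2, ENNReal.ofReal (2 ^ (m + 2)) *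
          MD (0, h2) F (x - s • ((2 : ℝ) ^ a • ((h1, 0) : G))) := by
        refine setLIntegral_mono' measurableSet_Icc fun s hs => ?_
        have := lavg_chain_succ_le' (d := (0, h2)) hF c m (t := -(ρ * s ^ b * 2 ^ (c + 1))) ?_
          (x - s • ((2 : ℝ) ^ a • ((h1, 0) : G)))
        · refine le_trans (le_of_eq ?_) this
          congr 1
          ext
          · simp
          · simp; ring
        · rw [abs_neg, abs_mul, abs_mul, abs_of_nonneg (by linarith [hρ.1] : (0 : ℝ) ≤ ρ),
            abs_of_pos (by positivity : (0 : ℝ) < 2 ^ (c + 1)), pow_succ]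
          have := rpow_le_two_rpow (by linarith : 0 ≤ b) hs
          have h4 : ρ * |s ^ b| ≤ 4 * 2 ^ b :=
            mul_le_mul hρ.2 this (abs_nonneg _) (by norm_num)
          have : (0 : ℝ) < 2 ^ c := by positivity
          nlinarith
    _ ≤ ∫⁻ s in Icc (-2 : ℝ) 2, ENNReal.ofReal (2 ^ (m + 2)) *
          MD (0, h2) F (x - s • ((2 : ℝ) ^ a • ((h1, 0) : G))) :=
        lintegral_mono_set (Icc_subset_Icc (by norm_num) le_rfl)
    _ ≤ ENNReal.ofReal (2 ^ (m + 2)) * (ENNReal.ofReal (2 ^ 1) * MD (h1, 0) (MD (0, h2) F) x) := by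
        rw [lintegral_const_mul _ (by fun_prop)]
        gcongr
        refine (setLIntegral_line_le hM x 1 (by norm_num)).trans ?_
        gcongr
        exact MD_smul_le _ _ _ _
    _ = _ := by
        rw [← mul_assoc, ← ENNReal.ofReal_mul (by positivity)]
        norm_num

theorem lavg_cur_both_le {b : ℝ} (hb : 1 < b) {m : ℕ} (hm : 4 * (2 : ℝ) ^ b * 2 ≤ 2 ^ m)
    {h1 h2 ρ : ℝ} (hρ : ρ ∈ Icc (1 : ℝ) 4) (a c : ℕ) {F : G → ℝ≥0∞} (hF : Measurable F) (x : G) :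
    lavg (cur b (2 ^ (a + 1) * h1) (ρ * (2 ^ (c + 1) * h2)))
      (lavg (chain (h1, 0) (a + 1)) (lavg (chain (0, h2) (c + 1)) F)) x ≤
      ENNReal.ofReal (16 * 2 ^ m) * MD (0, h2) (MD (h1, 0) (MD (0, h2) F)) x := by
  have := (cProb_chain (0, h2) (c + 1)).prob
  have hM := measurable_MD (d := (0, h2)) hF
  have hM2 := measurable_MD (d := (h1, 0)) hM
  refine (lavg_cur_first_le hb hm hρ a (c + 1) (measurable_lavg hF) x).trans ?_
  have e : ∀ y, lavg (chain (0, h2) (c + 1)) F y ≤ 4 * MD (0, h2) F y := fun y => by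
    simpa using lavg_chain_succ_le (d := (0, h2)) hF c (t := 0) (by simp) y
  have e2 : ∀ y, MD (h1, 0) (lavg (chain (0, h2) (c + 1)) F) y ≤
      4 * MD (h1, 0) (MD (0, h2) F) y := fun y =>
    (MD_mono e y).trans (MD_const_mul 4 hM y).le
  calc _ ≤ ENNReal.ofReal (4 * 2 ^ m) * (4 * MD (0, h2) (MD (h1, 0) (MD (0, h2) F)) x) := by
        gcongr
        exact (MD_mono e2 x).trans (MD_const_mul 4 hM2 x).le
    _ = _ := by
        rw [← mul_assoc, show (4 : ℝ≥0∞) = ENNReal.ofReal 4 by norm_num,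
          ← ENNReal.ofReal_mul (by positivity)]
        congr 2
        ring

/-! A two-point convexity inequality and the square function of a chain. -/

theorem rpow_two_point {p r s : ℝ} (h1 : 1 < p) (h2 : p ≤ 2) (hr : 0 ≤ r) (hs : 0 ≤ s) :
    r ^ p + p * r ^ (p - 1) * (s - r) + (p * (p - 1) / 2) * (s - r) ^ 2 * max r s ^ (p - 2) ≤
      s ^ p := by
  rcases eq_or_ne r s with rfl | hrs
  · simp
  set M := max r s with hM
  have hM0 : 0 < M := by
    rcases lt_or_gt_of_ne hrs with h | h
    · exact lt_max_of_lt_right (hr.trans_lt h)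
    · exact lt_max_of_lt_left (hs.trans_lt h)
  set K := (p * (p - 1) / 2) * M ^ (p - 2) with hK
  have hder : ∀ x : ℝ, HasDerivAt (fun x : ℝ => x ^ p - K * x ^ 2) (p * x ^ (p - 1) - 2 * K * x) x := by
    intro x
    have := ((hasDerivAt_pow 2 x).const_mul K)
    refine ((Real.hasDerivAt_rpow_const (Or.inr h1.le)).sub this).congr_deriv ?_
    push_cast
    ring
  have hconv : ConvexOn ℝ (Icc 0 M) (fun x : ℝ => x ^ p - K * x ^ 2) := by
    refine convexOn_of_hasDerivWithinAt2_nonneg (convex_Icc 0 M)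
      (fun x _ => (hder x).continuousAt.continuousWithinAt)
      (fun x _ => (hder x).hasDerivWithinAt)
      (f'' := fun x => p * ((p - 1) * x ^ (p - 1 - 1)) - 2 * K) (fun x hx => ?_) (fun x hx => ?_)
    · rw [interior_Icc] at hx
      have e : HasDerivAt (fun x : ℝ => 2 * K * x) (2 * K) x := by
        simpa using (hasDerivAt_id x).const_mul (2 * K)
      exact (((Real.hasDerivAt_rpow_const (Or.inl hx.1.ne')).const_mul p).sub e).hasDerivWithinAt
    · rw [interior_Icc] at hx
      have e : M ^ (p - 2) ≤ x ^ (p - 2) :=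
        Real.rpow_le_rpow_of_nonpos hx.1 hx.2.le (by linarith)
      rw [show p - 1 - 1 = p - 2 by ring]
      have : 0 ≤ p * (p - 1) := by nlinarith
      have := mul_le_mul_of_nonneg_left e this
      rw [hK]
      linarith
  have hrm : r ∈ Icc 0 M := ⟨hr, le_max_left _ _⟩
  have hsm : s ∈ Icc 0 M := ⟨hs, le_max_right _ _⟩
  have hpow : r ^ (p - 1) * r = r ^ p := by
    rcases hr.eq_or_lt with rfl | h
    · rw [mul_zero, Real.zero_rpow (by linarith)]
    · rw [← Real.rpow_add_one h.ne']; congr 1; ring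
  have key : (p * r ^ (p - 1) - 2 * K * r) * (s - r) ≤ (s ^ p - K * s ^ 2) - (r ^ p - K * r ^ 2) := by
    rcases lt_or_gt_of_ne hrs with h | h
    · have := hconv.le_slope_of_hasDerivWithinAt hrm hsm h (hder r).hasDerivWithinAt
      rw [slope_def_field, le_div_iff₀ (by linarith)] at this
      exact this
    · have := hconv.slope_le_of_hasDerivWithinAt hsm hrm h (hder r).hasDerivWithinAt
      rw [slope_def_field, div_le_iff₀ (by linarith)] at this
      linarith
  have : (p * (p - 1) / 2) * (s - r) ^ 2 * M ^ (p - 2) = K * (s - r) ^ 2 := by rw [hK]; ring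
  rw [this]
  nlinarith

theorem norm_rpow_two_point {H : Type*} [NormedAddCommGroup H] [InnerProductSpace ℝ H] {p : ℝ}
    (h1 : 1 < p) (h2 : p ≤ 2) (u v : H) :
    ‖u‖ ^ p + p * ‖u‖ ^ (p - 2) * inner ℝ u (v - u) +
      (p * (p - 1) / 2) * (‖v - u‖ ^ 2 * max ‖u‖ ‖v‖ ^ (p - 2)) ≤ ‖v‖ ^ p := by
  rcases eq_or_ne u 0 with rfl | hu
  · have := rpow_two_point h1 h2 le_rfl (norm_nonneg v)
    simp only [norm_zero, Real.zero_rpow (by linarith : p - 1 ≠ 0), mul_zero, zero_mul, sub_zero,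
      inner_zero_left] at this ⊢
    linarith
  have hu' : 0 < ‖u‖ := norm_pos_iff.2 hu
  have := rpow_two_point h1 h2 (norm_nonneg u) (norm_nonneg v)
  have e1 : inner ℝ u (v - u) = inner ℝ u v - ‖u‖ ^ 2 := by
    rw [inner_sub_right, real_inner_self_eq_norm_sq]
  have e2 : ‖v - u‖ ^ 2 = ‖v‖ ^ 2 - 2 * inner ℝ u v + ‖u‖ ^ 2 := by
    rw [@norm_sub_sq_real, real_inner_comm]
  have e3 : inner ℝ u v ≤ ‖u‖ * ‖v‖ := real_inner_le_norm u v
  have e4 : max ‖u‖ ‖v‖ ^ (p - 2) ≤ ‖u‖ ^ (p - 2) :=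
    Real.rpow_le_rpow_of_nonpos hu' (le_max_left _ _) (by linarith)
  have e5 : ‖u‖ ^ (p - 1) = ‖u‖ ^ (p - 2) * ‖u‖ := by
    rw [← Real.rpow_add_one hu'.ne']; congr 1; ring
  have e6 : 0 ≤ max ‖u‖ ‖v‖ ^ (p - 2) := by positivity
  rw [e1, e2]
  rw [e5] at this
  set A := ‖u‖ ^ (p - 2)
  set B := max ‖u‖ ‖v‖ ^ (p - 2)
  set c := inner ℝ u v
  have e7 : 0 ≤ (‖u‖ * ‖v‖ - c) * (p * A - p * (p - 1) * B) := by
    refine mul_nonneg (by linarith) ?_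
    have : p * (p - 1) * B ≤ p * 1 * B := by
      gcongr; linarith
    have : p * B ≤ p * A := by gcongr
    linarith
  nlinarith

section

variable {H : Type*} [NormedAddCommGroup H] [InnerProductSpace ℝ H] [CompleteSpace H]

theorem ennreal_rpow_anti {x y : ℝ≥0∞} (h : x ≤ y) {z : ℝ} (hz : z ≤ 0) : y ^ z ≤ x ^ z := by
  rw [show z = -(-z) by ring, ENNReal.rpow_neg y, ENNReal.rpow_neg x]
  exact ENNReal.inv_le_inv.2 (ENNReal.rpow_le_rpow h (by linarith))

theorem energy_pointwise {p : ℝ} (h1 : 1 < p) (h2 : p ≤ 2) {u : G → H} (hu : Nice u) (r x : G) :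
    ‖avg (box r) u x‖ₑ ^ p + ENNReal.ofReal (1 / 2) * ∫⁻ s in Icc (-1 : ℝ) 1,
      ENNReal.ofReal (p * (p - 1) / 2 * (‖u (x - s • r) - avg (box r) u x‖ ^ 2 *
        max ‖avg (box r) u x‖ ‖u (x - s • r)‖ ^ (p - 2))) ≤
      lavg (box r) (fun y => ‖u y‖ₑ ^ p) x := by
  set w := avg (box r) u x with hw
  have hwi := avg_box hu x (d := r)
  rw [← hw] at hwi
  set μ := (volume : Measure ℝ).restrict (Icc (-1 : ℝ) 1)
  have hmeas : StronglyMeasurable fun s : ℝ => u (x - s • r) := hu.1.comp_measurable (by fun_prop)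
  obtain ⟨M, hM⟩ := hu.2.1
  have hMw : ‖w‖ ≤ M := by
    have := (cProb_box r).prob
    rw [hw, avg]
    simpa using norm_integral_le_of_norm_le_const (μ := box r) (ae_of_all _ fun y => hM (x - y))
  have hM0 : 0 ≤ M := (norm_nonneg _).trans hMw
  have hint : Integrable (fun s : ℝ => u (x - s • r)) μ :=
    Integrable.of_bound hmeas.aestronglyMeasurable M (ae_of_all _ fun s => hM _)
  have hint1 : Integrable (fun s : ℝ => ‖u (x - s • r)‖ ^ p) μ :=
    Integrable.of_bound (hmeas.norm.measurable.pow_const p).aestronglyMeasurable (M ^ p)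
      (ae_of_all _ fun s => by
        rw [Real.norm_eq_abs, abs_of_nonneg (by positivity)]
        exact Real.rpow_le_rpow (norm_nonneg _) (hM _) (by linarith))
  have hsub : Integrable (fun s : ℝ => u (x - s • r) - w) μ := hint.sub (integrable_const w)
  have hint2 : Integrable (fun s : ℝ => inner ℝ w (u (x - s • r) - w)) μ :=
    hsub.const_inner w
  have hEb : ∀ s : ℝ, ‖u (x - s • r) - w‖ ^ 2 * max ‖w‖ ‖u (x - s • r)‖ ^ (p - 2) ≤ 4 * M ^ p := by
    intro s
    set m := max ‖w‖ ‖u (x - s • r)‖ with hm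
    have hm0 : 0 ≤ m := (norm_nonneg w).trans (le_max_left _ _)
    have e1 : ‖u (x - s • r) - w‖ ≤ 2 * m := by
      refine (norm_sub_le _ _).trans ?_
      linarith [le_max_left ‖w‖ ‖u (x - s • r)‖, le_max_right ‖w‖ ‖u (x - s • r)‖]
    rcases hm0.eq_or_lt with h | h
    · rw [← h] at e1
      have : ‖u (x - s • r) - w‖ = 0 := le_antisymm (by simpa using e1) (norm_nonneg _)
      rw [this]
      simp only [ne_eq, OfNat.ofNat_ne_zero, not_false_eq_true, zero_pow, zero_mul]
      positivity
    · calc _ ≤ (2 * m) ^ 2 * m ^ (p - 2) := by gcongr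
        _ = 4 * m ^ p := by
          rw [Real.rpow_sub h, Real.rpow_two]; field_simp; ring
        _ ≤ 4 * M ^ p := by
          gcongr
          exact max_le hMw (hM _)
  have hint3 : Integrable (fun s : ℝ => p * (p - 1) / 2 * (‖u (x - s • r) - w‖ ^ 2 *
      max ‖w‖ ‖u (x - s • r)‖ ^ (p - 2))) μ := by
    refine Integrable.const_mul ?_ _
    refine Integrable.of_bound (Measurable.aestronglyMeasurable ?_) (4 * M ^ p)
      (ae_of_all _ fun s => ?_)
    · exact ((hmeas.sub stronglyMeasurable_const).norm.measurable.pow_const 2).mul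
        ((measurable_const.max hmeas.norm.measurable).pow_const _)
    · rw [Real.norm_eq_abs, abs_of_nonneg (by positivity)]
      exact hEb s
  have hvol : μ.real univ = 2 := by
    simp only [μ, measureReal_restrict_apply_univ, Real.volume_real_Icc]; norm_num
  have hzero : ∫ s, inner ℝ w (u (x - s • r) - w) ∂μ = 0 := by
    rw [integral_inner hsub, integral_sub hint (integrable_const w),
      integral_const, hvol]
    have : ∫ s, u (x - s • r) ∂μ = (2 : ℝ) • w := by rw [hwi, smul_smul]; norm_num
    rw [this, sub_self, inner_zero_right]
  have hreal : 2 * ‖w‖ ^ p + ∫ s, p * (p - 1) / 2 * (‖u (x - s • r) - w‖ ^ 2 *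
      max ‖w‖ ‖u (x - s • r)‖ ^ (p - 2)) ∂μ ≤ ∫ s, ‖u (x - s • r)‖ ^ p ∂μ := by
    have := integral_mono (((integrable_const (‖w‖ ^ p)).add
      (hint2.const_mul (p * ‖w‖ ^ (p - 2)))).add hint3) hint1
      (fun s => norm_rpow_two_point h1 h2 w (u (x - s • r)))
    refine le_trans (le_of_eq ?_) this
    simp only [Pi.add_apply]
    have h12 : Integrable (fun s : ℝ => ‖w‖ ^ p + p * ‖w‖ ^ (p - 2) * inner ℝ w (u (x - s • r) - w)) μ :=
      (integrable_const _).add (hint2.const_mul _)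
    rw [integral_add h12 hint3,
      integral_add (integrable_const _) (hint2.const_mul _), integral_const_mul (p * ‖w‖ ^ (p - 2)), hzero,
      integral_const, hvol]
    simp
  have hp0 : 0 ≤ p * (p - 1) / 2 := by nlinarith
  have hnn : ∀ s : ℝ, 0 ≤ p * (p - 1) / 2 * (‖u (x - s • r) - w‖ ^ 2 *
      max ‖w‖ ‖u (x - s • r)‖ ^ (p - 2)) := fun s => by positivity
  rw [lavg_box (by have := hu.1.enorm; fun_prop),
    ← ofReal_integral_eq_lintegral_ofReal hint3 (ae_of_all _ hnn)]
  have eN : ∀ v : H, ‖v‖ₑ ^ p = ENNReal.ofReal (‖v‖ ^ p) := fun v => by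
    rw [← ofReal_norm, ENNReal.ofReal_rpow_of_nonneg (norm_nonneg _) (by linarith)]
  simp_rw [eN]
  rw [← ofReal_integral_eq_lintegral_ofReal hint1 (ae_of_all _ fun s => by positivity),
    ← ENNReal.ofReal_mul (by norm_num), ← ENNReal.ofReal_mul (by norm_num),
    ← ENNReal.ofReal_add (by positivity) (mul_nonneg (by norm_num) (integral_nonneg hnn))]
  refine ENNReal.ofReal_le_ofReal ?_
  linarith

theorem enorm_avg_sub_le {w : G → H} (hw : Nice w) (a : H) (r y : G) :
    ‖a - avg (box r) w y‖ₑ ^ 2 ≤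
      ENNReal.ofReal (1 / 2) * ∫⁻ s in Icc (-1 : ℝ) 1, ‖a - w (y + s • r)‖ₑ ^ 2 := by
  have hb := cProb_box r
  have := hb.prob
  have hmeas : StronglyMeasurable fun z : G => a - w (y - z) :=
    stronglyMeasurable_const.sub (hw.1.comp_measurable (by fun_prop))
  have e1 : a - avg (box r) w y = ∫ z, (a - w (y - z)) ∂(box r) := by
    rw [integral_sub (integrable_const _) (hw.integrable_sub hb y), integral_const]
    simp [avg]
  have hF : Measurable fun z : G => ‖a - w z‖ₑ :=
    (stronglyMeasurable_const.sub hw.1).enorm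
  have e2 : ‖a - avg (box r) w y‖ₑ ≤ lavg (box r) (fun z => ‖a - w z‖ₑ) y := by
    rw [e1]; exact enorm_integral_le_lintegral_enorm _
  have e3 := lavg_rpow_le hb hF (p := 2) (by norm_num) y
  simp only [ENNReal.rpow_two] at e3
  refine ((pow_le_pow_left₀ zero_le e2 2).trans e3).trans (le_of_eq ?_)
  rw [lavg_box (by fun_prop)]
  congr 1
  have h5 := setLIntegral_comp_sub_mul (H := fun s : ℝ => ‖a - w (y + s • r)‖ₑ ^ 2)
    (by
      have : StronglyMeasurable fun s : ℝ => a - w (y + s • r) :=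
        stronglyMeasurable_const.sub (hw.1.comp_measurable (by fun_prop))
      exact this.enorm.pow_const 2) 0 (one_ne_zero) (R := 1)
  simp only [mul_one, zero_sub, inv_one, abs_one, ENNReal.ofReal_one, one_mul, neg_smul,
    ← sub_eq_add_neg] at h5
  rw [h5, Real.closedBall_eq_Icc]
  norm_num

theorem energy_step {p : ℝ} (h1 : 1 < p) (h2 : p ≤ 2) {u : G → H} (hu : Nice u) (r : G)
    {F : G → ℝ≥0∞} (hF1 : ∀ y, ‖u y‖ₑ ≤ F y)
    (hF2 : ∀ y, ∀ s ∈ Icc (-1 : ℝ) 1, ‖avg (box r) u (y + s • r)‖ₑ ≤ F y) :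
    ENNReal.ofReal (p * (p - 1) / 2) *
      (∫⁻ y, ‖u y - avg (box r) (avg (box r) u) y‖ₑ ^ 2 * F y ^ (p - 2)) +
      ∫⁻ y, ‖avg (box r) u y‖ₑ ^ p ≤ ∫⁻ y, ‖u y‖ₑ ^ p := by
  have hb := cProb_box r
  have hw : Nice (avg (box r) u) := hu.avg hb
  set w := avg (box r) u with hwdef
  set κ := p * (p - 1) / 2
  have hκ : 0 ≤ κ := by simp only [κ]; nlinarith
  set Φ : G → H → ℝ≥0∞ := fun x v => ENNReal.ofReal (κ * (‖v - w x‖ ^ 2 * max ‖w x‖ ‖v‖ ^ (p - 2)))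
  have hΦm : Measurable fun z : G × ℝ => Φ z.1 (u (z.1 - z.2 • r)) := by
    have a1 : StronglyMeasurable fun z : G × ℝ => u (z.1 - z.2 • r) :=
      hu.1.comp_measurable (by fun_prop)
    have a2 : StronglyMeasurable fun z : G × ℝ => w z.1 := hw.1.comp_measurable (by fun_prop)
    exact ENNReal.measurable_ofReal.comp ((((a1.sub a2).norm.measurable.pow_const 2).mul
      ((a2.norm.measurable.max a1.norm.measurable).pow_const _)).const_mul κ)
  have hum : Measurable fun y => ‖u y‖ₑ := hu.1.enorm
  have hwm : Measurable fun y => ‖w y‖ₑ := hw.1.enorm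
  have key : ∫⁻ x, (‖w x‖ₑ ^ p + ENNReal.ofReal (1 / 2) *
      ∫⁻ s in Icc (-1 : ℝ) 1, Φ x (u (x - s • r))) ≤ ∫⁻ y, ‖u y‖ₑ ^ p :=
    (lintegral_mono fun x => energy_pointwise h1 h2 hu r x).trans
      (lintegral_lavg hb (by fun_prop)).le
  rw [lintegral_add_left (by fun_prop), add_comm] at key
  refine le_trans (add_le_add_left ?_ _) key
  have hin : Measurable fun x => ∫⁻ s in Icc (-1 : ℝ) 1, Φ x (u (x - s • r)) :=
    Measurable.lintegral_prod_right' (f := fun z : G × ℝ => Φ z.1 (u (z.1 - z.2 • r))) hΦm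
  rw [lintegral_const_mul _ hin, lintegral_lintegral_swap hΦm.aemeasurable]
  have e1 : ∀ s : ℝ, ∫⁻ x, Φ x (u (x - s • r)) = ∫⁻ y, Φ (y + s • r) (u y) := by
    intro s
    rw [← lintegral_add_right_eq_self (fun x => Φ x (u (x - s • r))) (s • r)]
    simp
  simp_rw [e1]
  have hΦm2 : Measurable fun z : ℝ × G => Φ (z.2 + z.1 • r) (u z.2) := by
    have := hΦm.comp (show Measurable fun z : ℝ × G => ((z.2 + z.1 • r, z.1) : G × ℝ) by fun_prop)
    simpa [Function.comp_def] using this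
  rw [lintegral_lintegral_swap hΦm2.aemeasurable, ← lintegral_const_mul' _ _ ENNReal.ofReal_ne_top,
    ← lintegral_const_mul' _ _ ENNReal.ofReal_ne_top]
  refine lintegral_mono fun y => ?_
  have e2 : ∀ s ∈ Icc (-1 : ℝ) 1, ENNReal.ofReal κ * F y ^ (p - 2) * ‖u y - w (y + s • r)‖ₑ ^ 2 ≤
      Φ (y + s • r) (u y) := by
    intro s hs
    simp only [Φ]
    rw [ENNReal.ofReal_mul hκ, mul_assoc, mul_comm (F y ^ (p - 2))]
    gcongr
    set m := max ‖w (y + s • r)‖ ‖u y‖ with hm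
    have hm0 : 0 ≤ m := (norm_nonneg _).trans (le_max_right _ _)
    rw [ENNReal.ofReal_mul (by positivity), ENNReal.ofReal_pow (norm_nonneg _), ofReal_norm]
    rcases hm0.eq_or_lt with h | h
    · have a1 : u y = 0 := norm_le_zero_iff.1 (h ▸ le_max_right _ _)
      have a2 : w (y + s • r) = 0 := norm_le_zero_iff.1 (h ▸ le_max_left _ _)
      simp [a1, a2]
    · gcongr
      rw [← ENNReal.ofReal_rpow_of_pos h]
      refine ennreal_rpow_anti ?_ (by linarith)
      rw [hm, ENNReal.ofReal_max, ofReal_norm, ofReal_norm]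
      exact max_le (hF2 y s hs) (hF1 y)
  have hm3 : Measurable fun s : ℝ => ‖u y - w (y + s • r)‖ₑ ^ 2 := by
    have : StronglyMeasurable fun s : ℝ => u y - w (y + s • r) :=
      stronglyMeasurable_const.sub (hw.1.comp_measurable (by fun_prop))
    exact this.enorm.pow_const 2
  calc _ ≤ ENNReal.ofReal κ * ((ENNReal.ofReal (1 / 2) *
        ∫⁻ s in Icc (-1 : ℝ) 1, ‖u y - w (y + s • r)‖ₑ ^ 2) * F y ^ (p - 2)) := by
        gcongr
        exact enorm_avg_sub_le hw (u y) r y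
    _ = ENNReal.ofReal (1 / 2) * (ENNReal.ofReal κ * F y ^ (p - 2) *
        ∫⁻ s in Icc (-1 : ℝ) 1, ‖u y - w (y + s • r)‖ₑ ^ 2) := by ring
    _ ≤ _ := by
        rw [← lintegral_const_mul _ hm3]
        gcongr 1
        exact setLIntegral_mono' measurableSet_Icc e2

end

section

variable {H : Type*} [NormedAddCommGroup H] [InnerProductSpace ℝ H] [CompleteSpace H]

/-- The difference of two consecutive chain averages. -/
def Qd {E : Type*} [NormedAddCommGroup E] [NormedSpace ℝ E] (d : G) (n : ℕ) (f : G → E) (x : G) : E :=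
  avg (chain d n) f x - avg (chain d (n + 1)) f x

theorem Nice.Qd {E : Type*} [NormedAddCommGroup E] [NormedSpace ℝ E] {f : G → E} (hf : Nice f)
    (d : G) (n : ℕ) : Nice (Qd d n f) :=
  (hf.avg (cProb_chain d n)).sub (hf.avg (cProb_chain d (n + 1)))

theorem MD_lt_top {E : Type*} [NormedAddCommGroup E] [NormedSpace ℝ E] {f : G → E} (hf : Nice f)
    (d x : G) : MD d (fun y => ‖f y‖ₑ) x < ∞ := by
  obtain ⟨M, hM⟩ := hf.2.1
  refine lt_of_le_of_lt (b := ENNReal.ofReal M * 2) (iSup_le fun n => ?_)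
    (ENNReal.mul_lt_top ENNReal.ofReal_lt_top (by norm_num))
  calc _ ≤ ∫⁻ _ in Icc (-1 : ℝ) 1, ENNReal.ofReal M := by
        refine lintegral_mono fun s => ?_
        simp only [← ofReal_norm]
        exact ENNReal.ofReal_le_ofReal (hM _)
    _ = _ := by
        rw [lintegral_const, Measure.restrict_apply_univ, Real.volume_Icc]
        norm_num

/-- The controlling function in the square function argument. -/
def ctrl (d : G) (f : G → H) (y : G) : ℝ≥0∞ := ‖f y‖ₑ + 4 * MD d (fun z => ‖f z‖ₑ) y

theorem enorm_avg_chain_le_ctrl {d : G} {f : G → H} (hf : Nice f) (n : ℕ) (y : G) :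
    ‖avg (chain d n) f y‖ₑ ≤ ctrl d f y := by
  have hm : Measurable fun z => ‖f z‖ₑ := hf.1.enorm
  cases n with
  | zero =>
    rw [avg_chain_zero hf]
    exact le_self_add
  | succ n =>
    refine le_trans ?_ le_add_self
    refine (enorm_avg_le _ _ _).trans ?_
    simpa using lavg_chain_succ_le (d := d) hm n (t := 0) (by simp) y

theorem enorm_avg_box_le_ctrl {d : G} {f : G → H} (hf : Nice f) (n : ℕ) (y : G) {s : ℝ}
    (hs : s ∈ Icc (-1 : ℝ) 1) :
    ‖avg (box ((2 : ℝ) ^ n • d)) (avg (chain d n) f) (y + s • ((2 : ℝ) ^ n • d))‖ₑ ≤ ctrl d f y := by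
  have hm : Measurable fun z => ‖f z‖ₑ := hf.1.enorm
  refine le_trans ?_ le_add_self
  refine (enorm_avg_le _ _ _).trans ?_
  refine (lavg_mono (fun z => enorm_avg_le (chain d n) f z) _).trans ?_
  rw [smul_smul]
  refine (lavg_box_chain_le hm n ?_ y).trans ?_
  · rw [abs_mul, abs_of_pos (a := (2 : ℝ) ^ n) (by positivity)]
    exact mul_le_of_le_one_left (by positivity) (abs_le.2 hs)
  · gcongr
    norm_num

theorem measurable_ctrl {d : G} {f : G → H} (hf : Nice f) : Measurable (ctrl d f) := by
  have hm : Measurable fun z => ‖f z‖ₑ := hf.1.enorm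
  exact hm.add ((measurable_MD hm).const_mul 4)

theorem ctrl_ne_top {d : G} {f : G → H} (hf : Nice f) (y : G) : ctrl d f y ≠ ∞ :=
  ENNReal.add_ne_top.2 ⟨enorm_ne_top, ENNReal.mul_ne_top (by norm_num) (MD_lt_top hf d y).ne⟩

theorem energy_sum {p : ℝ} (h1 : 1 < p) (h2 : p ≤ 2) {d : G} {f : G → H} (hf : Nice f) (L : ℕ) :
    ENNReal.ofReal (p * (p - 1) / 2) *
      (∑ n ∈ Finset.range L, ∫⁻ y, ‖Qd d n f y‖ₑ ^ 2 * ctrl d f y ^ (p - 2)) +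
      ∫⁻ y, ‖avg (chain d L) f y‖ₑ ^ p ≤ ∫⁻ y, ‖f y‖ₑ ^ p := by
  induction L with
  | zero => simp [avg_chain_zero hf]
  | succ L ih =>
    refine le_trans ?_ ih
    have h := energy_step h1 h2 (hf.avg (cProb_chain d L)) ((2 : ℝ) ^ L • d)
      (enorm_avg_chain_le_ctrl hf L) (fun y s hs => enorm_avg_box_le_ctrl hf L y hs)
    have hc := cProb_box ((2 : ℝ) ^ L • d)
    have h3 := lintegral_avg_rpow_le hc ((hf.avg (cProb_chain d L)).avg hc) h1.le
    rw [Finset.sum_range_succ, mul_add, add_assoc]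
    gcongr 1
    refine le_trans ?_ h
    unfold Qd
    rw [avg_chain_succ hf]
    gcongr

theorem LP_square {p : ℝ} (h1 : 1 < p) (h2 : p ≤ 2) : ∃ C > 0, ∀ (H : Type)
    [NormedAddCommGroup H] [InnerProductSpace ℝ H] [CompleteSpace H] (d : G), IsAxis d →
    ∀ f : G → H, Nice f → ∀ L : ℕ, ∫⁻ x, (∑ n ∈ Finset.range L, ‖Qd d n f x‖ₑ ^ 2) ^ (p / 2) ≤
      ENNReal.ofReal C * ∫⁻ x, ‖f x‖ₑ ^ p := by
  obtain ⟨C, hC, hM⟩ := MD_strong h1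
  have hκ : 0 < p * (p - 1) / 2 := by nlinarith
  set κ := p * (p - 1) / 2 with hκdef
  set K : ℝ := 2 ^ (p - 1) * (1 + 4 ^ p * C) with hK
  refine ⟨(κ⁻¹) ^ (p / 2) * K ^ (1 - p / 2), by positivity, fun H _ _ _ d hd f hf L => ?_⟩
  have hm : Measurable fun z => ‖f z‖ₑ := hf.1.enorm
  have hcm := measurable_ctrl (d := d) hf
  have hQm : ∀ n, Measurable fun x => ‖Qd d n f x‖ₑ := fun n => (hf.Qd d n).1.enorm
  set I := ∫⁻ x, ‖f x‖ₑ ^ p with hI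
  have hctrl : ∫⁻ y, ctrl d f y ^ p ≤ ENNReal.ofReal K * I := by
    calc _ ≤ ∫⁻ y, 2 ^ (p - 1) * (‖f y‖ₑ ^ p + 4 ^ p * MD d (fun z => ‖f z‖ₑ) y ^ p) := by
          refine lintegral_mono fun y => ?_
          refine (ENNReal.rpow_add_le_mul_rpow_add_rpow _ _ h1.le).trans ?_
          rw [ENNReal.mul_rpow_of_nonneg _ _ (by linarith)]
      _ = 2 ^ (p - 1) * (I + 4 ^ p * ∫⁻ y, MD d (fun z => ‖f z‖ₑ) y ^ p) := by
          have := measurable_MD (d := d) hm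
          rw [lintegral_const_mul _ (by fun_prop), lintegral_add_left (by fun_prop),
            lintegral_const_mul _ (by fun_prop)]
      _ ≤ 2 ^ (p - 1) * (I + 4 ^ p * (ENNReal.ofReal C * I)) := by
          gcongr
          exact hM d hd _ hm
      _ = _ := by
          rw [hK, ENNReal.ofReal_mul (by positivity), ENNReal.ofReal_add (by positivity)
            (by positivity), ENNReal.ofReal_mul (by positivity), ENNReal.ofReal_one,
            ← ENNReal.ofReal_rpow_of_pos (by norm_num), ← ENNReal.ofReal_rpow_of_pos (by norm_num)]
          norm_num
          ring
  have hsum : ∫⁻ y, (∑ n ∈ Finset.range L, ‖Qd d n f y‖ₑ ^ 2) * ctrl d f y ^ (p - 2) ≤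
      ENNReal.ofReal κ⁻¹ * I := by
    have h := (le_self_add).trans (energy_sum h1 h2 (d := d) hf L)
    rw [← hκdef] at h
    simp_rw [Finset.sum_mul]
    rw [lintegral_finsetSum _ (fun n _ => by have := hQm n; fun_prop)]
    rw [ENNReal.ofReal_inv_of_pos hκ]
    rwa [mul_comm, ← ENNReal.le_div_iff_mul_le (Or.inl (by simpa using hκ))
      (Or.inl ENNReal.ofReal_ne_top), ENNReal.div_eq_inv_mul] at h
  calc _ ≤ ∫⁻ y, ((∑ n ∈ Finset.range L, ‖Qd d n f y‖ₑ ^ 2) * ctrl d f y ^ (p - 2)) ^ (p / 2) *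
        (ctrl d f y ^ p) ^ (1 - p / 2) := by
        refine lintegral_mono fun y => ?_
        rcases eq_or_ne (ctrl d f y) 0 with h0 | h0
        · have hz : ∀ n, ‖Qd d n f y‖ₑ = 0 := fun n => by
            have a1 := enorm_avg_chain_le_ctrl (d := d) hf n y
            have a2 := enorm_avg_chain_le_ctrl (d := d) hf (n + 1) y
            rw [h0, nonpos_iff_eq_zero, enorm_eq_zero] at a1 a2
            simp [Qd, a1, a2]
          simp [hz, show 0 < p / 2 by linarith]
        · refine le_of_eq ?_
          rw [ENNReal.mul_rpow_of_nonneg _ _ (by linarith), mul_assoc, ← ENNReal.rpow_mul,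
            ← ENNReal.rpow_mul, ← ENNReal.rpow_add _ _ h0 (ctrl_ne_top hf y)]
          rw [show (p - 2) * (p / 2) + p * (1 - p / 2) = 0 by ring, ENNReal.rpow_zero, mul_one]
    _ ≤ (∫⁻ y, (∑ n ∈ Finset.range L, ‖Qd d n f y‖ₑ ^ 2) * ctrl d f y ^ (p - 2)) ^ (p / 2) *
        (∫⁻ y, ctrl d f y ^ p) ^ (1 - p / 2) := by
        refine ENNReal.lintegral_mul_norm_pow_le ?_ (by fun_prop) (by linarith) (by linarith) (by ring)
        fun_prop
    _ ≤ (ENNReal.ofReal κ⁻¹ * I) ^ (p / 2) * (ENNReal.ofReal K * I) ^ (1 - p / 2) := by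
        gcongr
        linarith
    _ = _ := by
        rw [ENNReal.mul_rpow_of_nonneg _ _ (by linarith), ENNReal.mul_rpow_of_nonneg _ _ (by linarith),
          ENNReal.ofReal_mul (p := κ⁻¹ ^ (p / 2)) (by positivity),
          ← ENNReal.ofReal_rpow_of_nonneg (by positivity) (by linarith),
          ← ENNReal.ofReal_rpow_of_nonneg (by positivity) (by linarith)]
        have : I ^ (p / 2) * I ^ (1 - p / 2) = I := by
          rw [← ENNReal.rpow_add_of_nonneg _ _ (by linarith) (by linarith)]
          simp
        calc _ = ENNReal.ofReal κ⁻¹ ^ (p / 2) * ENNReal.ofReal K ^ (1 - p / 2) *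
              (I ^ (p / 2) * I ^ (1 - p / 2)) := by ring
          _ = _ := by rw [this]

section Euclidean

variable {ι : Type*} [Fintype ι]

theorem Nice.euclidean {g : ι → G → ℝ} (hg : ∀ i, Nice (g i)) :
    Nice (fun y => WithLp.toLp 2 fun i => g i y : G → EuclideanSpace ℝ ι) := by
  choose M hM using fun i => (hg i).2.1
  choose R hR using fun i => (hg i).2.2
  refine ⟨?_, ⟨Real.sqrt (∑ i, M i ^ 2), fun x => ?_⟩, ∑ i, |R i|, fun x hx => ?_⟩
  · refine Measurable.stronglyMeasurable ?_
    exact (WithLp.measurable_toLp 2 _).comp (measurable_pi_lambda _ fun i => (hg i).1.measurable)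
  · rw [EuclideanSpace.norm_eq]
    refine Real.sqrt_le_sqrt (Finset.sum_le_sum fun i _ => ?_)
    exact pow_le_pow_left₀ (norm_nonneg _) (hM i x) 2
  · ext i
    refine hR i x (lt_of_le_of_lt ?_ hx)
    exact (le_abs_self _).trans
      (Finset.single_le_sum (f := fun i => |R i|) (fun i _ => abs_nonneg _) (Finset.mem_univ i))

theorem avg_euclidean {ν : Measure G} (hν : CProb ν) {g : ι → G → ℝ}
    (hg : ∀ i, Nice (g i)) (x : G) (i : ι) :
    avg ν (fun y => WithLp.toLp 2 fun i => g i y : G → EuclideanSpace ℝ ι) x i =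
      avg ν (g i) x := by
  have h := (Nice.euclidean hg).integrable_sub hν x
  unfold avg
  exact ((EuclideanSpace.proj (𝕜 := ℝ) i).integral_comp_comm h).symm

theorem enorm_euclidean_sq (v : EuclideanSpace ℝ ι) : ‖v‖ₑ ^ 2 = ∑ i, ‖v i‖ₑ ^ 2 := by
  simp_rw [← ofReal_norm, ← ENNReal.ofReal_pow (norm_nonneg _)]
  rw [← ENNReal.ofReal_sum_of_nonneg (fun i _ => by positivity), EuclideanSpace.norm_sq_eq]

end Euclidean

theorem LP_square_two {p : ℝ} (h1 : 1 < p) (h2 : p ≤ 2) : ∃ C > 0, ∀ d e, IsAxis d → IsAxis e →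
    ∀ f : G → ℝ, Nice f → ∀ L L' : ℕ,
      ∫⁻ x, (∑ n ∈ Finset.range L, ∑ n' ∈ Finset.range L', ‖Qd d n (Qd e n' f) x‖ₑ ^ 2) ^ (p / 2) ≤
      ENNReal.ofReal C * ∫⁻ x, ‖f x‖ₑ ^ p := by
  obtain ⟨C, hC, hs⟩ := LP_square h1 h2
  refine ⟨C * C, by positivity, fun d e hd he f hf L L' => ?_⟩
  have hg : ∀ n' : Fin L', Nice (Qd e (n' : ℕ) f) := fun n' => hf.Qd e _
  have hge := Nice.euclidean hg
  have eq1 : ∀ n x, ‖Qd d n (fun y => WithLp.toLp 2 fun n' : Fin L' => Qd e (n' : ℕ) f y :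
      G → EuclideanSpace ℝ (Fin L')) x‖ₑ ^ 2 =
      ∑ n' ∈ Finset.range L', ‖Qd d n (Qd e n' f) x‖ₑ ^ 2 := by
    intro n x
    rw [enorm_euclidean_sq, ← Fin.sum_univ_eq_sum_range (fun n' => ‖Qd d n (Qd e n' f) x‖ₑ ^ 2)]
    refine Finset.sum_congr rfl fun i _ => ?_
    congr 2
    rw [Qd, PiLp.sub_apply, avg_euclidean (cProb_chain d n) hg, avg_euclidean (cProb_chain d (n + 1)) hg]
    rfl
  have eq2 : ∀ x, ‖(WithLp.toLp 2 fun n' : Fin L' => Qd e (n' : ℕ) f x :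
      EuclideanSpace ℝ (Fin L'))‖ₑ ^ p =
      (∑ n' ∈ Finset.range L', ‖Qd e n' f x‖ₑ ^ 2) ^ (p / 2) := by
    intro x
    rw [← Fin.sum_univ_eq_sum_range (fun n' => ‖Qd e n' f x‖ₑ ^ 2), ← enorm_euclidean_sq
      (WithLp.toLp 2 fun n' : Fin L' => Qd e (n' : ℕ) f x), ← ENNReal.rpow_natCast,
      ← ENNReal.rpow_mul]
    congr 1
    push_cast
    ring
  simp_rw [← eq1]
  refine (hs _ d hd _ hge L).trans ?_
  simp_rw [eq2]
  rw [ENNReal.ofReal_mul hC.le, mul_assoc]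
  gcongr
  exact hs ℝ e he f hf L'

end

section

section Plancherel

open scoped FourierTransform ContDiff SchwartzMap

variable {V : Type*} [NormedAddCommGroup V] [InnerProductSpace ℝ V] [FiniteDimensional ℝ V]
  [MeasurableSpace V] [BorelSpace V]

theorem fourier_Lp_ae_eq {f : V → ℂ} (hf : Integrable f) (h2 : MemLp f 2) :
    ⇑(𝓕 h2.toLp : Lp (α := V) ℂ 2) =ᵐ[volume] 𝓕 f := by
  have hcont : Continuous (𝓕 f) :=
    VectorFourier.fourierIntegral_continuous Real.continuous_fourierChar
      (L := innerₗ V) continuous_inner hf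
  refine ae_eq_of_integral_contDiff_smul_eq
    ((Lp.memLp _).locallyIntegrable (by norm_num)) hcont.locallyIntegrable fun g hg hg' => ?_
  have hg'' : HasCompactSupport (fun x => (g x : ℂ)) := hg'.comp_left (g := fun x : ℝ => (x : ℂ)) rfl
  let φ : 𝓢(V, ℂ) := hg''.toSchwartzMap (Complex.ofRealCLM.contDiff.comp hg)
  have hφ : ∀ x, φ x = (g x : ℂ) := fun x => rfl
  have key := congrArg (fun T => T φ) (Lp.fourier_toTemperedDistribution_eq (h2.toLp))
  simp only [TemperedDistribution.fourier_apply, Lp.toTemperedDistribution_apply] at key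
  have e1 : ∫ x, (𝓕 φ) x • (h2.toLp : V → ℂ) x = ∫ x, (𝓕 φ) x • f x := by
    refine integral_congr_ae ?_
    filter_upwards [h2.coeFn_toLp] with x hx
    rw [hx]
  have e2 : ∫ x, (𝓕 φ) x • f x = ∫ x, φ x • 𝓕 f x := by
    simpa using! VectorFourier.integral_fourierIntegral_smul_eq_flip (L := innerₗ V)
      Real.continuous_fourierChar continuous_inner φ.integrable hf
  rw [e1, e2] at key
  have e3 : ∀ h : V → ℂ, ∫ x, g x • h x = ∫ x, φ x • h x := fun h => by
    refine integral_congr_ae (Eventually.of_forall fun x => ?_)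
    simp only [hφ, Complex.real_smul, smul_eq_mul]
  rw [e3, e3, key]

theorem plancherel_lintegral {f : V → ℂ} (hf : Integrable f) (h2 : MemLp f 2) :
    ∫⁻ ξ, ‖𝓕 f ξ‖ₑ ^ 2 = ∫⁻ x, ‖f x‖ₑ ^ 2 := by
  have h := Lp.norm_fourier_eq (h2.toLp)
  have h' : eLpNorm (𝓕 f) 2 volume = eLpNorm f 2 volume := by
    rw [← eLpNorm_congr_ae (fourier_Lp_ae_eq hf h2), ← eLpNorm_congr_ae h2.coeFn_toLp]
    rw [Lp.norm_def, Lp.norm_def] at h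
    exact (ENNReal.toReal_eq_toReal_iff' (Lp.eLpNorm_ne_top _) (Lp.eLpNorm_ne_top _)).1 h
  have e : ∀ g : V → ℂ, ∫⁻ x, ‖g x‖ₑ ^ 2 = eLpNorm g 2 volume ^ 2 := fun g => by
    have := eLpNorm_nnreal_pow_eq_lintegral (f := g) (μ := (volume : Measure V)) (p := 2) (by norm_num)
    simpa using this.symm
  rw [e, e, h']

end Plancherel

section FourierPlane

open scoped FourierTransform

/-- The bilinear pairing on the plane. -/
def pair (x ξ : G) : ℝ := x.1 * ξ.1 + x.2 * ξ.2

/-- The character `e^{-2π i t}`. -/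
def chr (t : ℝ) : ℂ := Complex.exp (((-(2 * Real.pi * t) : ℝ) : ℂ) * Complex.I)

theorem chr_add (s t : ℝ) : chr (s + t) = chr s * chr t := by
  rw [chr, chr, chr, ← Complex.exp_add]
  congr 1
  push_cast
  ring

theorem chr_zero : chr 0 = 1 := by simp [chr]

theorem norm_chr (t : ℝ) : ‖chr t‖ = 1 := Complex.norm_exp_ofReal_mul_I _

theorem continuous_chr : Continuous chr := by unfold chr; fun_prop

theorem continuous_pair (ξ : G) : Continuous fun x => pair x ξ := by unfold pair; fun_prop

/-- The Fourier transform of a real function on the plane. -/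
def ft (f : G → ℝ) (ξ : G) : ℂ := ∫ x, chr (pair x ξ) * (f x : ℂ)

/-- The Fourier transform of a measure on the plane. -/
def sym (ν : Measure G) (ξ : G) : ℂ := ∫ y, chr (pair y ξ) ∂ν

theorem ft_eq (f : G → ℝ) (ξ : G) :
    ft f ξ = 𝓕 (fun v : WithLp 2 (ℝ × ℝ) => (f (WithLp.ofLp v) : ℂ)) (WithLp.toLp 2 ξ) := by
  rw [Real.fourier_eq, ft, ← (WithLp.volume_preserving_ofLp ℝ ℝ).integral_comp
    (MeasurableEquiv.toLp 2 (ℝ × ℝ)).symm.measurableEmbedding]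
  refine integral_congr_ae (Eventually.of_forall fun v => ?_)
  simp only [Circle.smul_def, Real.fourierChar_apply, smul_eq_mul, chr, pair,
    WithLp.prod_inner_apply]
  congr 2
  simp
  ring

theorem plancherel {f : G → ℝ} (hf : Nice f) :
    ∫⁻ ξ, ‖ft f ξ‖ₑ ^ 2 = ∫⁻ x, ‖f x‖ₑ ^ 2 := by
  have hmp := WithLp.volume_preserving_ofLp ℝ ℝ
  have hem := (MeasurableEquiv.toLp 2 (ℝ × ℝ)).symm.measurableEmbedding
  have tr : ∀ F : G → ℝ≥0∞, ∫⁻ ξ, F ξ = ∫⁻ v : WithLp 2 (ℝ × ℝ), F (WithLp.ofLp v) := fun F =>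
    (hmp.lintegral_comp_emb hem F).symm
  have h2 : MemLp (fun x => (f x : ℂ)) 2 := (hf.memLp 2).ofReal
  have h1 : Integrable (fun x => (f x : ℂ)) := hf.integrable.ofReal
  have h2' := h2.comp_measurePreserving hmp
  rw [tr, tr]
  simp only [ft_eq, WithLp.toLp_ofLp]
  have := plancherel_lintegral (f := fun v : WithLp 2 (ℝ × ℝ) => (f (WithLp.ofLp v) : ℂ))
    ((hmp.integrable_comp_emb hem).2 h1) h2'
  rw [this]
  refine lintegral_congr fun v => ?_
  rw [← ofReal_norm, ← ofReal_norm, Complex.norm_real]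

theorem Nice.integrable_chr_mul {f : G → ℝ} (hf : Nice f) (ξ : G) :
    Integrable fun x => chr (pair x ξ) * (f x : ℂ) :=
  hf.integrable.ofReal.bdd_mul (c := 1)
    (continuous_chr.comp (continuous_pair ξ)).aestronglyMeasurable
    (Eventually.of_forall fun _ => (norm_chr _).le)

theorem ft_sub {f g : G → ℝ} (hf : Nice f) (hg : Nice g) (ξ : G) :
    ft (fun x => f x - g x) ξ = ft f ξ - ft g ξ := by
  rw [ft, ft, ft, ← integral_sub (hf.integrable_chr_mul ξ) (hg.integrable_chr_mul ξ)]
  refine integral_congr_ae (Eventually.of_forall fun x => ?_)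
  push_cast
  ring

theorem ft_avg {ν : Measure G} (hν : CProb ν) {f : G → ℝ} (hf : Nice f) (ξ : G) :
    ft (avg ν f) ξ = sym ν ξ * ft f ξ := by
  have := hν.prob
  have hf1 := hf.integrable_chr_mul ξ
  have hmeas : StronglyMeasurable fun z : G × G => chr (pair z.1 ξ) * (f (z.1 - z.2) : ℂ) :=
    (continuous_chr.comp ((continuous_pair ξ).comp continuous_fst)).stronglyMeasurable.mul
      (Complex.continuous_ofReal.comp_stronglyMeasurable
        (hf.1.comp_measurable (measurable_fst.sub measurable_snd)))
  have hshift : ∀ y : G, ∫ x, chr (pair x ξ) * (f (x - y) : ℂ) = chr (pair y ξ) * ft f ξ := by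
    intro y
    rw [← integral_add_right_eq_self _ y, ft, ← integral_const_mul]
    refine integral_congr_ae (Eventually.of_forall fun x => ?_)
    have : pair (x + y) ξ = pair y ξ + pair x ξ := by
      simp only [pair, Prod.fst_add, Prod.snd_add]
      ring
    simp only [add_sub_cancel_right]
    rw [this, chr_add, mul_assoc]
  have hint : Integrable (fun z : G × G => chr (pair z.1 ξ) * (f (z.1 - z.2) : ℂ))
      (volume.prod ν) := by
    rw [integrable_prod_iff' hmeas.aestronglyMeasurable]
    constructor
    · refine Eventually.of_forall fun y => ?_
      exact (hf.integrable.comp_sub_right y).ofReal.bdd_mul (c := 1)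
        (continuous_chr.comp (continuous_pair ξ)).aestronglyMeasurable
        (Eventually.of_forall fun _ => (norm_chr _).le)
    · simp only [norm_mul, norm_chr, one_mul, Complex.norm_real]
      have : ∀ y : G, ∫ x, ‖f (x - y)‖ = ∫ x, ‖f x‖ := fun y =>
        integral_sub_right_eq_self (fun x => ‖f x‖) y
      simp only [this]
      exact integrable_const _
  calc ft (avg ν f) ξ = ∫ x, ∫ y, chr (pair x ξ) * (f (x - y) : ℂ) ∂ν := by
        refine integral_congr_ae (Eventually.of_forall fun x => ?_)
        simp only [avg]
        rw [integral_const_mul, integral_complex_ofReal]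
    _ = ∫ y, (∫ x, chr (pair x ξ) * (f (x - y) : ℂ)) ∂ν := integral_integral_swap hint
    _ = sym ν ξ * ft f ξ := by
        simp only [hshift]
        rw [integral_mul_const, sym]

theorem norm_sym_le {ν : Measure G} (hν : CProb ν) (ξ : G) : ‖sym ν ξ‖ ≤ 1 := by
  have := hν.prob
  refine (norm_integral_le_integral_norm _).trans ?_
  simp [norm_chr]

theorem norm_chr_sub_le (s t : ℝ) : ‖chr s - chr t‖ ≤ 2 * Real.pi * |s - t| := by
  have : chr s - chr t = chr t * (chr (s - t) - 1) := by
    rw [mul_sub, ← chr_add, mul_one, add_sub_cancel]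
  rw [this, norm_mul, norm_chr, one_mul, chr]
  have h := Real.norm_exp_I_mul_ofReal_sub_one_le (x := -(2 * Real.pi * (s - t)))
  rw [mul_comm Complex.I] at h
  refine h.trans (le_of_eq ?_)
  rw [Real.norm_eq_abs, abs_neg, abs_mul, abs_of_pos Real.two_pi_pos]

theorem norm_one_sub_sym_le {d : G} {R : ℝ} {ν : Measure G} (hν : SegProb d R ν) (ξ : G) :
    ‖1 - sym ν ξ‖ ≤ 2 * Real.pi * R * |pair d ξ| := by
  have := hν.prob
  have hi : Integrable (fun y => chr (pair y ξ)) ν :=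
    Integrable.of_bound (continuous_chr.comp (continuous_pair ξ)).aestronglyMeasurable 1
      (Eventually.of_forall fun _ => (norm_chr _).le)
  have e : 1 - sym ν ξ = ∫ y, (1 - chr (pair y ξ)) ∂ν := by
    rw [integral_sub (integrable_const _) hi]
    simp [sym]
  rw [e]
  refine (norm_integral_le_of_norm_le_const (C := 2 * Real.pi * R * |pair d ξ|) ?_).trans ?_
  · filter_upwards [hν.supp] with y hy
    obtain ⟨s, hs, rfl⟩ := hy
    have h := norm_chr_sub_le 0 (pair (s • d) ξ)
    rw [chr_zero] at h
    refine h.trans ?_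
    have : |0 - pair (s • d) ξ| = |s| * |pair d ξ| := by
      rw [zero_sub, abs_neg, ← abs_mul]
      congr 1
      simp [pair]
      ring
    rw [this, mul_assoc (2 * Real.pi) R]
    have : |s| ≤ R := abs_le.2 hs
    gcongr
  · simp

/-- A square-function bound from a pointwise bound on the Fourier multipliers. -/
theorem lintegral_sum_sq_le {ι : Type*} (s : Finset ι) {f : G → ℝ} (hf : Nice f)
    (g : ι → G → ℝ) (hg : ∀ i, Nice (g i)) (m : ι → G → ℂ)
    (hm : ∀ i ξ, ft (g i) ξ = m i ξ * ft f ξ) (K : ℝ)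
    (hK : ∀ ξ : G, ξ.1 ≠ 0 → ξ.2 ≠ 0 → ∑ i ∈ s, ‖m i ξ‖ ^ 2 ≤ K) :
    ∑ i ∈ s, ∫⁻ x, ‖g i x‖ₑ ^ 2 ≤ ENNReal.ofReal K * ∫⁻ x, ‖f x‖ₑ ^ 2 := by
  have hae : ∀ᵐ ξ : G, ξ.1 ≠ 0 ∧ ξ.2 ≠ 0 := by
    have h : ∀ᵐ x : ℝ, x ≠ 0 := by simp [ae_iff]
    have h1 : ∀ᵐ ξ : G, ξ.1 ≠ 0 := Measure.quasiMeasurePreserving_fst.ae h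
    have h2 : ∀ᵐ ξ : G, ξ.2 ≠ 0 := Measure.quasiMeasurePreserving_snd.ae h
    filter_upwards [h1, h2] with ξ a b using ⟨a, b⟩
  have hftm : ∀ {u : G → ℝ}, Nice u → AEMeasurable fun ξ => ‖ft u ξ‖ₑ ^ 2 := by
    intro u hu
    have hmeas : StronglyMeasurable fun z : G × G => chr (pair z.2 z.1) * (u z.2 : ℂ) := by
      refine StronglyMeasurable.mul (Continuous.stronglyMeasurable ?_)
        (Complex.continuous_ofReal.comp_stronglyMeasurable (hu.1.comp_measurable measurable_snd))
      refine continuous_chr.comp ?_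
      unfold pair
      fun_prop
    exact (hmeas.integral_prod_right'.enorm.pow_const 2).aemeasurable
  simp only [← plancherel hf, ← plancherel (hg _)]
  rw [← lintegral_finsetSum' _ fun i _ => hftm (hg i), ← lintegral_const_mul'' _ (hftm hf)]
  refine lintegral_mono_ae ?_
  filter_upwards [hae] with ξ hξ
  have : ∀ i, ‖ft (g i) ξ‖ₑ ^ 2 = ENNReal.ofReal (‖m i ξ‖ ^ 2) * ‖ft f ξ‖ₑ ^ 2 := fun i => by
    rw [hm, enorm_mul, mul_pow, ← ofReal_norm, ENNReal.ofReal_pow (norm_nonneg _)]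
  simp only [this]
  rw [← Finset.sum_mul, ← ENNReal.ofReal_sum_of_nonneg fun i _ => by positivity]
  gcongr
  exact hK ξ hξ.1 hξ.2

end FourierPlane

end

section Oscillation

theorem oscillatory_identity_bound {φ v w : ℝ → ℝ} {a a' : ℝ → ℂ} {A l : ℝ} (hl : 0 < l)
    (hφ : ∀ s ∈ Icc (1:ℝ) 2, HasDerivAt φ (v s) s) (hv : ∀ s ∈ Icc (1:ℝ) 2, HasDerivAt v (w s) s)
    (hw : ContinuousOn w (Icc 1 2)) (ha : ∀ s ∈ Icc (1:ℝ) 2, HasDerivAt a (a' s) s)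
    (ha' : ContinuousOn a' (Icc 1 2)) (hA : ∀ s ∈ Icc (1:ℝ) 2, ‖a s‖ ≤ A)
    (hA' : ∀ s ∈ Icc (1:ℝ) 2, ‖a' s‖ ≤ A) :
    ‖∫ s in (1:ℝ)..2, Complex.exp (φ s * Complex.I) * a s‖ ≤
      2 * A / √l + A * ∫ s in (1:ℝ)..2, (|w s| + l) / (v s ^ 2 + l) := by
  have hsl : 0 < √l := Real.sqrt_pos.2 hl
  have hA0 : 0 ≤ A := (norm_nonneg _).trans (hA 1 (by simp))
  have hD : ∀ s, 0 < v s ^ 2 + l := fun s => by positivity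
  have hcφ : ContinuousOn φ (Icc 1 2) := fun s hs => (hφ s hs).continuousAt.continuousWithinAt
  have hcv : ContinuousOn v (Icc 1 2) := fun s hs => (hv s hs).continuousAt.continuousWithinAt
  have hca : ContinuousOn a (Icc 1 2) := fun s hs => (ha s hs).continuousAt.continuousWithinAt
  let h : ℝ → ℝ := fun s => v s / (v s ^ 2 + l)
  let h' : ℝ → ℝ := fun s => (w s * (v s ^ 2 + l) - v s * (2 * v s * w s)) / (v s ^ 2 + l) ^ 2
  have hh : ∀ s ∈ Icc (1:ℝ) 2, HasDerivAt h (h' s) s := fun s hs => by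
    have h1 := ((hv s hs).pow 2).add_const l
    convert! (hv s hs).div h1 (hD s).ne' using 1
    simp [h']
  have hch : ContinuousOn h (Icc 1 2) := fun s hs => (hh s hs).continuousAt.continuousWithinAt
  have hch' : ContinuousOn h' (Icc 1 2) := by
    refine ContinuousOn.div (by fun_prop) (by fun_prop) fun s _ => (pow_pos (hD s) 2).ne'
  have hhb : ∀ s, |h s| ≤ 1 / (2 * √l) := fun s => by
    simp only [h]
    rw [abs_div, abs_of_pos (hD s), div_le_div_iff₀ (hD s) (by positivity)]
    nlinarith [sq_nonneg (|v s| - √l), Real.sq_sqrt hl.le, sq_abs (v s)]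
  have hhb' : ∀ s, |h' s| ≤ |w s| / (v s ^ 2 + l) := fun s => by
    have e : h' s = w s * ((l - v s ^ 2) / (v s ^ 2 + l) ^ 2) := by
      simp only [h']
      ring
    rw [e, abs_mul, div_eq_mul_inv |w s|]
    refine mul_le_mul_of_nonneg_left ?_ (abs_nonneg _)
    rw [abs_div, abs_of_pos (pow_pos (hD s) 2), div_le_iff₀ (pow_pos (hD s) 2),
      show (v s ^ 2 + l)⁻¹ * (v s ^ 2 + l) ^ 2 = v s ^ 2 + l by field_simp [(hD s).ne'], abs_le]
    constructor <;> nlinarith [sq_nonneg (v s)]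
  let e : ℝ → ℂ := fun s => Complex.exp (φ s * Complex.I)
  have hne : ∀ s, ‖e s‖ = 1 := fun s => Complex.norm_exp_ofReal_mul_I _
  have he : ∀ s ∈ Icc (1:ℝ) 2, HasDerivAt e (e s * (v s * Complex.I)) s := fun s hs =>
    (((hφ s hs).ofReal_comp).mul_const Complex.I).cexp
  have hce : ContinuousOn e (Icc 1 2) := fun s hs => (he s hs).continuousAt.continuousWithinAt
  let F : ℝ → ℂ := fun s => e s * a s * (h s : ℂ) * (-Complex.I)
  let R : ℝ → ℂ := fun s => e s * a s * ((l / (v s ^ 2 + l) : ℝ) : ℂ) +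
    e s * (a' s * (h s : ℂ) + a s * (h' s : ℂ)) * Complex.I
  have hF : ∀ s ∈ Icc (1:ℝ) 2, HasDerivAt F (e s * a s - R s) s := fun s hs => by
    have h1 := (((he s hs).mul (ha s hs)).mul (hh s hs).ofReal_comp).mul_const (-Complex.I)
    convert! h1 using 1
    have h2 : (v s : ℂ) * (h s : ℂ) = 1 - ((l / (v s ^ 2 + l) : ℝ) : ℂ) := by
      have : v s * h s = 1 - l / (v s ^ 2 + l) := by
        simp only [h]
        field_simp [(hD s).ne']
        ring
      exact_mod_cast congrArg (fun r : ℝ => (r : ℂ)) this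
    simp only [R, Pi.mul_apply]
    have h3 : e s * (v s * Complex.I) * a s * (h s : ℂ) * (-Complex.I) =
        e s * a s * (1 - ((l / (v s ^ 2 + l) : ℝ) : ℂ)) := by
      rw [← h2]
      linear_combination (-(e s * v s * a s * h s)) * Complex.I_mul_I
    linear_combination -h3
  have hcl : ContinuousOn (fun s => l / (v s ^ 2 + l)) (Icc 1 2) :=
    ContinuousOn.div (by fun_prop) (by fun_prop) fun s _ => (hD s).ne'
  have hofr : ∀ {g : ℝ → ℝ}, ContinuousOn g (Icc 1 2) → ContinuousOn (fun s => (g s : ℂ)) (Icc 1 2) :=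
    fun hg => Complex.continuous_ofReal.comp_continuousOn hg
  have hcR : ContinuousOn R (Icc 1 2) :=
    ((hce.mul hca).mul (hofr hcl)).add ((hce.mul ((ha'.mul (hofr hch)).add (hca.mul (hofr hch')))).mul
      continuousOn_const)
  have hu : uIcc (1:ℝ) 2 = Icc 1 2 := uIcc_of_le (by norm_num)
  have iea : IntervalIntegrable (fun s => e s * a s) volume 1 2 := by
    apply ContinuousOn.intervalIntegrable
    rw [hu]
    exact hce.mul hca
  have iR : IntervalIntegrable R volume 1 2 := by
    apply ContinuousOn.intervalIntegrable
    rwa [hu]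
  have ftc := intervalIntegral.integral_eq_sub_of_hasDerivAt (a := 1) (b := 2)
    (fun s hs => hF s (hu ▸ hs)) (iea.sub iR)
  rw [intervalIntegral.integral_sub iea iR] at ftc
  have hFb : ∀ s ∈ Icc (1:ℝ) 2, ‖F s‖ ≤ A / (2 * √l) := fun s hs => by
    simp only [F, norm_mul, hne, one_mul, norm_neg, Complex.norm_I, mul_one, Complex.norm_real,
      Real.norm_eq_abs]
    rw [div_eq_mul_one_div]
    exact mul_le_mul (hA s hs) (hhb s) (abs_nonneg _) hA0
  have hq : ContinuousOn (fun s => (|w s| + l) / (v s ^ 2 + l)) (Icc 1 2) :=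
    ContinuousOn.div (by fun_prop) (by fun_prop) fun s _ => (hD s).ne'
  have hRb : ∀ s ∈ Icc (1:ℝ) 2, ‖R s‖ ≤ A / (2 * √l) + A * ((|w s| + l) / (v s ^ 2 + l)) :=
    fun s hs => by
      simp only [R]
      refine (norm_add_le _ _).trans ?_
      simp only [norm_mul, hne, one_mul, Complex.norm_I, mul_one, Complex.norm_real,
        Real.norm_eq_abs]
      have t1 : ‖a s‖ * |l / (v s ^ 2 + l)| ≤ A * (l / (v s ^ 2 + l)) := by
        rw [abs_of_nonneg (by positivity)]
        exact mul_le_mul_of_nonneg_right (hA s hs) (by positivity)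
      have t2 : ‖a' s * (h s : ℂ) + a s * (h' s : ℂ)‖ ≤
          A * (1 / (2 * √l)) + A * (|w s| / (v s ^ 2 + l)) := by
        refine (norm_add_le _ _).trans (add_le_add ?_ ?_)
        · rw [norm_mul, Complex.norm_real]
          exact mul_le_mul (hA' s hs) (hhb s) (abs_nonneg _) hA0
        · rw [norm_mul, Complex.norm_real]
          exact mul_le_mul (hA s hs) (hhb' s) (abs_nonneg _) hA0
      refine (add_le_add t1 t2).trans (le_of_eq ?_)
      ring
  have iq : IntervalIntegrable (fun s => (|w s| + l) / (v s ^ 2 + l)) volume 1 2 := by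
    apply ContinuousOn.intervalIntegrable
    rwa [hu]
  have hRi : ‖∫ s in (1:ℝ)..2, R s‖ ≤
      A / (2 * √l) + A * ∫ s in (1:ℝ)..2, (|w s| + l) / (v s ^ 2 + l) := by
    refine (intervalIntegral.norm_integral_le_of_norm_le (by norm_num)
      (Eventually.of_forall fun s hs => hRb s (Ioc_subset_Icc_self hs))
      (intervalIntegrable_const.add (iq.const_mul A))).trans (le_of_eq ?_)
    rw [intervalIntegral.integral_add intervalIntegrable_const (iq.const_mul A),
      intervalIntegral.integral_const_mul]
    norm_num
  have e1 : ∫ s in (1:ℝ)..2, e s * a s = F 2 - F 1 + ∫ s in (1:ℝ)..2, R s := by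
    rw [← ftc]
    ring
  have h1 := hFb 1 (by simp)
  have h2 := hFb 2 (by simp)
  have e2 : A / (2 * √l) + A / (2 * √l) + A / (2 * √l) ≤ 2 * A / √l := by
    rw [← add_div, ← add_div, div_le_div_iff₀ (by positivity) hsl]
    nlinarith
  change ‖∫ s in (1:ℝ)..2, e s * a s‖ ≤ _
  rw [e1]
  have := (norm_add_le (F 2 - F 1) (∫ s in (1:ℝ)..2, R s)).trans
    (add_le_add (norm_sub_le _ _) hRi)
  linarith

theorem integral_curvature_le {v w : ℝ → ℝ} {l σ : ℝ} (hl : 0 < l) (hσ : |σ| = 1)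
    (hv : ∀ s ∈ Icc (1:ℝ) 2, HasDerivAt v (w s) s) (hw : ContinuousOn w (Icc 1 2))
    (hlw : ∀ s ∈ Icc (1:ℝ) 2, l ≤ σ * w s) :
    ∫ s in (1:ℝ)..2, (|w s| + l) / (v s ^ 2 + l) ≤ 2 * Real.pi / √l := by
  have hsl : 0 < √l := Real.sqrt_pos.2 hl
  have hD : ∀ s, 0 < v s ^ 2 + l := fun s => by positivity
  have hu : uIcc (1:ℝ) 2 = Icc 1 2 := uIcc_of_le (by norm_num)
  have hcv : ContinuousOn v (Icc 1 2) := fun s hs => (hv s hs).continuousAt.continuousWithinAt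
  let P : ℝ → ℝ := fun s => 2 * σ / √l * Real.arctan (v s / √l)
  have hP : ∀ s ∈ Icc (1:ℝ) 2, HasDerivAt P (2 * (σ * w s) / (v s ^ 2 + l)) s := fun s hs => by
    have h1 := (((hv s hs).div_const (√l)).arctan).const_mul (2 * σ / √l)
    convert! h1 using 1
    have e : 1 + (v s / √l) ^ 2 = (v s ^ 2 + l) / l := by
      rw [div_pow, Real.sq_sqrt hl.le]
      field_simp
      ring
    rw [e]
    have := (hD s).ne'
    field_simp
    rw [Real.sq_sqrt hl.le]
  have i2 : IntervalIntegrable (fun s => 2 * (σ * w s) / (v s ^ 2 + l)) volume 1 2 := by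
    apply ContinuousOn.intervalIntegrable
    rw [hu]
    exact ContinuousOn.div (by fun_prop) (by fun_prop) fun s _ => (hD s).ne'
  have i1 : IntervalIntegrable (fun s => (|w s| + l) / (v s ^ 2 + l)) volume 1 2 := by
    apply ContinuousOn.intervalIntegrable
    rw [hu]
    exact ContinuousOn.div (by fun_prop) (by fun_prop) fun s _ => (hD s).ne'
  have ftc := intervalIntegral.integral_eq_sub_of_hasDerivAt (a := 1) (b := 2)
    (fun s hs => hP s (hu ▸ hs)) i2
  have hle : ∀ s ∈ Icc (1:ℝ) 2, (|w s| + l) / (v s ^ 2 + l) ≤ 2 * (σ * w s) / (v s ^ 2 + l) := by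
    intro s hs
    have h1 := hlw s hs
    have : |w s| = σ * w s := by
      rw [← abs_of_pos (hl.trans_le h1), abs_mul, hσ, one_mul]
    have := hD s
    gcongr
    linarith
  refine (intervalIntegral.integral_mono_on (by norm_num) i1 i2 hle).trans ?_
  rw [ftc]
  simp only [P]
  have b1 := Real.arctan_lt_pi_div_two (v 2 / √l)
  have b2 := Real.neg_pi_div_two_lt_arctan (v 2 / √l)
  have b3 := Real.arctan_lt_pi_div_two (v 1 / √l)
  have b4 := Real.neg_pi_div_two_lt_arctan (v 1 / √l)
  rw [← mul_sub]
  refine (le_abs_self _).trans ?_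
  rw [abs_mul, abs_div, abs_mul, hσ, abs_of_pos hsl, div_mul_eq_mul_div]
  have : |Real.arctan (v 2 / √l) - Real.arctan (v 1 / √l)| ≤ Real.pi := by
    rw [abs_le]
    constructor <;> linarith
  rw [show |(2:ℝ)| = 2 by norm_num, mul_one]
  gcongr

theorem exists_oscillation_bound {b : ℝ} (hb : 1 < b) :
    ∃ C > 0, ∀ (x y A : ℝ) (a a' : ℝ → ℂ), (∀ s ∈ Icc (1:ℝ) 2, HasDerivAt a (a' s) s) →
      ContinuousOn a' (Icc 1 2) → (∀ s ∈ Icc (1:ℝ) 2, ‖a s‖ ≤ A) →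
      (∀ s ∈ Icc (1:ℝ) 2, ‖a' s‖ ≤ A) →
      (x ≠ 0 → ‖∫ s in (1:ℝ)..2, chr (s * x + s ^ b * y) * a s‖ ≤ C * A / √|x|) ∧
      (y ≠ 0 → ‖∫ s in (1:ℝ)..2, chr (s * x + s ^ b * y) * a s‖ ≤ C * A / √|y|) := by
  have hpi := Real.pi_pos
  have hb0 : 0 < b := by linarith
  have hb1 : 0 < b - 1 := by linarith
  have h2b : (1:ℝ) ≤ 2 ^ b := Real.one_le_rpow (by norm_num) hb0.le
  set c0 := Real.pi * b * (b - 1) with hc0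
  have hc0p : 0 < c0 := by positivity
  set c1 := (2 + 2 * Real.pi) / √c0 with hc1
  have hc1p : 0 < c1 := by positivity
  set K := 2 * b * 2 ^ b with hK
  have hKp : 0 < K := by positivity
  have hK1 : 0 ≤ c1 * √K := by positivity
  refine ⟨c1 + c1 * √K + (3 + Real.pi * b), by positivity, ?_⟩
  intro x y A a a' ha ha' hA hA'
  have hA0 : 0 ≤ A := (norm_nonneg _).trans (hA 1 (by simp))
  let φ : ℝ → ℝ := fun s => -(2 * Real.pi * (s * x + s ^ b * y))
  let v : ℝ → ℝ := fun s => -(2 * Real.pi * (x + b * s ^ (b - 1) * y))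
  let w : ℝ → ℝ := fun s => -(2 * Real.pi * (b * ((b - 1) * s ^ (b - 1 - 1)) * y))
  have hpos : ∀ s ∈ Icc (1:ℝ) 2, 0 < s := fun s hs => by linarith [hs.1]
  have hφ : ∀ s ∈ Icc (1:ℝ) 2, HasDerivAt φ (v s) s := fun s hs => by
    have h1 := Real.hasDerivAt_rpow_const (p := b) (Or.inl (hpos s hs).ne')
    have h2 := ((((hasDerivAt_id s).mul_const x).add (h1.mul_const y)).const_mul (2 * Real.pi)).neg
    convert! h2 using 1
    simp [v]
  have hv : ∀ s ∈ Icc (1:ℝ) 2, HasDerivAt v (w s) s := fun s hs => by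
    have h1 := Real.hasDerivAt_rpow_const (p := b - 1) (Or.inl (hpos s hs).ne')
    exact ((((h1.const_mul b).mul_const y).const_add x).const_mul (2 * Real.pi)).neg
  have hw : ContinuousOn w (Icc 1 2) := by
    have : ContinuousOn (fun s : ℝ => s ^ (b - 1 - 1)) (Icc 1 2) := fun s hs =>
      (Real.continuousAt_rpow_const _ _ (Or.inl (hpos s hs).ne')).continuousWithinAt
    fun_prop
  have hlow : ∀ s ∈ Icc (1:ℝ) 2, 1 / 2 ≤ s ^ (b - 1 - 1) := fun s hs => by
    have h1 : s ^ (-1:ℝ) ≤ s ^ (b - 1 - 1) := Real.rpow_le_rpow_of_exponent_le hs.1 (by linarith)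
    refine le_trans ?_ h1
    rw [Real.rpow_neg_one, one_div]
    exact inv_anti₀ (hpos s hs) hs.2
  have hup : ∀ s ∈ Icc (1:ℝ) 2, ∀ e ≤ b, s ^ e ≤ 2 ^ b := fun s hs e he =>
    (Real.rpow_le_rpow_of_exponent_le hs.1 he).trans
      (Real.rpow_le_rpow (hpos s hs).le hs.2 hb0.le)
  have hchr : ∀ s, chr (s * x + s ^ b * y) = Complex.exp (φ s * Complex.I) := fun s => rfl
  simp only [hchr]
  set I := ∫ s in (1:ℝ)..2, Complex.exp (φ s * Complex.I) * a s with hI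
  have hIA : ‖I‖ ≤ A := by
    refine (intervalIntegral.norm_integral_le_of_norm_le_const (C := A) fun s hs => ?_).trans ?_
    · rw [uIoc_of_le (by norm_num)] at hs
      rw [norm_mul, Complex.norm_exp_ofReal_mul_I, one_mul]
      exact hA s (Ioc_subset_Icc_self hs)
    · norm_num
  have hy : y ≠ 0 → ‖I‖ ≤ c1 * A / √|y| := by
    intro hy
    have hy' : 0 < |y| := abs_pos.2 hy
    have hl : 0 < c0 * |y| := by positivity
    have h1 := oscillatory_identity_bound hl hφ hv hw ha ha' hA hA'
    have h2 := integral_curvature_le (σ := -SignType.sign y) hl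
      (by rcases lt_or_gt_of_ne hy with h | h <;> simp [h]) hv hw fun s hs => by
        have e : -(SignType.sign y : ℝ) * w s =
            2 * Real.pi * (b * ((b - 1) * s ^ (b - 1 - 1))) * (SignType.sign y * y) := by
          simp only [w]
          ring
        rw [e, sign_mul_self, hc0]
        have := hlow s hs
        have : Real.pi * b * (b - 1) = 2 * Real.pi * (b * ((b - 1) * (1 / 2))) := by ring
        rw [this]
        gcongr
    refine h1.trans ((add_le_add_right (mul_le_mul_of_nonneg_left h2 hA0) _).trans (le_of_eq ?_))
    rw [Real.sqrt_mul hc0p.le, hc1]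
    have := Real.sqrt_pos.2 hc0p
    have := Real.sqrt_pos.2 hy'
    field_simp
  refine ⟨fun hx => ?_, fun hy0 => (hy hy0).trans ?_⟩
  · have hx' : 0 < |x| := abs_pos.2 hx
    have hsx := Real.sqrt_pos.2 hx'
    rcases lt_or_ge |x| (K * |y|) with hxy | hxy
    · have hy0 : 0 < |y| := pos_of_mul_pos_right (hx'.trans hxy) hKp.le
      have hsy := Real.sqrt_pos.2 hy0
      refine (hy (abs_pos.1 hy0)).trans ?_
      rw [div_le_div_iff₀ hsy hsx]
      have h1 : √|x| ≤ √K * √|y| := by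
        rw [← Real.sqrt_mul hKp.le]
        exact Real.sqrt_le_sqrt hxy.le
      calc c1 * A * √|x| ≤ c1 * A * (√K * √|y|) := by gcongr
        _ = c1 * √K * A * √|y| := by ring
        _ ≤ _ := by gcongr; nlinarith
    · rcases lt_or_ge |x| 1 with hx1 | hx1
      · refine hIA.trans ?_
        rw [le_div_iff₀ hsx, mul_comm _ A]
        refine mul_le_mul_of_nonneg_left ?_ hA0
        have : √|x| ≤ 1 := Real.sqrt_le_one.2 hx1.le
        nlinarith
      · have h1 := oscillatory_identity_bound hx' hφ hv hw ha ha' hA hA'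
        have h2 : ∀ s ∈ Icc (1:ℝ) 2, (|w s| + |x|) / (v s ^ 2 + |x|) ≤
            (Real.pi * b + 1) / √|x| := fun s hs => by
          have u1 : |b * s ^ (b - 1) * y| ≤ |x| / 2 := by
            rw [abs_mul, abs_of_pos (by have := hpos s hs; positivity)]
            have := hup s hs (b - 1) (by linarith)
            calc b * s ^ (b - 1) * |y| ≤ b * 2 ^ b * |y| := by gcongr
              _ = K * |y| / 2 := by rw [hK]; ring
              _ ≤ _ := by linarith
          have u2 : |w s| ≤ Real.pi * b * |x| := by
            have := hpos s hs
            simp only [w]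
            rw [abs_neg, abs_mul, abs_of_pos Real.two_pi_pos, abs_mul, abs_of_pos (by positivity)]
            have := hup s hs (b - 1 - 1) (by linarith)
            calc 2 * Real.pi * (b * ((b - 1) * s ^ (b - 1 - 1)) * |y|)
                ≤ 2 * Real.pi * (b * (b * 2 ^ b) * |y|) := by gcongr; linarith
              _ = Real.pi * b * (K * |y|) := by rw [hK]; ring
              _ ≤ _ := by gcongr
          have u3 : |x| ≤ |v s| := by
            simp only [v]
            rw [abs_neg, abs_mul, abs_of_pos Real.two_pi_pos]
            have h3 : |x| / 2 ≤ |x + b * s ^ (b - 1) * y| := by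
              have := abs_sub_abs_le_abs_sub x (-(b * s ^ (b - 1) * y))
              rw [abs_neg, sub_neg_eq_add] at this
              linarith
            have h4 : (2:ℝ) ≤ 2 * Real.pi := by linarith [Real.pi_gt_three]
            nlinarith [abs_nonneg x]
          have u4 : |x| ^ 2 ≤ v s ^ 2 := by
            rw [← sq_abs (v s)]
            gcongr
          have hs1 : √|x| ≤ |x| := by
            rw [Real.sqrt_le_left (by positivity)]
            nlinarith
          rw [div_le_div_iff₀ (by positivity) hsx]
          calc (|w s| + |x|) * √|x| ≤ (Real.pi * b * |x| + |x|) * |x| := by gcongr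
            _ = (Real.pi * b + 1) * |x| ^ 2 := by ring
            _ ≤ _ := by gcongr; linarith
        have h3 : ∫ s in (1:ℝ)..2, (|w s| + |x|) / (v s ^ 2 + |x|) ≤
            (Real.pi * b + 1) / √|x| := by
          have hcv : ContinuousOn v (Icc 1 2) := fun s hs =>
            (hv s hs).continuousAt.continuousWithinAt
          refine (intervalIntegral.integral_mono_on (by norm_num) ?_ intervalIntegrable_const
            h2).trans (by norm_num)
          apply ContinuousOn.intervalIntegrable
          rw [uIcc_of_le (by norm_num)]
          exact ContinuousOn.div (by fun_prop) (by fun_prop) fun s _ => by positivity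
        refine h1.trans ((add_le_add_right (mul_le_mul_of_nonneg_left h3 hA0) _).trans ?_)
        rw [mul_div_assoc', ← add_div]
        gcongr
        nlinarith
  · gcongr
    nlinarith [Real.pi_pos]

end Oscillation

section Symbols

theorem sym_cur (b X Y : ℝ) (ξ : G) :
    sym (cur b X Y) ξ = ∫ s in (1:ℝ)..2, chr (s * (X * ξ.1) + s ^ b * (Y * ξ.2)) := by
  rw [sym, cur, integral_map (f := fun y => chr (pair y ξ)) (measurable_curPar b X Y).aemeasurable
    (continuous_chr.comp (continuous_pair ξ)).aestronglyMeasurable,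
    intervalIntegral.integral_of_le (by norm_num), integral_Icc_eq_integral_Ioc]
  simp only [pair, mul_assoc]

theorem continuous_chr_phase {b : ℝ} (hb : 1 < b) (x y : ℝ) :
    Continuous fun s : ℝ => chr (s * x + s ^ b * y) := by
  have : Continuous fun s : ℝ => s ^ b := Real.continuous_rpow_const (by linarith)
  exact continuous_chr.comp (by fun_prop)

theorem hasDerivAt_chr_rpow {b : ℝ} (hb : 1 < b) (r : ℝ) {s : ℝ} (hs : s ∈ Icc (1:ℝ) 2) :
    HasDerivAt (fun s : ℝ => chr (s ^ b * r) - 1)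
      (chr (s ^ b * r) * (((-(2 * Real.pi * (b * s ^ (b - 1) * r)) : ℝ) : ℂ) * Complex.I)) s := by
  have hs0 : s ≠ 0 := by linarith [hs.1]
  have h1 := Real.hasDerivAt_rpow_const (p := b) (Or.inl hs0)
  exact ((((h1.mul_const r).const_mul (2 * Real.pi)).neg.ofReal_comp).mul_const
    Complex.I).cexp.sub_const 1

theorem exists_sym_cur_bounds {b : ℝ} (hb : 1 < b) :
    ∃ C ≥ 1, ∀ (X Y : ℝ) (ξ : G), X * ξ.1 ≠ 0 → Y * ξ.2 ≠ 0 →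
      (∀ ρ ∈ Icc (1:ℝ) 4, ‖sym (cur b X (ρ * Y)) ξ‖ ≤ C / √|X * ξ.1| ∧
        ‖sym (cur b X (ρ * Y)) ξ‖ ≤ C / √|Y * ξ.2|) ∧
      (∀ ρ ∈ Icc (1:ℝ) 4, ∀ ρ' ∈ Icc (1:ℝ) 4,
        ‖sym (cur b X (ρ * Y)) ξ - sym (cur b X (ρ' * Y)) ξ‖ ≤
            C * (|ρ - ρ'| * |Y * ξ.2|) / √|X * ξ.1| ∧
        ‖sym (cur b X (ρ * Y)) ξ - sym (cur b X (ρ' * Y)) ξ‖ ≤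
            C * (|ρ - ρ'| * |Y * ξ.2|) / √|Y * ξ.2|) := by
  obtain ⟨C, hC, hosc⟩ := exists_oscillation_bound hb
  have hpi := Real.pi_pos
  have hb0 : 0 < b := by linarith
  have h2b : (1:ℝ) ≤ 2 ^ b := Real.one_le_rpow (by norm_num) hb0.le
  set D := 2 * Real.pi * b * 2 ^ b with hD
  have hDp : 0 < D := by positivity
  have base : ∀ (X Y : ℝ) (ξ : G), X * ξ.1 ≠ 0 → Y * ξ.2 ≠ 0 →
      ∀ ρ ∈ Icc (1:ℝ) 4, ‖sym (cur b X (ρ * Y)) ξ‖ ≤ C / √|X * ξ.1| ∧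
        ‖sym (cur b X (ρ * Y)) ξ‖ ≤ C / √|Y * ξ.2| := by
    intro X Y ξ hx hy ρ hρ
    have hρ0 : ρ ≠ 0 := by linarith [hρ.1]
    have h := hosc (X * ξ.1) (ρ * Y * ξ.2) 1 (fun _ => 1) (fun _ => 0)
      (fun s _ => hasDerivAt_const s 1) continuousOn_const (by simp) (by simp)
    simp only [mul_one] at h
    rw [sym_cur]
    refine ⟨h.1 hx, (h.2 (by rw [mul_assoc]; exact mul_ne_zero hρ0 hy)).trans ?_⟩
    have : |Y * ξ.2| ≤ |ρ * Y * ξ.2| := by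
      rw [mul_assoc, abs_mul ρ]
      exact le_mul_of_one_le_left (abs_nonneg _) (hρ.1.trans (le_abs_self _))
    have h0 := Real.sqrt_pos.2 (abs_pos.2 hy)
    gcongr
  refine ⟨1 + 2 * C + C * D, by nlinarith [mul_pos hC hDp], ?_⟩
  intro X Y ξ hx hy
  have hsx := Real.sqrt_pos.2 (abs_pos.2 hx)
  have hsy := Real.sqrt_pos.2 (abs_pos.2 hy)
  have hCD : 0 < C * D := mul_pos hC hDp
  refine ⟨fun ρ hρ => ⟨((base X Y ξ hx hy ρ hρ).1).trans (by gcongr; linarith),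
    ((base X Y ξ hx hy ρ hρ).2).trans (by gcongr; linarith)⟩, ?_⟩
  intro ρ hρ ρ' hρ'
  set r := |ρ - ρ'| * |Y * ξ.2| with hr
  have hr0 : 0 ≤ r := by positivity
  rcases lt_or_ge 1 r with h1 | h1
  · have b1 := base X Y ξ hx hy ρ hρ
    have b2 := base X Y ξ hx hy ρ' hρ'
    have key : ∀ z : ℝ, 0 < z → C / z + C / z ≤ (1 + 2 * C + C * D) * r / z := fun z hz => by
      rw [← add_div]
      gcongr
      nlinarith
    exact ⟨(norm_sub_le _ _).trans ((add_le_add b1.1 b2.1).trans (key _ hsx)),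
      (norm_sub_le _ _).trans ((add_le_add b1.2 b2.2).trans (key _ hsy))⟩
  · have hρ'0 : ρ' ≠ 0 := by linarith [hρ'.1]
    have hra : |(ρ - ρ') * (Y * ξ.2)| = r := by rw [abs_mul]
    have h := hosc (X * ξ.1) (ρ' * Y * ξ.2) (D * r)
      (fun s => chr (s ^ b * ((ρ - ρ') * (Y * ξ.2))) - 1) _
      (fun s hs => hasDerivAt_chr_rpow hb _ hs) (by
        have : Continuous fun s : ℝ => s ^ b := Real.continuous_rpow_const hb0.le
        have : Continuous fun s : ℝ => s ^ (b - 1) := Real.continuous_rpow_const (by linarith)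
        have := continuous_chr
        fun_prop) (fun s hs => by
        have h := norm_chr_sub_le (s ^ b * ((ρ - ρ') * (Y * ξ.2))) 0
        rw [chr_zero] at h
        refine h.trans ?_
        rw [sub_zero, abs_mul, hra, hD]
        have := rpow_le_two_rpow hb0.le hs
        calc 2 * Real.pi * (|s ^ b| * r) ≤ 2 * Real.pi * (2 ^ b * r) := by gcongr
          _ ≤ 2 * Real.pi * (2 ^ b * r) * b := le_mul_of_one_le_right (by positivity) hb.le
          _ = _ := by ring) (fun s hs => by
        rw [norm_mul, norm_chr, one_mul, norm_mul, Complex.norm_I, mul_one, Complex.norm_real,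
          Real.norm_eq_abs, abs_neg, abs_mul, abs_of_pos Real.two_pi_pos, abs_mul, hra, abs_mul,
          abs_of_pos hb0, hD]
        have hs0 : 0 ≤ s := by linarith [hs.1]
        have : |s ^ (b - 1)| ≤ 2 ^ b := (rpow_le_two_rpow (by linarith) hs).trans
          (Real.rpow_le_rpow_of_exponent_le (by norm_num) (by linarith))
        calc 2 * Real.pi * (b * |s ^ (b - 1)| * r) ≤ 2 * Real.pi * (b * 2 ^ b * r) := by gcongr
          _ = _ := by ring)
    have e : sym (cur b X (ρ * Y)) ξ - sym (cur b X (ρ' * Y)) ξ =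
        ∫ s in (1:ℝ)..2, chr (s * (X * ξ.1) + s ^ b * (ρ' * Y * ξ.2)) *
          (chr (s ^ b * ((ρ - ρ') * (Y * ξ.2))) - 1) := by
      rw [sym_cur, sym_cur, ← intervalIntegral.integral_sub
        ((continuous_chr_phase hb _ _).intervalIntegrable _ _)
        ((continuous_chr_phase hb _ _).intervalIntegrable _ _)]
      refine intervalIntegral.integral_congr fun s _ => ?_
      rw [mul_sub, ← chr_add, mul_one]
      congr 2
      ring
    rw [e]
    have hy' : ρ' * Y * ξ.2 ≠ 0 := by rw [mul_assoc]; exact mul_ne_zero hρ'0 hy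
    have hle : |Y * ξ.2| ≤ |ρ' * Y * ξ.2| := by
      rw [mul_assoc, abs_mul ρ']
      exact le_mul_of_one_le_left (abs_nonneg _) (hρ'.1.trans (le_abs_self _))
    have hC' : C * (D * r) ≤ (1 + 2 * C + C * D) * r := by nlinarith
    refine ⟨(h.1 hx).trans (by gcongr), (h.2 hy').trans ?_⟩
    refine (div_le_div_of_nonneg_left (by positivity) hsy (Real.sqrt_le_sqrt hle)).trans ?_
    gcongr

theorem sq_le_of_bounds {t C x y η : ℝ} (ht : 0 ≤ t) (hC : 0 < C) (hx : 0 < x) (hy : 0 < y)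
    (hη : 0 ≤ η) (hη' : η ≤ 1 / 2) (h0 : t ≤ C) (h1 : t ≤ C / √x) (h2 : t ≤ C / √y) :
    t ^ 2 ≤ C ^ 2 * (x ^ (-η) * y ^ (-η)) := by
  have e : ∀ u : ℝ, 0 ≤ u → u ^ 2 = u ^ (2 - 4 * η) * (u ^ (2 * η) * u ^ (2 * η)) := fun u hu => by
    rw [← Real.rpow_add_of_nonneg hu (by linarith) (by linarith),
      ← Real.rpow_add_of_nonneg hu (by linarith) (by linarith), ← Real.rpow_natCast]
    congr 1
    push_cast
    ring
  have f : ∀ z : ℝ, 0 < z → (C / √z) ^ (2 * η) = C ^ (2 * η) * z ^ (-η) := fun z hz => by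
    rw [Real.div_rpow hC.le (Real.sqrt_nonneg _), Real.sqrt_eq_rpow, ← Real.rpow_mul hz.le,
      Real.rpow_neg hz.le, div_eq_mul_inv]
    congr 3
    ring
  rw [e t ht, e C hC.le]
  have g0 := Real.rpow_le_rpow ht h0 (by linarith : 0 ≤ 2 - 4 * η)
  have g1 := Real.rpow_le_rpow ht h1 (by linarith : 0 ≤ 2 * η)
  have g2 := Real.rpow_le_rpow ht h2 (by linarith : 0 ≤ 2 * η)
  rw [f x hx] at g1
  rw [f y hy] at g2
  calc t ^ (2 - 4 * η) * (t ^ (2 * η) * t ^ (2 * η))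
      ≤ C ^ (2 - 4 * η) * ((C ^ (2 * η) * x ^ (-η)) * (C ^ (2 * η) * y ^ (-η))) := by gcongr
    _ = _ := by ring

theorem sq_le_of_difference_bounds {t C x y η δ : ℝ} (ht : 0 ≤ t) (hC : 0 < C) (hx : 0 < x)
    (hy : 0 < y) (hδ : 0 ≤ δ)
    (hη : 0 ≤ η) (hη' : η ≤ 1 / 2) (h1 : t ≤ C / √x) (h2 : t ≤ C / √y)
    (h3 : t ≤ C * (δ * y) / √x) (h4 : t ≤ C * (δ * y) / √y) :
    t ^ 2 ≤ C ^ 2 * δ ^ (1 - 2 * η) * (x ^ (-η) * y ^ (-η)) := by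
  have half : ∀ z : ℝ, 0 < z → t ≤ C / √z → t ≤ C * (δ * y) / √z →
      t ≤ C * (δ * y) ^ ((1 - 2 * η) / 2) * z ^ (-(1 / 2) : ℝ) := by
    intro z hz g g'
    have hCz : 0 ≤ C / √z := by positivity
    have i1 := Real.rpow_le_rpow ht g (by linarith : 0 ≤ 1 - (1 - 2 * η) / 2)
    have i2 := Real.rpow_le_rpow ht g' (by linarith : 0 ≤ (1 - 2 * η) / 2)
    have e1 : ∀ u : ℝ, 0 ≤ u → u = u ^ (1 - (1 - 2 * η) / 2) * u ^ ((1 - 2 * η) / 2) := fun u hu => by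
      rw [← Real.rpow_add_of_nonneg hu (by linarith) (by linarith), sub_add_cancel, Real.rpow_one]
    have e2 : (C * (δ * y) / √z) ^ ((1 - 2 * η) / 2) =
        (δ * y) ^ ((1 - 2 * η) / 2) * (C / √z) ^ ((1 - 2 * η) / 2) := by
      rw [← Real.mul_rpow (by positivity) hCz]
      congr 1
      ring
    have e3 : C / √z = C * z ^ (-(1 / 2) : ℝ) := by
      rw [Real.rpow_neg hz.le, ← Real.sqrt_eq_rpow, div_eq_mul_inv]
    calc t = t ^ (1 - (1 - 2 * η) / 2) * t ^ ((1 - 2 * η) / 2) := e1 t ht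
      _ ≤ (C / √z) ^ (1 - (1 - 2 * η) / 2) * (C * (δ * y) / √z) ^ ((1 - 2 * η) / 2) := by gcongr
      _ = (δ * y) ^ ((1 - 2 * η) / 2) * (C / √z) := by
          rw [e2, mul_left_comm, ← e1 _ hCz]
      _ = _ := by rw [e3]; ring
  have a1 := half x hx h1 h3
  have a2 := half y hy h2 h4
  set B := C * (δ * y) ^ ((1 - 2 * η) / 2) with hB
  have hB0 : 0 ≤ B := by positivity
  have i1 := Real.rpow_le_rpow ht a1 (by linarith : 0 ≤ 2 * η)
  have i2 := Real.rpow_le_rpow ht a2 (by linarith : 0 ≤ 2 - 2 * η)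
  have e : ∀ u : ℝ, 0 ≤ u → u ^ 2 = u ^ (2 * η) * u ^ (2 - 2 * η) := fun u hu => by
    rw [← Real.rpow_add_of_nonneg hu (by linarith) (by linarith), ← Real.rpow_natCast]
    congr 1
    push_cast
    ring
  rw [Real.mul_rpow hB0 (by positivity), ← Real.rpow_mul hx.le] at i1
  rw [Real.mul_rpow hB0 (by positivity), ← Real.rpow_mul hy.le] at i2
  have hBsq : B ^ 2 = C ^ 2 * δ ^ (1 - 2 * η) * y ^ (1 - 2 * η) := by
    rw [hB, mul_pow, ← Real.rpow_natCast ((δ * y) ^ _), ← Real.rpow_mul (by positivity),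
      Real.mul_rpow hδ hy.le, show (1 - 2 * η) / 2 * ((2:ℕ):ℝ) = 1 - 2 * η by push_cast; ring,
      mul_assoc]
  calc t ^ 2 = t ^ (2 * η) * t ^ (2 - 2 * η) := e t ht
    _ ≤ (B ^ (2 * η) * x ^ (-(1 / 2) * (2 * η))) * (B ^ (2 - 2 * η) * y ^ (-(1 / 2) * (2 - 2 * η))) := by
        gcongr
    _ = B ^ 2 * (x ^ (-η) * y ^ (-(1 - η))) := by
        rw [e B hB0, show -(1 / 2 : ℝ) * (2 * η) = -η by ring,
          show -(1 / 2 : ℝ) * (2 - 2 * η) = -(1 - η) by ring]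
        ring
    _ = C ^ 2 * δ ^ (1 - 2 * η) * (x ^ (-η) * (y ^ (1 - 2 * η) * y ^ (-(1 - η)))) := by
        rw [hBsq]
        ring
    _ = _ := by
        rw [← Real.rpow_add hy]
        congr 3
        ring

theorem exists_sym_cur_sq_bounds {b : ℝ} (hb : 1 < b) :
    ∃ C > 0, ∀ (η : ℝ), 0 ≤ η → η ≤ 1 / 2 → ∀ (X Y : ℝ) (ξ : G), X * ξ.1 ≠ 0 → Y * ξ.2 ≠ 0 →
      (∀ ρ ∈ Icc (1:ℝ) 4, ‖sym (cur b X (ρ * Y)) ξ‖ ^ 2 ≤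
        C * (|X * ξ.1| ^ (-η) * |Y * ξ.2| ^ (-η))) ∧
      (∀ ρ ∈ Icc (1:ℝ) 4, ∀ ρ' ∈ Icc (1:ℝ) 4,
        ‖sym (cur b X (ρ * Y)) ξ - sym (cur b X (ρ' * Y)) ξ‖ ^ 2 ≤
          C * |ρ - ρ'| ^ (1 - 2 * η) * (|X * ξ.1| ^ (-η) * |Y * ξ.2| ^ (-η))) := by
  obtain ⟨C, hC, h⟩ := exists_sym_cur_bounds hb
  have hb0 : 0 ≤ b := by linarith
  refine ⟨(2 * C) ^ 2, by positivity, ?_⟩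
  intro η hη hη' X Y ξ hx hy
  obtain ⟨h1, h2⟩ := h X Y ξ hx hy
  have hx' := abs_pos.2 hx
  have hy' := abs_pos.2 hy
  have hCC : ∀ {z : ℝ}, C / √z ≤ 2 * C / √z := fun {z} => by
    apply div_le_div_of_nonneg_right _ (Real.sqrt_nonneg _)
    linarith
  have hdd : ∀ {z : ℝ}, C / √z + C / √z = 2 * C / √z := fun {z} => by ring
  refine ⟨fun ρ hρ => ?_, fun ρ hρ ρ' hρ' => ?_⟩
  · exact sq_le_of_bounds (norm_nonneg _) (by positivity) hx' hy' hη hη'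
      ((norm_sym_le (cProb_cur hb0 _ _) ξ).trans (by linarith)) ((h1 ρ hρ).1.trans hCC)
      ((h1 ρ hρ).2.trans hCC)
  · have k : ∀ {z : ℝ}, C * (|ρ - ρ'| * |Y * ξ.2|) / √z ≤ 2 * C * (|ρ - ρ'| * |Y * ξ.2|) / √z :=
      fun {z} => by
        apply div_le_div_of_nonneg_right _ (Real.sqrt_nonneg _)
        have : 0 ≤ |ρ - ρ'| * |Y * ξ.2| := by positivity
        nlinarith
    exact sq_le_of_difference_bounds (norm_nonneg _) (by positivity) hx' hy' (abs_nonneg _) hη hη'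
      (((norm_sub_le _ _).trans (add_le_add (h1 ρ hρ).1 (h1 ρ' hρ').1)).trans hdd.le)
      (((norm_sub_le _ _).trans (add_le_add (h1 ρ hρ).2 (h1 ρ' hρ').2)).trans hdd.le)
      ((h2 ρ hρ ρ' hρ').1.trans k) ((h2 ρ hρ ρ' hρ').2.trans k)

end Symbols

section Lattice

/-- The profile `min (u^η, u^{-η})`. -/
def hat (η u : ℝ) : ℝ := min (u ^ η) (u ^ (-η))

theorem hat_nonneg {η u : ℝ} (hu : 0 ≤ u) : 0 ≤ hat η u :=
  le_min (Real.rpow_nonneg hu _) (Real.rpow_nonneg hu _)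

theorem exists_sum_hat_le {η : ℝ} (hη : 0 < η) :
    ∃ C > 0, ∀ z : ℝ, 0 < z → ∀ s : Finset ℕ, ∑ n ∈ s, hat η (2 ^ n * z) ≤ C := by
  set r : ℝ := 2 ^ (-η) with hr
  have hr0 : 0 < r := by positivity
  have hr1 : r < 1 := Real.rpow_lt_one_of_one_lt_of_neg (by norm_num) (by linarith)
  have hsum : Summable fun k : ℤ => r ^ k.natAbs := by
    refine Summable.of_nat_of_neg ?_ ?_ <;>
      simpa using summable_geometric_of_lt_one hr0.le hr1
  have htpos : 0 ≤ ∑' k : ℤ, r ^ k.natAbs := tsum_nonneg fun k => by positivity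
  refine ⟨2 ^ η * ∑' k : ℤ, r ^ k.natAbs + 1, by positivity, fun z hz s => ?_⟩
  set m : ℤ := ⌊Real.logb 2 z⌋ with hm
  have hz2 : (2:ℝ) ^ (Real.logb 2 z) = z := Real.rpow_logb (by norm_num) (by norm_num) hz
  have term : ∀ n : ℕ, hat η (2 ^ n * z) ≤ 2 ^ η * r ^ ((n : ℤ) + m).natAbs := by
    intro n
    set t : ℝ := n + Real.logb 2 z with ht
    have e : 2 ^ n * z = (2:ℝ) ^ t := by
      rw [ht, Real.rpow_add (by norm_num), hz2, Real.rpow_natCast]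
    have h1 : ((n : ℤ) + m : ℤ) ≤ t := by
      push_cast
      have := Int.floor_le (Real.logb 2 z)
      linarith
    have h2 : t < ((n : ℤ) + m : ℤ) + (1 : ℝ) := by
      push_cast
      have := Int.lt_floor_add_one (Real.logb 2 z)
      linarith
    have h3 : (((n : ℤ) + m).natAbs : ℝ) = |(((n : ℤ) + m : ℤ) : ℝ)| := by
      rw [Nat.cast_natAbs, Int.cast_abs]
    rw [e, hat, ← Real.rpow_natCast, h3, hr, ← Real.rpow_mul (by norm_num),
      ← Real.rpow_mul (by norm_num), ← Real.rpow_mul (by norm_num),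
      ← Real.rpow_add (by norm_num)]
    rcases le_total 0 (((n : ℤ) + m : ℤ) : ℝ) with h | h
    · rw [abs_of_nonneg h]
      refine (min_le_right _ _).trans (Real.rpow_le_rpow_of_exponent_le (by norm_num) ?_)
      nlinarith
    · rw [abs_of_nonpos h]
      refine (min_le_left _ _).trans (Real.rpow_le_rpow_of_exponent_le (by norm_num) ?_)
      nlinarith
  have hinj : Function.Injective fun n : ℕ => (n : ℤ) + m := fun a b h => by simpa using h
  calc ∑ n ∈ s, hat η (2 ^ n * z) ≤ ∑ n ∈ s, 2 ^ η * r ^ ((n : ℤ) + m).natAbs :=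
        Finset.sum_le_sum fun n _ => term n
    _ = 2 ^ η * ∑ k ∈ s.image (fun n : ℕ => (n : ℤ) + m), r ^ k.natAbs := by
        rw [Finset.sum_image fun _ _ _ _ h => hinj h, Finset.mul_sum]
    _ ≤ 2 ^ η * ∑' k : ℤ, r ^ k.natAbs := by
        gcongr
        exact hsum.sum_le_tsum _ fun k _ => by positivity
    _ ≤ _ := by linarith

theorem exists_sum_hat_mul_hat_le {η : ℝ} (hη : 0 < η) :
    ∃ C > 0, ∀ {ι : Type} [Fintype ι] (n n' : ι → ℕ), (Function.Injective fun i => (n i, n' i)) →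
      ∀ z z' : ℝ, 0 < z → 0 < z' →
        ∑ i, hat η (2 ^ n i * z) * hat η (2 ^ n' i * z') ≤ C := by
  obtain ⟨C, hC, h⟩ := exists_sum_hat_le hη
  refine ⟨C * C, by positivity, ?_⟩
  intro ι _ n n' hinj z z' hz hz'
  have hn : ∀ (k : ℕ) {z : ℝ}, 0 < z → 0 ≤ hat η (2 ^ k * z) := fun k z hz =>
    hat_nonneg (by positivity)
  calc ∑ i, hat η (2 ^ n i * z) * hat η (2 ^ n' i * z')
      = ∑ k ∈ Finset.univ.image (fun i => (n i, n' i)),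
          hat η (2 ^ k.1 * z) * hat η (2 ^ k.2 * z') :=
        (Finset.sum_image (f := fun k : ℕ × ℕ => hat η (2 ^ k.1 * z) * hat η (2 ^ k.2 * z'))
          fun _ _ _ _ h => hinj h).symm
    _ ≤ ∑ k ∈ (Finset.univ.image n) ×ˢ (Finset.univ.image n'),
          hat η (2 ^ k.1 * z) * hat η (2 ^ k.2 * z') := by
        refine Finset.sum_le_sum_of_subset_of_nonneg ?_ fun k _ _ => mul_nonneg (hn _ hz) (hn _ hz')
        intro k hk
        obtain ⟨i, -, rfl⟩ := Finset.mem_image.1 hk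
        simp
    _ = (∑ k ∈ Finset.univ.image n, hat η (2 ^ k * z)) *
          ∑ k ∈ Finset.univ.image n', hat η (2 ^ k * z') := by
        rw [Finset.sum_product, Finset.sum_mul_sum]
    _ ≤ C * C := by
        gcongr
        · exact Finset.sum_nonneg fun k _ => hn _ hz'
        · exact h z hz _
        · exact h z' hz' _

theorem rpow_neg_mul_sq_le_hat {η u t K : ℝ} (hη : 0 ≤ η) (hη1 : η ≤ 1) (hu : 0 < u) (ht : 0 ≤ t)
    (h1 : t ≤ K) (h2 : t ≤ K * u) : u ^ (-η) * t ^ 2 ≤ K ^ 2 * hat η u := by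
  have hK : 0 ≤ K := ht.trans h1
  have e : ∀ x ≥ 0, x ≤ K ^ 2 * u ^ η → x ≤ K ^ 2 * u ^ (-η) → x ≤ K ^ 2 * hat η u := by
    intro x _ g1 g2
    rw [hat, mul_min_of_nonneg _ _ (sq_nonneg K)]
    exact le_min g1 g2
  have g2 : u ^ (-η) * t ^ 2 ≤ K ^ 2 * u ^ (-η) := by
    rw [mul_comm]
    gcongr
  refine e _ (by positivity) ?_ g2
  rcases le_total u 1 with h | h
  · calc u ^ (-η) * t ^ 2 ≤ u ^ (-η) * (K * u) ^ 2 := by gcongr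
      _ = K ^ 2 * (u ^ (-η) * u ^ (2:ℝ)) := by rw [Real.rpow_two]; ring
      _ = K ^ 2 * u ^ (2 - η) := by rw [← Real.rpow_add hu]; ring_nf
      _ ≤ K ^ 2 * u ^ η := by
        gcongr 1
        exact Real.rpow_le_rpow_of_exponent_ge hu h (by linarith)
  · refine g2.trans ?_
    gcongr 1
    exact Real.rpow_le_rpow_of_exponent_le h (by linarith)

/-- The complementary projection `1 - P_n`. -/
def Cd (d : G) (n : ℕ) (f : G → ℝ) (x : G) : ℝ := f x - avg (chain d n) f x

theorem Nice.Cd {f : G → ℝ} (hf : Nice f) (d : G) (n : ℕ) : Nice (Cd d n f) :=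
  hf.sub (hf.avg (cProb_chain d n))

theorem ft_Cd {f : G → ℝ} (hf : Nice f) (d : G) (n : ℕ) (ξ : G) :
    ft (CurveMax.Cd d n f) ξ = (1 - sym (chain d n) ξ) * ft f ξ := by
  unfold CurveMax.Cd
  rw [ft_sub hf (hf.avg (cProb_chain d n)), ft_avg (cProb_chain d n) hf]
  ring

theorem ft_Qd {f : G → ℝ} (hf : Nice f) (d : G) (n : ℕ) (ξ : G) :
    ft (CurveMax.Qd d n f) ξ = (sym (chain d n) ξ - sym (chain d (n + 1)) ξ) * ft f ξ := by
  unfold CurveMax.Qd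
  rw [ft_sub (hf.avg (cProb_chain d n)) (hf.avg (cProb_chain d (n + 1))),
    ft_avg (cProb_chain d n) hf, ft_avg (cProb_chain d (n + 1)) hf]
  ring

/-- The averaging measure at scales `(a, c)` with parameter `ρ`. -/
def Am (b h1 h2 : ℝ) (a c : ℕ) (ρ : ℝ) : Measure G := cur b (2 ^ a * h1) (ρ * (2 ^ c * h2))

theorem cProb_Am {b : ℝ} (hb : 1 < b) (h1 h2 : ℝ) (a c : ℕ) (ρ : ℝ) : CProb (Am b h1 h2 a c ρ) :=
  cProb_cur (by linarith) _ _

theorem norm_one_sub_sym_chain {d : G} {n : ℕ} (ξ : G) :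
    ‖1 - sym (chain d n) ξ‖ ≤ 4 * Real.pi * (2 ^ n * |pair d ξ|) :=
  (norm_one_sub_sym_le (segProb_chain d n) ξ).trans (le_of_eq (by ring))

theorem norm_one_sub_sym_chain_le_hat {η : ℝ} (hη : 0 ≤ η) (hη1 : η ≤ 1) {d : G} {n : ℕ} (ξ : G)
    (hξ : pair d ξ ≠ 0) :
    (2 ^ n * |pair d ξ|) ^ (-η) * ‖1 - sym (chain d n) ξ‖ ^ 2 ≤
      (12 * Real.pi) ^ 2 * hat η (2 ^ n * |pair d ξ|) := by
  have h0 := abs_pos.2 hξ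
  refine rpow_neg_mul_sq_le_hat hη hη1 (by positivity) (norm_nonneg _) ?_ ?_
  · have := norm_sub_le (1 : ℂ) (sym (chain d n) ξ)
    have := norm_sym_le (cProb_chain d n) ξ
    have := Real.pi_gt_three
    rw [norm_one] at *
    linarith
  · refine (norm_one_sub_sym_chain ξ).trans ?_
    have := Real.pi_pos
    gcongr
    norm_num

theorem norm_sym_chain_sub_le_hat {η : ℝ} (hη : 0 ≤ η) (hη1 : η ≤ 1) {d : G} {n : ℕ} (ξ : G)
    (hξ : pair d ξ ≠ 0) :
    (2 ^ n * |pair d ξ|) ^ (-η) * ‖sym (chain d n) ξ - sym (chain d (n + 1)) ξ‖ ^ 2 ≤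
      (12 * Real.pi) ^ 2 * hat η (2 ^ n * |pair d ξ|) := by
  have h0 := abs_pos.2 hξ
  refine rpow_neg_mul_sq_le_hat hη hη1 (by positivity) (norm_nonneg _) ?_ ?_
  · have := norm_sub_le (sym (chain d n) ξ) (sym (chain d (n + 1)) ξ)
    have := norm_sym_le (cProb_chain d n) ξ
    have := norm_sym_le (cProb_chain d (n + 1)) ξ
    have := Real.pi_gt_three
    linarith
  · have e : sym (chain d n) ξ - sym (chain d (n + 1)) ξ =
        (1 - sym (chain d (n + 1)) ξ) - (1 - sym (chain d n) ξ) := by ring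
    rw [e]
    refine (norm_sub_le _ _).trans ?_
    have i1 := norm_one_sub_sym_chain (d := d) (n := n + 1) ξ
    have i2 := norm_one_sub_sym_chain (d := d) (n := n) ξ
    rw [pow_succ] at i1
    nlinarith

theorem pair_fst (h : ℝ) (ξ : G) : pair (h, 0) ξ = h * ξ.1 := by simp [pair]

theorem pair_snd (h : ℝ) (ξ : G) : pair (0, h) ξ = h * ξ.2 := by simp [pair]

theorem piece_L2 {b : ℝ} (hb : 1 < b) {η : ℝ} (hη : 0 < η) (hη2 : η ≤ 1 / 2) :
    ∃ C > 0, ∀ h1 h2 : ℝ, h1 ≠ 0 → h2 ≠ 0 → ∀ {ι : Type} [Fintype ι] (n n' : ι → ℕ),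
      (Function.Injective fun i => (n i, n' i)) → ∀ (ρ : ι → ℝ), (∀ i, ρ i ∈ Icc (1:ℝ) 4) →
      ∀ (j j' : ℕ) (f : G → ℝ), Nice f →
      ∑ i, ∫⁻ x, ‖avg (Am b h1 h2 (n i + 1 + j) (n' i + 1 + j') (ρ i))
          (Qd (h1, 0) (n i) (Qd (0, h2) (n' i) f)) x‖ₑ ^ 2 ≤
        ENNReal.ofReal (C * ((2:ℝ) ^ (-η)) ^ (j + j')) * ∫⁻ x, ‖f x‖ₑ ^ 2 := by
  obtain ⟨C1, hC1, hsym⟩ := exists_sym_cur_sq_bounds hb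
  obtain ⟨C2, hC2, hlat⟩ := exists_sum_hat_mul_hat_le hη
  have hpi := Real.pi_pos
  refine ⟨C1 * ((12 * Real.pi) ^ 2) ^ 2 * C2, by positivity, ?_⟩
  intro h1 h2 hh1 hh2 ι _ n n' hinj ρ hρ j j' f hf
  refine lintegral_sum_sq_le _ hf _ (fun i => ((hf.Qd _ _).Qd _ _).avg (cProb_Am hb _ _ _ _ _))
    (fun i ξ => sym (Am b h1 h2 (n i + 1 + j) (n' i + 1 + j') (ρ i)) ξ *
      ((sym (chain (h1, 0) (n i)) ξ - sym (chain (h1, 0) (n i + 1)) ξ) *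
      (sym (chain (0, h2) (n' i)) ξ - sym (chain (0, h2) (n' i + 1)) ξ))) ?_ _ ?_
  · intro i ξ
    rw [ft_avg (cProb_Am hb _ _ _ _ _) ((hf.Qd _ _).Qd _ _), ft_Qd (hf.Qd _ _), ft_Qd hf]
    ring
  · intro ξ hξ1 hξ2
    have z1 : h1 * ξ.1 ≠ 0 := mul_ne_zero hh1 hξ1
    have z2 : h2 * ξ.2 ≠ 0 := mul_ne_zero hh2 hξ2
    set r : ℝ := 2 ^ (-η) with hr
    have hr0 : 0 < r := by positivity
    have hr1 : r ≤ 1 := Real.rpow_le_one_of_one_le_of_nonpos (by norm_num) (by linarith)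
    have scale : ∀ (k j : ℕ) (z : ℝ), |2 ^ (k + 1 + j) * z| ^ (-η) ≤ r ^ j * (2 ^ k * |z|) ^ (-η) := by
      intro k j z
      rw [abs_mul, abs_of_pos (by positivity), show (2:ℝ) ^ (k + 1 + j) * |z| =
        2 ^ (j + 1) * (2 ^ k * |z|) by ring, Real.mul_rpow (by positivity) (by positivity)]
      have : ((2:ℝ) ^ (j + 1)) ^ (-η) = r ^ (j + 1) := by
        rw [hr, ← Real.rpow_natCast, ← Real.rpow_natCast, ← Real.rpow_mul (by norm_num),
          ← Real.rpow_mul (by norm_num), mul_comm]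
      rw [this]
      gcongr ?_ * _
      exact pow_le_pow_of_le_one hr0.le hr1 (by omega)
    have term : ∀ i, ‖sym (Am b h1 h2 (n i + 1 + j) (n' i + 1 + j') (ρ i)) ξ *
      ((sym (chain (h1, 0) (n i)) ξ - sym (chain (h1, 0) (n i + 1)) ξ) *
      (sym (chain (0, h2) (n' i)) ξ - sym (chain (0, h2) (n' i + 1)) ξ))‖ ^ 2 ≤
      C1 * ((12 * Real.pi) ^ 2) ^ 2 * r ^ (j + j') *
        (hat η (2 ^ n i * |h1 * ξ.1|) * hat η (2 ^ n' i * |h2 * ξ.2|)) := by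
      intro i
      have s0 := (hsym η hη.le hη2 (2 ^ (n i + 1 + j) * h1) (2 ^ (n' i + 1 + j') * h2) ξ
        (by rw [mul_assoc]; exact mul_ne_zero (by positivity) z1)
        (by rw [mul_assoc]; exact mul_ne_zero (by positivity) z2)).1 (ρ i) (hρ i)
      rw [mul_assoc _ h1, mul_assoc _ h2] at s0
      have s1 := scale (n i) j (h1 * ξ.1)
      have s2 := scale (n' i) j' (h2 * ξ.2)
      have s3 := norm_sym_chain_sub_le_hat hη.le (by linarith) (d := (h1, 0)) (n := n i) ξ
        (by rwa [pair_fst])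
      have s4 := norm_sym_chain_sub_le_hat hη.le (by linarith) (d := (0, h2)) (n := n' i) ξ
        (by rwa [pair_snd])
      rw [pair_fst] at s3
      rw [pair_snd] at s4
      rw [norm_mul, norm_mul, mul_pow, mul_pow]
      set q1 := ‖sym (chain (h1, 0) (n i)) ξ - sym (chain (h1, 0) (n i + 1)) ξ‖ ^ 2
      set q2 := ‖sym (chain (0, h2) (n' i)) ξ - sym (chain (0, h2) (n' i + 1)) ξ‖ ^ 2
      have hh : 0 ≤ hat η (2 ^ n i * |h1 * ξ.1|) := hat_nonneg (by positivity)
      calc ‖sym (Am b h1 h2 (n i + 1 + j) (n' i + 1 + j') (ρ i)) ξ‖ ^ 2 * (q1 * q2)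
          ≤ C1 * ((r ^ j * (2 ^ n i * |h1 * ξ.1|) ^ (-η)) *
              (r ^ j' * (2 ^ n' i * |h2 * ξ.2|) ^ (-η))) * (q1 * q2) := by
            gcongr
            exact s0.trans (by gcongr)
        _ = C1 * r ^ (j + j') * (((2 ^ n i * |h1 * ξ.1|) ^ (-η) * q1) *
              ((2 ^ n' i * |h2 * ξ.2|) ^ (-η) * q2)) := by
            rw [pow_add]
            ring
        _ ≤ C1 * r ^ (j + j') * (((12 * Real.pi) ^ 2 * hat η (2 ^ n i * |h1 * ξ.1|)) *
              ((12 * Real.pi) ^ 2 * hat η (2 ^ n' i * |h2 * ξ.2|))) := by gcongr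
        _ = _ := by ring
    refine (Finset.sum_le_sum fun i _ => term i).trans ?_
    rw [← Finset.mul_sum]
    refine (mul_le_mul_of_nonneg_left (hlat n n' hinj _ _ (abs_pos.2 z1) (abs_pos.2 z2))
      (by positivity)).trans (le_of_eq ?_)
    ring

/-- The averages with both low-frequency parts removed. -/
def Rop (b h1 h2 : ℝ) (a c : ℕ) (ρ : ℝ) (f : G → ℝ) : G → ℝ :=
  avg (Am b h1 h2 a c ρ) (Cd (h1, 0) a (Cd (0, h2) c f))

theorem Nice.Rop {b : ℝ} (hb : 1 < b) {f : G → ℝ} (hf : Nice f) (h1 h2 : ℝ) (a c : ℕ) (ρ : ℝ) :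
    Nice (Rop b h1 h2 a c ρ f) :=
  ((hf.Cd _ _).Cd _ _).avg (cProb_Am hb _ _ _ _ _)

theorem difference_L2 {b : ℝ} (hb : 1 < b) {η : ℝ} (hη : 0 < η) (hη2 : η ≤ 1 / 2) :
    ∃ C > 0, ∀ h1 h2 : ℝ, h1 ≠ 0 → h2 ≠ 0 → ∀ {ι : Type} [Fintype ι] (a c : ι → ℕ),
      (Function.Injective fun i => (a i, c i)) → ∀ (ρ ρ' : ι → ℝ), (∀ i, ρ i ∈ Icc (1:ℝ) 4) →
      (∀ i, ρ' i ∈ Icc (1:ℝ) 4) → ∀ δ : ℝ, (∀ i, |ρ i - ρ' i| ≤ δ) →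
      ∀ (f : G → ℝ), Nice f →
      ∑ i, ∫⁻ x, ‖Rop b h1 h2 (a i) (c i) (ρ i) f x - Rop b h1 h2 (a i) (c i) (ρ' i) f x‖ₑ ^ 2 ≤
        ENNReal.ofReal (C * δ ^ (1 - 2 * η)) * ∫⁻ x, ‖f x‖ₑ ^ 2 := by
  obtain ⟨C1, hC1, hsym⟩ := exists_sym_cur_sq_bounds hb
  obtain ⟨C2, hC2, hlat⟩ := exists_sum_hat_mul_hat_le hη
  have hpi := Real.pi_pos
  refine ⟨C1 * ((12 * Real.pi) ^ 2) ^ 2 * C2, by positivity, ?_⟩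
  intro h1 h2 hh1 hh2 ι _ a c hinj ρ ρ' hρ hρ' δ hδ f hf
  rcases isEmpty_or_nonempty ι with hι | ⟨⟨i0⟩⟩
  · simp
  have hδ0 : 0 ≤ δ := (abs_nonneg _).trans (hδ i0)
  refine lintegral_sum_sq_le _ hf _
    (fun i => (hf.Rop hb _ _ _ _ _).sub (hf.Rop hb _ _ _ _ _))
    (fun i ξ => (sym (Am b h1 h2 (a i) (c i) (ρ i)) ξ - sym (Am b h1 h2 (a i) (c i) (ρ' i)) ξ) *
      ((1 - sym (chain (h1, 0) (a i)) ξ) * (1 - sym (chain (0, h2) (c i)) ξ))) ?_ _ ?_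
  · intro i ξ
    rw [ft_sub (hf.Rop hb _ _ _ _ _) (hf.Rop hb _ _ _ _ _)]
    unfold CurveMax.Rop
    rw [ft_avg (cProb_Am hb _ _ _ _ _) ((hf.Cd _ _).Cd _ _),
      ft_avg (cProb_Am hb _ _ _ _ _) ((hf.Cd _ _).Cd _ _), ft_Cd (hf.Cd _ _), ft_Cd hf]
    ring
  · intro ξ hξ1 hξ2
    have z1 : h1 * ξ.1 ≠ 0 := mul_ne_zero hh1 hξ1
    have z2 : h2 * ξ.2 ≠ 0 := mul_ne_zero hh2 hξ2
    have scale : ∀ (k : ℕ) (z : ℝ), |2 ^ k * z| = 2 ^ k * |z| := fun k z => by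
      rw [abs_mul, abs_of_pos (by positivity)]
    have term : ∀ i, ‖(sym (Am b h1 h2 (a i) (c i) (ρ i)) ξ -
        sym (Am b h1 h2 (a i) (c i) (ρ' i)) ξ) *
        ((1 - sym (chain (h1, 0) (a i)) ξ) * (1 - sym (chain (0, h2) (c i)) ξ))‖ ^ 2 ≤
      C1 * ((12 * Real.pi) ^ 2) ^ 2 * δ ^ (1 - 2 * η) *
        (hat η (2 ^ a i * |h1 * ξ.1|) * hat η (2 ^ c i * |h2 * ξ.2|)) := by
      intro i
      have s0 := (hsym η hη.le hη2 (2 ^ a i * h1) (2 ^ c i * h2) ξ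
        (by rw [mul_assoc]; exact mul_ne_zero (by positivity) z1)
        (by rw [mul_assoc]; exact mul_ne_zero (by positivity) z2)).2 (ρ i) (hρ i) (ρ' i) (hρ' i)
      rw [mul_assoc _ h1, mul_assoc _ h2, scale, scale] at s0
      have s3 := norm_one_sub_sym_chain_le_hat hη.le (by linarith) (d := (h1, 0)) (n := a i) ξ
        (by rwa [pair_fst])
      have s4 := norm_one_sub_sym_chain_le_hat hη.le (by linarith) (d := (0, h2)) (n := c i) ξ
        (by rwa [pair_snd])
      rw [pair_fst] at s3
      rw [pair_snd] at s4
      rw [norm_mul, norm_mul, mul_pow, mul_pow]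
      set q1 := ‖1 - sym (chain (h1, 0) (a i)) ξ‖ ^ 2
      set q2 := ‖1 - sym (chain (0, h2) (c i)) ξ‖ ^ 2
      have hh : 0 ≤ hat η (2 ^ a i * |h1 * ξ.1|) := hat_nonneg (by positivity)
      have hδi : |ρ i - ρ' i| ^ (1 - 2 * η) ≤ δ ^ (1 - 2 * η) :=
        Real.rpow_le_rpow (abs_nonneg _) (hδ i) (by linarith)
      calc ‖sym (Am b h1 h2 (a i) (c i) (ρ i)) ξ - sym (Am b h1 h2 (a i) (c i) (ρ' i)) ξ‖ ^ 2 *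
            (q1 * q2)
          ≤ C1 * δ ^ (1 - 2 * η) * ((2 ^ a i * |h1 * ξ.1|) ^ (-η) *
              (2 ^ c i * |h2 * ξ.2|) ^ (-η)) * (q1 * q2) := by
            gcongr
            exact s0.trans (by gcongr)
        _ = C1 * δ ^ (1 - 2 * η) * (((2 ^ a i * |h1 * ξ.1|) ^ (-η) * q1) *
              ((2 ^ c i * |h2 * ξ.2|) ^ (-η) * q2)) := by ring
        _ ≤ C1 * δ ^ (1 - 2 * η) * (((12 * Real.pi) ^ 2 * hat η (2 ^ a i * |h1 * ξ.1|)) *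
              ((12 * Real.pi) ^ 2 * hat η (2 ^ c i * |h2 * ξ.2|))) := by gcongr
        _ = _ := by ring
    refine (Finset.sum_le_sum fun i _ => term i).trans ?_
    rw [← Finset.mul_sum]
    refine (mul_le_mul_of_nonneg_left (hlat a c hinj _ _ (abs_pos.2 z1) (abs_pos.2 z2))
      (by positivity)).trans (le_of_eq ?_)
    ring

end Lattice

/-- The `L^q` norm of a nonnegative function. -/
def nrm (q : ℝ) (F : G → ℝ≥0∞) : ℝ≥0∞ := (∫⁻ x, F x ^ q) ^ (1 / q)

theorem nrm_mono {q : ℝ} (hq : 0 < q) {F H : G → ℝ≥0∞} (h : ∀ x, F x ≤ H x) : nrm q F ≤ nrm q H :=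
  ENNReal.rpow_le_rpow (lintegral_mono fun x => ENNReal.rpow_le_rpow (h x) hq.le) (by positivity)

theorem nrm_add_le {q : ℝ} (hq : 1 ≤ q) {F H : G → ℝ≥0∞} (hF : Measurable F) (hH : Measurable H) :
    nrm q (fun x => F x + H x) ≤ nrm q F + nrm q H :=
  ENNReal.lintegral_Lp_add_le hF.aemeasurable hH.aemeasurable hq

theorem nrm_sum_le {q : ℝ} (hq : 1 ≤ q) {ι : Type*} (s : Finset ι) {F : ι → G → ℝ≥0∞}
    (hF : ∀ i, Measurable (F i)) : nrm q (fun x => ∑ i ∈ s, F i x) ≤ ∑ i ∈ s, nrm q (F i) := by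
  induction s using Finset.induction_on with
  | empty =>
    have : (0:ℝ≥0∞) ^ q = 0 := ENNReal.zero_rpow_of_pos (by linarith)
    have h' : (0:ℝ≥0∞) ^ q⁻¹ = 0 := ENNReal.zero_rpow_of_pos (by positivity)
    simp [nrm, this, h']
  | insert i s hi ih =>
    simp only [Finset.sum_insert hi]
    exact (nrm_add_le hq (hF i) (Finset.measurable_sum s fun i _ => hF i)).trans
      (add_le_add le_rfl ih)

theorem nrm_rpow {q : ℝ} (hq : 0 < q) (F : G → ℝ≥0∞) : nrm q F ^ q = ∫⁻ x, F x ^ q := by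
  rw [nrm, ← ENNReal.rpow_mul, one_div_mul_cancel hq.ne', ENNReal.rpow_one]

theorem nrm_le_iff {q : ℝ} (hq : 0 < q) {F H : G → ℝ≥0∞} {K : ℝ≥0∞} :
    nrm q F ≤ K * nrm q H ↔ ∫⁻ x, F x ^ q ≤ K ^ q * ∫⁻ x, H x ^ q := by
  rw [← nrm_rpow hq, ← nrm_rpow hq, ← ENNReal.mul_rpow_of_nonneg _ _ hq.le,
    ENNReal.rpow_le_rpow_iff hq]

theorem nrm_le_of_lintegral_le {q : ℝ} (hq : 0 < q) {F H : G → ℝ≥0∞} {K : ℝ} (hK : 0 ≤ K)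
    (h : ∫⁻ x, F x ^ q ≤ ENNReal.ofReal K * ∫⁻ x, H x ^ q) :
    nrm q F ≤ ENNReal.ofReal (K ^ (1 / q)) * nrm q H := by
  rw [nrm_le_iff hq, ENNReal.ofReal_rpow_of_nonneg (by positivity) hq.le, ← Real.rpow_mul hK,
    one_div_mul_cancel hq.ne', Real.rpow_one]
  exact h

theorem lintegral_le_of_nrm_le {q : ℝ} (hq : 0 < q) {F H : G → ℝ≥0∞} {K : ℝ} (hK : 0 ≤ K)
    (h : nrm q F ≤ ENNReal.ofReal K * nrm q H) :
    ∫⁻ x, F x ^ q ≤ ENNReal.ofReal (K ^ q) * ∫⁻ x, H x ^ q := by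
  rw [nrm_le_iff hq, ENNReal.ofReal_rpow_of_nonneg hK hq.le] at h
  exact h

theorem iSup_rpow {κ : Sort*} (F : κ → ℝ≥0∞) {q : ℝ} (hq : 0 < q) :
    (⨆ i, F i) ^ q = ⨆ i, F i ^ q :=
  (ENNReal.orderIsoRpow q hq).map_iSup F

/-- The maximal function of a family of averages. -/
def supAvg {ι : Type*} (ν : ι → Measure G) (F : G → ℝ≥0∞) (x : G) : ℝ≥0∞ := ⨆ i, lavg (ν i) F x

theorem supAvg_mono {ι : Type*} (ν : ι → Measure G) {F H : G → ℝ≥0∞} (h : ∀ x, F x ≤ H x) (x : G) :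
    supAvg ν F x ≤ supAvg ν H x :=
  iSup_mono fun _ => lintegral_mono fun _ => h _

theorem measurable_supAvg {ι : Type*} [Countable ι] {ν : ι → Measure G} (hν : ∀ i, CProb (ν i))
    {F : G → ℝ≥0∞} (hF : Measurable F) : Measurable (supAvg ν F) := by
  refine Measurable.iSup fun i => ?_
  have := (hν i).prob
  exact measurable_lavg hF

/-- Truncation of a function to a bounded function of bounded support. -/
def trunc (F : G → ℝ≥0∞) (n : ℕ) (x : G) : ℝ≥0∞ :=
  (Metric.closedBall 0 n).indicator (fun x => min (F x) n) x

theorem measurable_trunc {F : G → ℝ≥0∞} (hF : Measurable F) (n : ℕ) : Measurable (trunc F n) :=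
  (hF.min measurable_const).indicator Metric.isClosed_closedBall.measurableSet

theorem trunc_le (F : G → ℝ≥0∞) (n : ℕ) (x : G) : trunc F n x ≤ F x :=
  (Set.indicator_le_self' (fun _ _ => zero_le) x).trans (min_le_left _ _)

theorem trunc_le_nat (F : G → ℝ≥0∞) (n : ℕ) (x : G) : trunc F n x ≤ n :=
  (Set.indicator_le_self' (fun _ _ => zero_le) x).trans (min_le_right _ _)

theorem monotone_trunc (F : G → ℝ≥0∞) : Monotone (trunc F) := by
  intro m n hmn x
  have h : (m : ℝ≥0∞) ≤ n := by exact_mod_cast hmn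
  have h' : (m : ℝ) ≤ n := by exact_mod_cast hmn
  refine (Set.indicator_le_indicator_of_subset (Metric.closedBall_subset_closedBall h')
    (fun _ => zero_le) x).trans ?_
  exact Set.indicator_le_indicator (min_le_min_left _ h)

theorem iSup_trunc (F : G → ℝ≥0∞) (x : G) : ⨆ n, trunc F n x = F x := by
  refine le_antisymm (iSup_le fun n => trunc_le F n x) (le_of_forall_lt fun c hc => ?_)
  obtain ⟨n, hn⟩ := exists_nat_gt ‖x‖
  obtain ⟨m, hm⟩ := ENNReal.exists_nat_gt (lt_of_lt_of_le hc le_top).ne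
  refine lt_of_lt_of_le ?_ (le_iSup _ (max n m))
  have hx : x ∈ Metric.closedBall (0:G) (max n m : ℕ) := by
    simp only [mem_closedBall_zero_iff]
    exact hn.le.trans (by exact_mod_cast le_max_left n m)
  rw [trunc, Set.indicator_of_mem hx]
  refine lt_min hc (hm.trans_le ?_)
  exact_mod_cast le_max_right n m

theorem nice_trunc {F : G → ℝ≥0∞} (hF : Measurable F) (n : ℕ) :
    Nice fun x => (trunc F n x).toReal := by
  refine ⟨(measurable_trunc hF n).ennreal_toReal.stronglyMeasurable, ⟨n, fun x => ?_⟩, n, ?_⟩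
  · rw [Real.norm_of_nonneg ENNReal.toReal_nonneg]
    exact (ENNReal.toReal_mono (by simp) (trunc_le_nat F n x)).trans (by simp)
  · intro x hx
    have : trunc F n x = 0 := Set.indicator_of_notMem (by simpa using hx) _
    simp [this]

theorem enorm_trunc (F : G → ℝ≥0∞) (n : ℕ) (x : G) : ‖(trunc F n x).toReal‖ₑ = trunc F n x := by
  rw [← ofReal_norm, Real.norm_of_nonneg ENNReal.toReal_nonneg, ENNReal.ofReal_toReal]
  exact ((trunc_le_nat F n x).trans_lt (by simp)).ne

/-- Maximal inequalities extend from nice functions to all measurable functions. -/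
theorem supAvg_of_nice {ι : Type*} [Countable ι] {ν : ι → Measure G} (hν : ∀ i, CProb (ν i))
    {q : ℝ} (hq : 0 < q) {K : ℝ≥0∞}
    (h : ∀ f : G → ℝ, Nice f → (∀ x, 0 ≤ f x) →
      ∫⁻ x, supAvg ν (fun y => ‖f y‖ₑ) x ^ q ≤ K * ∫⁻ x, ‖f x‖ₑ ^ q)
    {F : G → ℝ≥0∞} (hF : Measurable F) :
    ∫⁻ x, supAvg ν F x ^ q ≤ K * ∫⁻ x, F x ^ q := by
  have e : ∀ x, supAvg ν F x ^ q = ⨆ n, supAvg ν (trunc F n) x ^ q := by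
    intro x
    rw [← iSup_rpow _ hq]
    congr 1
    simp only [supAvg]
    rw [iSup_comm]
    refine iSup_congr fun i => ?_
    simp only [lavg, ← iSup_trunc F]
    refine lintegral_iSup (fun n => (measurable_trunc hF n).comp (measurable_const.sub measurable_id))
      fun m n hmn y => monotone_trunc F hmn _
  simp only [e]
  rw [lintegral_iSup (fun n => (measurable_supAvg hν (measurable_trunc hF n)).pow_const q)]
  · refine iSup_le fun n => ?_
    have := h _ (nice_trunc hF n) fun _ => ENNReal.toReal_nonneg
    simp only [enorm_trunc] at this
    refine this.trans (mul_le_mul_right ?_ _)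
    exact lintegral_mono fun x => ENNReal.rpow_le_rpow (trunc_le F n x) hq.le
  · intro m n hmn x
    exact ENNReal.rpow_le_rpow (supAvg_mono ν (fun y => monotone_trunc F hmn y) x) hq.le

theorem supAvg_le_card {ι : Type*} [Fintype ι] {ν : ι → Measure G} (hν : ∀ i, CProb (ν i))
    {q : ℝ} (hq : 1 ≤ q) {F : G → ℝ≥0∞} (hF : Measurable F) :
    ∫⁻ x, supAvg ν F x ^ q ≤ (Fintype.card ι : ℝ≥0∞) * ∫⁻ x, F x ^ q := by
  have h0 : 0 < q := by linarith
  calc ∫⁻ x, supAvg ν F x ^ q ≤ ∫⁻ x, ∑ i, lavg (ν i) (fun y => F y ^ q) x := by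
        refine lintegral_mono fun x => ?_
        simp only [supAvg]
        rw [iSup_rpow _ h0]
        refine iSup_le fun i => (lavg_rpow_le (hν i) hF hq x).trans ?_
        exact Finset.single_le_sum (f := fun i => lavg (ν i) (fun y => F y ^ q) x)
          (fun _ _ => zero_le) (Finset.mem_univ i)
    _ = ∑ i : ι, ∫⁻ x, F x ^ q := by
        rw [lintegral_finsetSum]
        · exact Finset.sum_congr rfl fun i _ => lintegral_lavg (hν i) (hF.pow_const q)
        · intro i _
          have := (hν i).prob
          exact measurable_lavg (hF.pow_const q)
    _ = _ := by simp

theorem lavg_sq_le {ν : Measure G} {g W : G → ℝ≥0∞} (hg : Measurable g)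
    (hW : Measurable W) (h0 : ∀ x, W x = 0 → g x = 0) (htop : ∀ x, W x ≠ ∞) (s : ℝ) (x : G) :
    lavg ν g x ^ 2 ≤ lavg ν (fun y => g y ^ 2 * W y ^ (-s)) x * lavg ν (fun y => W y ^ s) x := by
  have hg' : Measurable fun y => g (x - y) := hg.comp (measurable_const.sub measurable_id)
  have hW' : Measurable fun y => W (x - y) := hW.comp (measurable_const.sub measurable_id)
  have := ENNReal.lintegral_mul_norm_pow_le (μ := ν) (p := 1 / 2) (q := 1 / 2)
    (f := fun y => g (x - y) ^ 2 * W (x - y) ^ (-s)) (g := fun y => W (x - y) ^ s)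
    (by fun_prop) (hW'.pow_const _).aemeasurable
    (by norm_num) (by norm_num) (by norm_num)
  have e : ∀ y, g y = (g y ^ 2 * W y ^ (-s)) ^ (1 / 2 : ℝ) * (W y ^ s) ^ (1 / 2 : ℝ) := by
    intro y
    by_cases hy : W y = 0
    · simp [h0 y hy]
    · rw [← ENNReal.mul_rpow_of_nonneg _ _ (by norm_num), mul_assoc,
        ← ENNReal.rpow_add _ _ hy (htop y), neg_add_cancel, ENNReal.rpow_zero, mul_one,
        ← ENNReal.rpow_two, ← ENNReal.rpow_mul]
      norm_num
  have h2 : lavg ν g x ≤ (lavg ν (fun y => g y ^ 2 * W y ^ (-s)) x) ^ (1 / 2 : ℝ) *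
      (lavg ν (fun y => W y ^ s) x) ^ (1 / 2 : ℝ) := by
    refine le_trans (le_of_eq ?_) this
    exact lintegral_congr fun y => e (x - y)
  calc lavg ν g x ^ 2 ≤ _ := pow_le_pow_left' h2 2
    _ = _ := by
      rw [mul_pow, ← ENNReal.rpow_two, ← ENNReal.rpow_two, ← ENNReal.rpow_mul, ← ENNReal.rpow_mul]
      norm_num

/-- A scalar maximal inequality implies a square function inequality at a smaller exponent. -/
theorem vector_valued {ι : Type*} [Fintype ι] {ν : ι → Measure G} (hν : ∀ i, CProb (ν i))
    {q r : ℝ} (hq : 1 < q) (hr : r = 2 * q / (1 + q)) {K : ℝ≥0∞}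
    (h : ∀ F : G → ℝ≥0∞, Measurable F → ∫⁻ x, supAvg ν F x ^ q ≤ K * ∫⁻ x, F x ^ q)
    {g : ι → G → ℝ≥0∞} (hg : ∀ i, Measurable (g i)) (hfin : ∀ i x, g i x ≠ ∞) :
    ∫⁻ x, (∑ i, lavg (ν i) (g i) x ^ 2) ^ (r / 2) ≤
      K ^ (1 - r / 2) * ∫⁻ x, (∑ i, g i x ^ 2) ^ (r / 2) := by
  have hr0 : 0 < r := by rw [hr]; positivity
  have hr2 : r < 2 := by rw [hr, div_lt_iff₀ (by linarith)]; linarith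
  set W : G → ℝ≥0∞ := fun x => (∑ i, g i x ^ 2) ^ (1 / 2 : ℝ) with hWdef
  have hW : Measurable W :=
    (Finset.measurable_sum _ fun i _ => (hg i).pow_const 2).pow_const _
  have hWtop : ∀ x, W x ≠ ∞ := fun x => ENNReal.rpow_ne_top_of_nonneg (by norm_num)
    (ENNReal.sum_ne_top.2 fun i _ => ENNReal.pow_ne_top (hfin i x))
  have hW2 : ∀ x, ∑ i, g i x ^ 2 = W x ^ (2:ℝ) := by
    intro x
    rw [hWdef]
    simp only
    rw [← ENNReal.rpow_mul]
    norm_num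
  have hW0 : ∀ i x, W x = 0 → g i x = 0 := by
    intro i x hx
    have h2 := hW2 x
    rw [hx, ENNReal.zero_rpow_of_pos (by norm_num), Finset.sum_eq_zero_iff] at h2
    simpa using h2 i (Finset.mem_univ i)
  set s := 2 - r with hs
  have hs0 : 0 < s := by linarith
  have hsq : s * q = r := by
    rw [hs, hr]; field_simp; ring
  set S : G → ℝ≥0∞ := fun x => ∑ i, lavg (ν i) (fun y => g i y ^ 2 * W y ^ (-s)) x with hSdef
  have mS : ∀ i, Measurable fun y => g i y ^ 2 * W y ^ (-s) := fun i =>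
    ((hg i).pow_const 2).mul (hW.pow_const _)
  have hS : Measurable S := by
    refine Finset.measurable_sum _ fun i _ => ?_
    have := (hν i).prob
    exact measurable_lavg (mS i)
  set M : G → ℝ≥0∞ := supAvg ν fun y => W y ^ s with hMdef
  have hM : Measurable M := measurable_supAvg hν (hW.pow_const _)
  have hSint : ∫⁻ x, S x = ∫⁻ x, W x ^ r := by
    rw [hSdef, lintegral_finsetSum]
    · rw [Finset.sum_congr rfl fun i _ => lintegral_lavg (hν i) (mS i),
        ← lintegral_finsetSum _ fun i _ => mS i]
      refine lintegral_congr fun x => ?_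
      rw [← Finset.sum_mul, hW2]
      by_cases hx : W x = 0
      · rw [hx, ENNReal.zero_rpow_of_pos (by norm_num), zero_mul, ENNReal.zero_rpow_of_pos hr0]
      · rw [← ENNReal.rpow_add _ _ hx (hWtop x)]
        congr 1
        rw [hs]; ring
    · intro i _
      have := (hν i).prob
      exact measurable_lavg (mS i)
  have hMint : ∫⁻ x, M x ^ q ≤ K * ∫⁻ x, W x ^ r := by
    refine (h _ (hW.pow_const s)).trans (le_of_eq ?_)
    simp only [← ENNReal.rpow_mul, hsq]
  have hexp : (r / 2) = q * (1 - r / 2) := by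
    rw [hr]; field_simp; ring
  calc ∫⁻ x, (∑ i, lavg (ν i) (g i) x ^ 2) ^ (r / 2)
      ≤ ∫⁻ x, S x ^ (r / 2) * (M x ^ q) ^ (1 - r / 2) := by
        refine lintegral_mono fun x => ?_
        rw [← ENNReal.rpow_mul, ← hexp, ← ENNReal.mul_rpow_of_nonneg _ _ (by positivity)]
        refine ENNReal.rpow_le_rpow ?_ (by positivity)
        rw [hSdef]
        simp only
        rw [Finset.sum_mul]
        refine Finset.sum_le_sum fun i _ =>
          (lavg_sq_le (hg i) hW (hW0 i) hWtop s x).trans (mul_le_mul_right ?_ _)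
        exact le_iSup (fun i => lavg (ν i) (fun y => W y ^ s) x) i
    _ ≤ (∫⁻ x, S x) ^ (r / 2) * (∫⁻ x, M x ^ q) ^ (1 - r / 2) :=
        ENNReal.lintegral_mul_norm_pow_le hS.aemeasurable (hM.pow_const q).aemeasurable
          (by positivity) (by linarith) (by ring)
    _ ≤ (∫⁻ x, W x ^ r) ^ (r / 2) * (K * ∫⁻ x, W x ^ r) ^ (1 - r / 2) := by
        rw [hSint]
        exact mul_le_mul_right (ENNReal.rpow_le_rpow hMint (by linarith)) _
    _ = K ^ (1 - r / 2) * ∫⁻ x, W x ^ r := by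
        rw [ENNReal.mul_rpow_of_nonneg _ _ (by linarith), mul_left_comm,
          ← ENNReal.rpow_add_of_nonneg _ _ (by positivity) (by linarith)]
        norm_num
    _ = _ := by
        congr 1
        refine lintegral_congr fun x => ?_
        simp only [hWdef]
        rw [← ENNReal.rpow_mul]
        congr 1
        ring

theorem Qd_add {f g : G → ℝ} (hf : Nice f) (hg : Nice g) (d : G) (n : ℕ) :
    Qd d n (fun y => f y + g y) = fun y => Qd d n f y + Qd d n g y := by
  ext x
  simp only [CurveMax.Qd]
  rw [avg_add (cProb_chain d n) hf hg, avg_add (cProb_chain d (n + 1)) hf hg]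
  ring

theorem Cd_add {f g : G → ℝ} (hf : Nice f) (hg : Nice g) (d : G) (n : ℕ) :
    Cd d n (fun y => f y + g y) = fun y => Cd d n f y + Cd d n g y := by
  ext x
  simp only [CurveMax.Cd]
  rw [avg_add (cProb_chain d n) hf hg]
  ring

theorem isAxis_fst {h : ℝ} (hh : h ≠ 0) : IsAxis (h, 0) := Or.inl ⟨hh, rfl⟩

theorem isAxis_snd {h : ℝ} (hh : h ≠ 0) : IsAxis (0, h) := Or.inr ⟨rfl, hh⟩

theorem iSup_sq_le_sum {ι : Type*} [Fintype ι] (F : ι → ℝ≥0∞) : (⨆ i, F i) ^ (2:ℝ) ≤ ∑ i, F i ^ 2 := by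
  rw [iSup_rpow _ (by norm_num)]
  refine iSup_le fun i => ?_
  rw [ENNReal.rpow_two]
  exact Finset.single_le_sum (f := fun i => F i ^ 2) (fun _ _ => zero_le) (Finset.mem_univ i)

/-- The pieces of the lacunary maximal operator decay, given an a priori maximal inequality. -/
theorem piece_Lq {b : ℝ} (hb : 1 < b) {q : ℝ} (hq : 1 < q) (hq2 : q ≤ 2) :
    ∃ C > 0, ∃ θ : ℝ, 0 < θ ∧ θ < 1 ∧ ∀ h1 h2 : ℝ, h1 ≠ 0 → h2 ≠ 0 → ∀ {ι : Type} [Fintype ι]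
      (n n' : ι → ℕ), (Function.Injective fun i => (n i, n' i)) → ∀ (ρ : ι → ℝ),
      (∀ i, ρ i ∈ Icc (1:ℝ) 4) → ∀ (j j' : ℕ) (B : ℝ), 0 < B →
      (∀ F : G → ℝ≥0∞, Measurable F →
        ∫⁻ x, supAvg (fun i => Am b h1 h2 (n i + 1 + j) (n' i + 1 + j') (ρ i)) F x ^ q ≤
          ENNReal.ofReal B * ∫⁻ x, F x ^ q) →
      ∀ f : G → ℝ, Nice f →
      ∫⁻ x, (⨆ i, ‖avg (Am b h1 h2 (n i + 1 + j) (n' i + 1 + j') (ρ i))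
          (Qd (h1, 0) (n i) (Qd (0, h2) (n' i) f)) x‖ₑ) ^ q ≤
        ENNReal.ofReal (C * B ^ (1 - q / 2) * θ ^ (j + j')) * ∫⁻ x, ‖f x‖ₑ ^ q := by
  obtain ⟨C2, hC2, H2⟩ := piece_L2 hb (η := 1 / 2) (by norm_num) le_rfl
  have hθ1 : (2:ℝ) ^ (-(1 / 2 : ℝ)) < 1 := Real.rpow_lt_one_of_one_lt_of_neg (by norm_num) (by norm_num)
  have L2 : ∀ h1 h2 : ℝ, h1 ≠ 0 → h2 ≠ 0 → ∀ {ι : Type} [Fintype ι]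
      (n n' : ι → ℕ), (Function.Injective fun i => (n i, n' i)) → ∀ (ρ : ι → ℝ),
      (∀ i, ρ i ∈ Icc (1:ℝ) 4) → ∀ (j j' : ℕ), ∀ f : G → ℝ, Nice f →
      ∫⁻ x, (⨆ i, ‖avg (Am b h1 h2 (n i + 1 + j) (n' i + 1 + j') (ρ i))
          (Qd (h1, 0) (n i) (Qd (0, h2) (n' i) f)) x‖ₑ) ^ (2:ℝ) ≤
        ENNReal.ofReal (C2 * ((2:ℝ) ^ (-(1 / 2 : ℝ))) ^ (j + j')) * ∫⁻ x, ‖f x‖ₑ ^ (2:ℝ) := by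
    intro h1 h2 hh1 hh2 ι _ n n' hinj ρ hρ j j' f hf
    simp only [ENNReal.rpow_two (‖f _‖ₑ)]
    refine le_trans ?_ (H2 h1 h2 hh1 hh2 n n' hinj ρ hρ j j' f hf)
    refine (lintegral_mono fun x => iSup_sq_le_sum _).trans (le_of_eq ?_)
    rw [lintegral_finsetSum]
    exact fun i _ => ((((hf.Qd _ _).Qd _ _).avg (cProb_Am hb _ _ _ _ _)).1.enorm).pow_const 2
  rcases hq2.eq_or_lt with rfl | hq2
  · refine ⟨C2, hC2, _, by positivity, hθ1, ?_⟩
    intro h1 h2 hh1 hh2 ι _ n n' hinj ρ hρ j j' B hB _ f hf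
    simpa using L2 h1 h2 hh1 hh2 n n' hinj ρ hρ j j' f hf
  set r := 2 * q / (1 + q) with hr
  have hr1 : 1 < r := by rw [hr, lt_div_iff₀ (by linarith)]; linarith
  have hr2 : r < 2 := by rw [hr, div_lt_iff₀ (by linarith)]; linarith
  have hrq : r < q := by rw [hr, div_lt_iff₀ (by linarith)]; nlinarith
  obtain ⟨C1, hC1, H1⟩ := LP_square_two hr1 hr2.le
  obtain ⟨C3, hC3, H3⟩ := marcinkiewicz (by linarith) hrq hq2
  set e := (q - r) / (2 - r) with he
  have he0 : 0 < e := div_pos (by linarith) (by linarith)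
  refine ⟨C3 * C1 ^ ((2 - q) / (2 - r)) * C2 ^ e, by positivity, ((2:ℝ) ^ (-(1 / 2 : ℝ))) ^ e,
    by positivity, Real.rpow_lt_one (by positivity) hθ1 he0, ?_⟩
  intro h1 h2 hh1 hh2 ι _ n n' hinj ρ hρ j j' B hB hmax f hf
  set A : ι → Measure G := fun i => Am b h1 h2 (n i + 1 + j) (n' i + 1 + j') (ρ i) with hA
  have hAc : ∀ i, CProb (A i) := fun i => cProb_Am hb _ _ _ _ _
  have hQ : ∀ {f : G → ℝ}, Nice f → ∀ i, Nice (Qd (h1, 0) (n i) (Qd (0, h2) (n' i) f)) :=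
    fun hf i => (hf.Qd _ _).Qd _ _
  have key := H3 (fun f x => ⨆ i, ‖avg (A i) (Qd (h1, 0) (n i) (Qd (0, h2) (n' i) f)) x‖ₑ)
    (fun f hf => Measurable.iSup fun i => ((hQ hf i).avg (hAc i)).1.enorm) ?_
    (C1 * B ^ (1 - r / 2)) (C2 * ((2:ℝ) ^ (-(1 / 2 : ℝ))) ^ (j + j')) (by positivity) (by positivity)
    ?_ (fun f hf => L2 h1 h2 hh1 hh2 n n' hinj ρ hρ j j' f hf) f hf
  · refine key.trans (le_of_eq ?_)
    congr 2
    rw [Real.mul_rpow hC1.le (by positivity), Real.mul_rpow hC2.le (by positivity),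
      ← Real.rpow_mul hB.le, ← Real.rpow_natCast, ← Real.rpow_natCast, ← Real.rpow_mul (by positivity),
      ← Real.rpow_mul (by positivity) e, mul_comm e]
    have : (1 - r / 2) * ((2 - q) / (2 - r)) = 1 - q / 2 := by
      have : 2 - r ≠ 0 := by linarith
      field_simp
    rw [this]
    ring
  · intro f g hf hg x
    refine iSup_le fun i => ?_
    rw [Qd_add hf hg, Qd_add (hf.Qd _ _) (hg.Qd _ _), avg_add (hAc i) (hQ hf i) (hQ hg i)]
    refine (enorm_add_le _ _).trans (add_le_add ?_ ?_)
    · exact le_iSup (fun i => ‖avg (A i) (Qd (h1, 0) (n i) (Qd (0, h2) (n' i) f)) x‖ₑ) i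
    · exact le_iSup (fun i => ‖avg (A i) (Qd (h1, 0) (n i) (Qd (0, h2) (n' i) g)) x‖ₑ) i
  · intro f hf
    obtain ⟨L, hL⟩ := (Finset.univ.image n).exists_nat_subset_range
    obtain ⟨L', hL'⟩ := (Finset.univ.image n').exists_nat_subset_range
    calc ∫⁻ x, (⨆ i, ‖avg (A i) (Qd (h1, 0) (n i) (Qd (0, h2) (n' i) f)) x‖ₑ) ^ r
        ≤ ∫⁻ x, (∑ i, lavg (A i) (fun y => ‖Qd (h1, 0) (n i) (Qd (0, h2) (n' i) f) y‖ₑ) x ^ 2) ^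
            (r / 2) := by
          refine lintegral_mono fun x => ?_
          have : ∀ z : ℝ≥0∞, z ^ r = (z ^ (2:ℝ)) ^ (r / 2) := fun z => by
            rw [← ENNReal.rpow_mul]; congr 1; ring
          simp only
          rw [this]
          refine ENNReal.rpow_le_rpow ((iSup_sq_le_sum _).trans ?_) (by linarith)
          exact Finset.sum_le_sum fun i _ => pow_le_pow_left' (enorm_avg_le _ _ _) 2
      _ ≤ ENNReal.ofReal B ^ (1 - r / 2) *
            ∫⁻ x, (∑ i, ‖Qd (h1, 0) (n i) (Qd (0, h2) (n' i) f) x‖ₑ ^ 2) ^ (r / 2) :=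
          vector_valued hAc hq hr hmax (fun i => (hQ hf i).1.enorm) fun i x => enorm_ne_top
      _ ≤ ENNReal.ofReal B ^ (1 - r / 2) * (ENNReal.ofReal C1 * ∫⁻ x, ‖f x‖ₑ ^ r) := by
          refine mul_le_mul_right (le_trans (lintegral_mono fun x => ?_)
            (H1 _ _ (isAxis_fst hh1) (isAxis_snd hh2) f hf L L')) _
          refine ENNReal.rpow_le_rpow ?_ (by linarith)
          rw [← Finset.sum_product', ← Finset.sum_image (s := Finset.univ)
            (g := fun i => (n i, n' i))
            (f := fun k : ℕ × ℕ => ‖Qd (h1, 0) k.1 (Qd (0, h2) k.2 f) x‖ₑ ^ 2)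
            fun _ _ _ _ h => hinj h]
          refine Finset.sum_le_sum_of_subset fun k hk => ?_
          obtain ⟨i, -, rfl⟩ := Finset.mem_image.1 hk
          exact Finset.mem_product.2 ⟨hL (Finset.mem_image_of_mem _ (Finset.mem_univ i)),
            hL' (Finset.mem_image_of_mem _ (Finset.mem_univ i))⟩
      _ = _ := by
          rw [← mul_assoc, ENNReal.ofReal_rpow_of_nonneg hB.le (by linarith),
            ← ENNReal.ofReal_mul (by positivity), mul_comm C1]

theorem Nice.sum {κ : Type*} (s : Finset κ) {g : κ → G → ℝ} (hg : ∀ k, Nice (g k)) :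
    Nice fun x => ∑ k ∈ s, g k x := by
  induction s using Finset.induction_on with
  | empty => simpa using Nice.zero
  | insert k s hk ih =>
    simp only [Finset.sum_insert hk]
    exact (hg k).add ih

theorem avg_sum {κ : Type*} (s : Finset κ) {ν : Measure G} (hν : CProb ν) {g : κ → G → ℝ}
    (hg : ∀ k, Nice (g k)) (x : G) :
    avg ν (fun y => ∑ k ∈ s, g k y) x = ∑ k ∈ s, avg ν (g k) x :=
  integral_finsetSum _ fun k _ => (hg k).integrable_sub hν x

theorem Qd_sum {κ : Type*} (s : Finset κ) (d : G) (n : ℕ) {g : κ → G → ℝ} (hg : ∀ k, Nice (g k)) :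
    Qd d n (fun y => ∑ k ∈ s, g k y) = fun x => ∑ k ∈ s, Qd d n (g k) x := by
  ext x
  simp only [CurveMax.Qd]
  rw [avg_sum s (cProb_chain d n) hg, avg_sum s (cProb_chain d (n + 1)) hg, Finset.sum_sub_distrib]

theorem Cd_eq_sum {f : G → ℝ} (hf : Nice f) (d : G) (a : ℕ) :
    Cd d a f = fun x => ∑ j ∈ Finset.range a, Qd d (a - 1 - j) f x := by
  ext x
  rw [Finset.sum_range_reflect fun n => Qd d n f x]
  simp only [CurveMax.Qd, CurveMax.Cd]
  rw [Finset.sum_range_sub' fun n => avg (chain d n) f x, avg_chain_zero hf]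

theorem Rop_eq_sum {b : ℝ} (hb : 1 < b) (h1 h2 : ℝ) (a c : ℕ) (ρ : ℝ) {f : G → ℝ} (hf : Nice f) (x : G) :
    Rop b h1 h2 (a + 1) (c + 1) ρ f x = ∑ j ∈ Finset.range (a + 1), ∑ j' ∈ Finset.range (c + 1),
      avg (Am b h1 h2 (a + 1) (c + 1) ρ) (Qd (h1, 0) (a - j) (Qd (0, h2) (c - j') f)) x := by
  rw [CurveMax.Rop, Cd_eq_sum (hf.Cd _ _), Cd_eq_sum hf]
  simp only [Nat.add_sub_cancel]
  rw [avg_sum _ (cProb_Am hb _ _ _ _ _) fun j =>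
    (Nice.sum (Finset.range (c + 1)) fun j' => hf.Qd (0, h2) (c - j')).Qd (h1, 0) (a - j)]
  refine Finset.sum_congr rfl fun j _ => ?_
  rw [Qd_sum _ _ _ fun j' => hf.Qd (0, h2) (c - j'), avg_sum _ (cProb_Am hb _ _ _ _ _) fun j' =>
    (hf.Qd _ _).Qd _ _]

theorem avg_Am_decomposition {b : ℝ} (hb : 1 < b) (h1 h2 : ℝ) (a c : ℕ) (ρ : ℝ) {f : G → ℝ}
    (hf : Nice f) (x : G) :
    avg (Am b h1 h2 a c ρ) f x = avg (Am b h1 h2 a c ρ) (avg (chain (h1, 0) a) f) x +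
      avg (Am b h1 h2 a c ρ) (avg (chain (0, h2) c) f) x -
      avg (Am b h1 h2 a c ρ) (avg (chain (h1, 0) a) (avg (chain (0, h2) c) f)) x +
      Rop b h1 h2 a c ρ f x := by
  have hA := cProb_Am hb h1 h2 a c ρ
  have h1' := cProb_chain (h1, 0) a
  have h2' := cProb_chain (0, h2) c
  have e : CurveMax.Cd (h1, 0) a (CurveMax.Cd (0, h2) c f) = fun y =>
      (f y - avg (chain (0, h2) c) f y) -
        (avg (chain (h1, 0) a) f y - avg (chain (h1, 0) a) (avg (chain (0, h2) c) f) y) := by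
    ext y
    simp only [CurveMax.Cd]
    rw [← avg_sub h1' hf (hf.avg h2')]
    rfl
  rw [CurveMax.Rop, e, avg_sub hA (hf.sub (hf.avg h2')) ((hf.avg h1').sub ((hf.avg h2').avg h1')),
    avg_sub hA hf (hf.avg h2'), avg_sub hA (hf.avg h1') ((hf.avg h2').avg h1')]
  ring

theorem lavg_Am_le {b : ℝ} (hb : 1 < b) : ∃ K > 0, ∀ (h1 h2 : ℝ) (a c : ℕ), ∀ ρ ∈ Icc (1:ℝ) 4,
    ∀ f : G → ℝ, Nice f → ∀ x,
    ((∀ y, 0 ≤ f y) → lavg (Am b h1 h2 (a + 1) (c + 1) ρ) (fun y => ‖f y‖ₑ) x ≤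
      ENNReal.ofReal K * (MD (0, h2) (MD (h1, 0) fun y => ‖f y‖ₑ) x +
        MD (h1, 0) (MD (0, h2) fun y => ‖f y‖ₑ) x) + ‖Rop b h1 h2 (a + 1) (c + 1) ρ f x‖ₑ) ∧
    ‖Rop b h1 h2 (a + 1) (c + 1) ρ f x‖ₑ ≤
      lavg (Am b h1 h2 (a + 1) (c + 1) ρ) (fun y => ‖f y‖ₑ) x +
      ENNReal.ofReal K * (MD (0, h2) (MD (h1, 0) fun y => ‖f y‖ₑ) x +
        MD (h1, 0) (MD (0, h2) fun y => ‖f y‖ₑ) x +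
        MD (0, h2) (MD (h1, 0) (MD (0, h2) fun y => ‖f y‖ₑ)) x) := by
  obtain ⟨m, hm⟩ := exists_curve_exponent b
  refine ⟨16 * 2 ^ m, by positivity, ?_⟩
  intro h1 h2 a c ρ hρ f hf x
  set A := Am b h1 h2 (a + 1) (c + 1) ρ with hAdef
  set P1 := chain (h1, 0) (a + 1)
  set P2 := chain (0, h2) (c + 1)
  have hA : CProb A := cProb_Am hb _ _ _ _ _
  have hP1 : CProb P1 := cProb_chain _ _
  have hP2 : CProb P2 := cProb_chain _ _
  set F : G → ℝ≥0∞ := fun y => ‖f y‖ₑ with hFdef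
  have hF : Measurable F := hf.1.enorm
  have i1 : ‖avg A (avg P1 f) x‖ₑ ≤ ENNReal.ofReal (16 * 2 ^ m) * MD (0, h2) (MD (h1, 0) F) x := by
    refine (enorm_avg_le _ _ _).trans ((lavg_mono (fun y => enorm_avg_le _ _ _) x).trans ?_)
    refine (lavg_cur_first_le hb hm hρ a (c + 1) hF x).trans (mul_le_mul_left ?_ _)
    exact ENNReal.ofReal_le_ofReal (by gcongr; norm_num)
  have i2 : ‖avg A (avg P2 f) x‖ₑ ≤ ENNReal.ofReal (16 * 2 ^ m) * MD (h1, 0) (MD (0, h2) F) x := by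
    refine (enorm_avg_le _ _ _).trans ((lavg_mono (fun y => enorm_avg_le _ _ _) x).trans ?_)
    refine (lavg_cur_second_le hb hm hρ (a + 1) c hF x).trans (mul_le_mul_left ?_ _)
    refine ENNReal.ofReal_le_ofReal ?_
    have : (0:ℝ) < 2 ^ m := by positivity
    rw [pow_add]; linarith
  have i3 : ‖avg A (avg P1 (avg P2 f)) x‖ₑ ≤
      ENNReal.ofReal (16 * 2 ^ m) * MD (0, h2) (MD (h1, 0) (MD (0, h2) F)) x := by
    refine (enorm_avg_le _ _ _).trans ((lavg_mono (fun y => (enorm_avg_le _ _ _).trans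
      (lavg_mono (fun z => enorm_avg_le _ _ _) y)) x).trans ?_)
    exact lavg_cur_both_le hb hm hρ a c hF x
  have hdec := avg_Am_decomposition hb h1 h2 (a + 1) (c + 1) ρ hf x
  constructor
  · intro h0
    rw [← enorm_avg_eq hA hf h0]
    have n3 : 0 ≤ avg A (avg P1 (avg P2 f)) x :=
      avg_nonneg (fun y => avg_nonneg (fun z => avg_nonneg h0 z) y) x
    have n1 : 0 ≤ avg A f x := avg_nonneg h0 x
    calc ‖avg A f x‖ₑ ≤ ‖avg A (avg P1 f) x + avg A (avg P2 f) x +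
            ‖Rop b h1 h2 (a + 1) (c + 1) ρ f x‖‖ₑ := by
          have n4 : 0 ≤ avg A (avg P1 f) x := avg_nonneg (fun y => avg_nonneg h0 y) x
          have n5 : 0 ≤ avg A (avg P2 f) x := avg_nonneg (fun y => avg_nonneg h0 y) x
          have n6 := le_abs_self (Rop b h1 h2 (a + 1) (c + 1) ρ f x)
          rw [Real.enorm_of_nonneg n1, Real.enorm_of_nonneg (by positivity)]
          refine ENNReal.ofReal_le_ofReal ?_
          rw [Real.norm_eq_abs]
          linarith
      _ ≤ ‖avg A (avg P1 f) x‖ₑ + ‖avg A (avg P2 f) x‖ₑ + ‖Rop b h1 h2 (a + 1) (c + 1) ρ f x‖ₑ := by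
          refine (enorm_add_le _ _).trans (add_le_add (enorm_add_le _ _) (le_of_eq ?_))
          exact enorm_norm _
      _ ≤ _ := by
          rw [mul_add]
          gcongr
  · have e : Rop b h1 h2 (a + 1) (c + 1) ρ f x = avg A f x - (avg A (avg P1 f) x +
        avg A (avg P2 f) x - avg A (avg P1 (avg P2 f)) x) := by linarith
    rw [e]
    refine (enorm_sub_le).trans (add_le_add (enorm_avg_le _ _ _) ?_)
    rw [mul_add, mul_add]
    exact (enorm_sub_le).trans (add_le_add ((enorm_add_le _ _).trans (add_le_add i1 i2)) i3)

theorem MD_nrm {q : ℝ} (hq : 1 < q) : ∃ K > 0, ∀ d : G, IsAxis d → ∀ F : G → ℝ≥0∞, Measurable F →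
    nrm q (MD d F) ≤ ENNReal.ofReal K * nrm q F := by
  obtain ⟨C, hC, H⟩ := MD_strong hq
  exact ⟨C ^ (1 / q), by positivity, fun d hd F hF =>
    nrm_le_of_lintegral_le (by linarith) hC.le (H d hd F hF)⟩

theorem nrm_const_mul {q : ℝ} (hq : 0 < q) (K : ℝ≥0∞) {F : G → ℝ≥0∞} (hF : Measurable F) :
    nrm q (fun x => K * F x) = K * nrm q F := by
  simp only [nrm, ENNReal.mul_rpow_of_nonneg _ _ hq.le]
  rw [lintegral_const_mul _ (hF.pow_const q), ENNReal.mul_rpow_of_nonneg _ _ (by positivity),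
    ← ENNReal.rpow_mul, mul_one_div_cancel hq.ne', ENNReal.rpow_one]

/-- Iterated one dimensional maximal functions appearing as error terms. -/
def errMD (h1 h2 : ℝ) (F : G → ℝ≥0∞) (x : G) : ℝ≥0∞ :=
  MD (0, h2) (MD (h1, 0) F) x + MD (h1, 0) (MD (0, h2) F) x +
    MD (0, h2) (MD (h1, 0) (MD (0, h2) F)) x

theorem measurable_errMD (h1 h2 : ℝ) {F : G → ℝ≥0∞} (hF : Measurable F) :
    Measurable (errMD h1 h2 F) :=
  ((measurable_MD (measurable_MD hF)).add (measurable_MD (measurable_MD hF))).add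
    (measurable_MD (measurable_MD (measurable_MD hF)))

theorem errMD_nrm {q : ℝ} (hq : 1 < q) : ∃ K > 0, ∀ h1 h2 : ℝ, h1 ≠ 0 → h2 ≠ 0 →
    ∀ F : G → ℝ≥0∞, Measurable F → nrm q (errMD h1 h2 F) ≤ ENNReal.ofReal K * nrm q F := by
  obtain ⟨K, hK, H⟩ := MD_nrm hq
  refine ⟨K * K + K * K + K * (K * K), by positivity, ?_⟩
  intro h1 h2 hh1 hh2 F hF
  have a1 := isAxis_fst hh1
  have a2 := isAxis_snd hh2
  have two : ∀ d e, IsAxis d → IsAxis e → ∀ F : G → ℝ≥0∞, Measurable F →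
      nrm q (MD d (MD e F)) ≤ ENNReal.ofReal (K * K) * nrm q F := by
    intro d e hd he F hF
    rw [ENNReal.ofReal_mul hK.le, mul_assoc]
    exact (H d hd _ (measurable_MD hF)).trans (mul_le_mul_right (H e he F hF) _)
  have m1 := measurable_MD (d := (0, h2)) (measurable_MD (d := (h1, 0)) hF)
  have m2 := measurable_MD (d := (h1, 0)) (measurable_MD (d := (0, h2)) hF)
  have m3 := measurable_MD (d := (0, h2)) m2
  refine (nrm_add_le hq.le (m1.add m2) m3).trans ?_
  rw [ENNReal.ofReal_add (by positivity) (by positivity),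
    ENNReal.ofReal_add (by positivity) (by positivity), add_mul, add_mul]
  refine add_le_add ((nrm_add_le hq.le m1 m2).trans
    (add_le_add (two _ _ a2 a1 F hF) (two _ _ a1 a2 F hF))) ?_
  rw [ENNReal.ofReal_mul hK.le, mul_assoc]
  exact (H _ a2 _ m2).trans (mul_le_mul_right (two _ _ a1 a2 F hF) _)

theorem sum_sum_geometric_le {M τ : ℝ} (hM : 0 ≤ M) (hτ : 0 ≤ τ) (hτ1 : τ < 1) (N : ℕ) (X : ℝ≥0∞) :
    ∑ j ∈ Finset.range N, ∑ j' ∈ Finset.range N, ENNReal.ofReal (M * (τ ^ j * τ ^ j')) * X ≤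
      ENNReal.ofReal (M * ((1 - τ)⁻¹ * (1 - τ)⁻¹)) * X := by
  have geom : ∑ j ∈ Finset.range N, τ ^ j ≤ (1 - τ)⁻¹ := by
    rw [← tsum_geometric_of_lt_one hτ hτ1]
    exact (summable_geometric_of_lt_one hτ hτ1).sum_le_tsum _ fun _ _ => by positivity
  have hs : 0 ≤ ∑ j ∈ Finset.range N, τ ^ j := Finset.sum_nonneg fun _ _ => by positivity
  simp only [← Finset.sum_mul]
  refine mul_le_mul_left ?_ _
  have e : ∑ j ∈ Finset.range N, ∑ j' ∈ Finset.range N, ENNReal.ofReal (M * (τ ^ j * τ ^ j')) =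
      ENNReal.ofReal (M * ((∑ j ∈ Finset.range N, τ ^ j) * ∑ j ∈ Finset.range N, τ ^ j)) := by
    rw [Finset.sum_mul_sum, Finset.mul_sum, ENNReal.ofReal_sum_of_nonneg fun j _ =>
      mul_nonneg hM (Finset.sum_nonneg fun _ _ => by positivity)]
    refine Finset.sum_congr rfl fun j _ => ?_
    rw [Finset.mul_sum, ENNReal.ofReal_sum_of_nonneg fun _ _ => by positivity]
  rw [e]
  refine ENNReal.ofReal_le_ofReal ?_
  gcongr

/-- Improvement of an a priori bound for the remainder part of a lacunary maximal operator. -/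
theorem iSup_Rop_nrm_of_apriori {b : ℝ} (hb : 1 < b) {q : ℝ} (hq : 1 < q) (hq2 : q ≤ 2) :
    ∃ K > 0, ∀ h1 h2 : ℝ, h1 ≠ 0 → h2 ≠ 0 → ∀ {ι : Type} [Fintype ι]
      (a c : ι → ℕ), (Function.Injective fun i => (a i, c i)) → ∀ (ρ : ι → ℝ),
      (∀ i, ρ i ∈ Icc (1:ℝ) 4) → ∀ β : ℝ, 0 < β →
      (∀ F : G → ℝ≥0∞, Measurable F →
        nrm q (supAvg (fun i => Am b h1 h2 (a i + 1) (c i + 1) (ρ i)) F) ≤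
          ENNReal.ofReal β * nrm q F) →
      ∀ f : G → ℝ, Nice f →
      nrm q (fun x => ⨆ i, ‖Rop b h1 h2 (a i + 1) (c i + 1) (ρ i) f x‖ₑ) ≤
        ENNReal.ofReal (K * β ^ (1 - q / 2)) * nrm q (fun x => ‖f x‖ₑ) := by
  have h0 : 0 < q := by linarith
  obtain ⟨C, hC, θ, hθ, hθ1, H⟩ := piece_Lq hb hq hq2
  set τ := θ ^ (1 / q) with hτ
  have hτ0 : 0 < τ := by positivity
  have hτ1 : τ < 1 := Real.rpow_lt_one hθ.le hθ1 (by positivity)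
  have hτ2 : 0 < 1 - τ := by linarith
  refine ⟨C ^ (1 / q) * ((1 - τ)⁻¹ * (1 - τ)⁻¹), by positivity, ?_⟩
  intro h1 h2 hh1 hh2 ι _ a c hinj ρ hρ β hβ hmax f hf
  set A : ι → Measure G := fun i => Am b h1 h2 (a i + 1) (c i + 1) (ρ i) with hA
  have hAc : ∀ i, CProb (A i) := fun i => cProb_Am hb _ _ _ _ _
  set T : ℕ → ℕ → G → ℝ≥0∞ := fun j j' x => ⨆ i : {i : ι // j ≤ a i ∧ j' ≤ c i},
    ‖avg (A i) (Qd (h1, 0) (a i - j) (Qd (0, h2) (c i - j') f)) x‖ₑ with hT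
  have mT : ∀ j j', Measurable (T j j') := fun j j' => Measurable.iSup fun i =>
    (((hf.Qd _ _).Qd _ _).avg (hAc i)).1.enorm
  have hTn : ∀ j j', nrm q (T j j') ≤
      ENNReal.ofReal (C ^ (1 / q) * β ^ (1 - q / 2) * (τ ^ j * τ ^ j')) * nrm q fun x => ‖f x‖ₑ := by
    intro j j'
    have e : C ^ (1 / q) * β ^ (1 - q / 2) * (τ ^ j * τ ^ j') =
        (C * (β ^ q) ^ (1 - q / 2) * θ ^ (j + j')) ^ (1 / q) := by
      rw [Real.mul_rpow (by positivity) (by positivity), Real.mul_rpow (by positivity) (by positivity),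
        ← Real.rpow_mul hβ.le, ← Real.rpow_mul hβ.le, ← pow_add, hτ, ← Real.rpow_natCast,
        ← Real.rpow_natCast, ← Real.rpow_mul hθ.le, ← Real.rpow_mul hθ.le, mul_comm (1 / q)]
      congr 3
      field_simp
    rw [e]
    refine nrm_le_of_lintegral_le h0 (by positivity) ?_
    have hi : ∀ i : {i : ι // j ≤ a i ∧ j' ≤ c i},
        Am b h1 h2 (a i - j + 1 + j) (c i - j' + 1 + j') (ρ i) = A i := by
      rintro ⟨i, hi, hi'⟩
      rw [hA]
      simp only
      congr 1 <;> omega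
    have key := H h1 h2 hh1 hh2 (ι := {i : ι // j ≤ a i ∧ j' ≤ c i}) (fun i => a i - j)
      (fun i => c i - j') ?_ (fun i => ρ i) (fun i => hρ i) j j' (β ^ q) (by positivity) ?_ f hf
    · simp only [hi] at key
      exact key
    · rintro ⟨i, hi, hi'⟩ ⟨k, hk, hk'⟩ h
      simp only [Prod.mk.injEq] at h
      refine Subtype.ext (hinj (Prod.ext ?_ ?_)) <;> simp only <;> omega
    · intro F hF
      simp only [hi]
      refine le_trans ?_ (lintegral_le_of_nrm_le h0 hβ.le (hmax F hF))
      refine lintegral_mono fun x => ENNReal.rpow_le_rpow ?_ h0.le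
      exact iSup_le fun i => le_iSup (fun i => lavg (A i) F x) (i : ι)
  obtain ⟨N, hN⟩ : ∃ N, ∀ i, a i + 1 ≤ N ∧ c i + 1 ≤ N := by
    obtain ⟨N, hN⟩ := (Finset.univ.image fun i => a i + c i).exists_nat_subset_range
    refine ⟨N, fun i => ?_⟩
    have := Finset.mem_range.1 (hN (Finset.mem_image_of_mem _ (Finset.mem_univ i)))
    omega
  have hpt : ∀ x, ⨆ i, ‖Rop b h1 h2 (a i + 1) (c i + 1) (ρ i) f x‖ₑ ≤
      ∑ j ∈ Finset.range N, ∑ j' ∈ Finset.range N, T j j' x := by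
    intro x
    refine iSup_le fun i => ?_
    rw [Rop_eq_sum hb _ _ _ _ _ hf]
    calc _ ≤ ∑ j ∈ Finset.range (a i + 1), ∑ j' ∈ Finset.range (c i + 1),
          ‖avg (A i) (Qd (h1, 0) (a i - j) (Qd (0, h2) (c i - j') f)) x‖ₑ :=
          (enorm_sum_le _ _).trans (Finset.sum_le_sum fun j _ => enorm_sum_le _ _)
      _ ≤ ∑ j ∈ Finset.range (a i + 1), ∑ j' ∈ Finset.range (c i + 1), T j j' x := by
          refine Finset.sum_le_sum fun j hj => Finset.sum_le_sum fun j' hj' => ?_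
          rw [Finset.mem_range] at hj hj'
          exact le_iSup (fun i : {i : ι // j ≤ a i ∧ j' ≤ c i} =>
            ‖avg (A i) (Qd (h1, 0) (a i - j) (Qd (0, h2) (c i - j') f)) x‖ₑ) ⟨i, by omega, by omega⟩
      _ ≤ ∑ j ∈ Finset.range (a i + 1), ∑ j' ∈ Finset.range N, T j j' x :=
          Finset.sum_le_sum fun j _ =>
            Finset.sum_le_sum_of_subset (Finset.range_subset_range.2 (hN i).2)
      _ ≤ _ := Finset.sum_le_sum_of_subset (Finset.range_subset_range.2 (hN i).1)
  calc _ ≤ nrm q (fun x => ∑ j ∈ Finset.range N, ∑ j' ∈ Finset.range N, T j j' x) := nrm_mono h0 hpt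
    _ ≤ ∑ j ∈ Finset.range N, ∑ j' ∈ Finset.range N, nrm q (T j j') :=
        (nrm_sum_le hq.le _ fun j => Finset.measurable_sum _ fun j' _ => mT j j').trans
          (Finset.sum_le_sum fun j _ => nrm_sum_le hq.le _ fun j' => mT j j')
    _ ≤ ∑ j ∈ Finset.range N, ∑ j' ∈ Finset.range N,
          ENNReal.ofReal (C ^ (1 / q) * β ^ (1 - q / 2) * (τ ^ j * τ ^ j')) *
            nrm q fun x => ‖f x‖ₑ :=
        Finset.sum_le_sum fun j _ => Finset.sum_le_sum fun j' _ => hTn j j'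
    _ ≤ _ := by
        refine (sum_sum_geometric_le (by positivity) hτ0.le hτ1 N _).trans (le_of_eq ?_)
        ring_nf

theorem nrm_supAvg_of_nice {ι : Type*} [Countable ι] {ν : ι → Measure G} (hν : ∀ i, CProb (ν i))
    {q : ℝ} (hq : 0 < q) {K : ℝ≥0∞}
    (h : ∀ f : G → ℝ, Nice f → (∀ x, 0 ≤ f x) →
      nrm q (supAvg ν (fun y => ‖f y‖ₑ)) ≤ K * nrm q fun x => ‖f x‖ₑ)
    {F : G → ℝ≥0∞} (hF : Measurable F) : nrm q (supAvg ν F) ≤ K * nrm q F :=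
  (nrm_le_iff hq).2 (supAvg_of_nice hν hq (fun f hf h0 => (nrm_le_iff hq).1 (h f hf h0)) hF)

/-- The bi-parameter lacunary maximal function along dilates of the curve is bounded. -/
theorem lacunary_maximal {b : ℝ} (hb : 1 < b) {q : ℝ} (hq : 1 < q) (hq2 : q ≤ 2) :
    ∃ K > 0, ∀ h1 h2 : ℝ, h1 ≠ 0 → h2 ≠ 0 → ∀ {ι : Type} [Fintype ι]
      (a c : ι → ℕ), (Function.Injective fun i => (a i, c i)) → ∀ (ρ : ι → ℝ),
      (∀ i, ρ i ∈ Icc (1:ℝ) 4) → ∀ F : G → ℝ≥0∞, Measurable F →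
        nrm q (supAvg (fun i => Am b h1 h2 (a i + 1) (c i + 1) (ρ i)) F) ≤
          ENNReal.ofReal K * nrm q F := by
  have h0 : 0 < q := by linarith
  obtain ⟨E, hE, HR⟩ := iSup_Rop_nrm_of_apriori hb hq hq2
  obtain ⟨K1, hK1, HA⟩ := lavg_Am_le hb
  obtain ⟨K2, hK2, HM⟩ := errMD_nrm hq
  set D := K1 * K2 with hD
  have hD0 : 0 < D := by positivity
  set β0 := 1 + 16 * E ^ 2 + 4 * D with hβ0
  have hβ0' : 0 < β0 := by positivity
  refine ⟨β0, hβ0', ?_⟩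
  intro h1 h2 hh1 hh2 ι _ a c hinj ρ hρ
  set A : ι → Measure G := fun i => Am b h1 h2 (a i + 1) (c i + 1) (ρ i) with hA
  have hAc : ∀ i, CProb (A i) := fun i => cProb_Am hb _ _ _ _ _
  set S : ℝ → Prop := fun β => ∀ F : G → ℝ≥0∞, Measurable F →
    nrm q (supAvg A F) ≤ ENNReal.ofReal β * nrm q F with hS
  have mono : ∀ {β β'}, β ≤ β' → S β → S β' := fun hββ h F hF =>
    (h F hF).trans (mul_le_mul_left (ENNReal.ofReal_le_ofReal hββ) _)
  have improve : ∀ β, 0 < β → S β → S (D + E * β ^ (1 - q / 2)) := by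
    intro β hβ hSβ F hF
    refine nrm_supAvg_of_nice hAc h0 (fun f hf hf0 => ?_) hF
    have mf : Measurable fun x => ‖f x‖ₑ := hf.1.enorm
    have mR : Measurable fun x => ⨆ i, ‖Rop b h1 h2 (a i + 1) (c i + 1) (ρ i) f x‖ₑ :=
      Measurable.iSup fun i => (hf.Rop hb _ _ _ _ _).1.enorm
    calc nrm q (supAvg A fun y => ‖f y‖ₑ)
        ≤ nrm q (fun x => ENNReal.ofReal K1 * errMD h1 h2 (fun y => ‖f y‖ₑ) x +
            ⨆ i, ‖Rop b h1 h2 (a i + 1) (c i + 1) (ρ i) f x‖ₑ) := by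
          refine nrm_mono h0 fun x => iSup_le fun i => ?_
          refine ((HA h1 h2 (a i) (c i) (ρ i) (hρ i) f hf x).1 hf0).trans (add_le_add ?_ ?_)
          · exact mul_le_mul_right le_self_add _
          · exact le_iSup (fun i => ‖Rop b h1 h2 (a i + 1) (c i + 1) (ρ i) f x‖ₑ) i
      _ ≤ ENNReal.ofReal K1 * nrm q (errMD h1 h2 fun y => ‖f y‖ₑ) +
            nrm q (fun x => ⨆ i, ‖Rop b h1 h2 (a i + 1) (c i + 1) (ρ i) f x‖ₑ) := by
          rw [← nrm_const_mul h0 _ (measurable_errMD h1 h2 mf)]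
          exact nrm_add_le hq.le ((measurable_errMD h1 h2 mf).const_mul _) mR
      _ ≤ ENNReal.ofReal K1 * (ENNReal.ofReal K2 * nrm q fun y => ‖f y‖ₑ) +
            ENNReal.ofReal (E * β ^ (1 - q / 2)) * nrm q fun y => ‖f y‖ₑ :=
          add_le_add (mul_le_mul_right (HM h1 h2 hh1 hh2 _ mf) _)
            (HR h1 h2 hh1 hh2 a c hinj ρ hρ β hβ hSβ f hf)
      _ = _ := by
          rw [ENNReal.ofReal_add hD0.le (by positivity), add_mul, hD, ENNReal.ofReal_mul hK1.le,
            mul_assoc]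
  have half : ∀ β, β0 ≤ β → S β → S (β / 2) := by
    intro β hββ hSβ
    have hβ : 0 < β := by linarith
    refine mono ?_ (improve β hβ hSβ)
    have hβ1 : 1 ≤ β := by nlinarith [sq_nonneg E]
    have e1 : β ^ (1 - q / 2) ≤ √β := by
      rw [Real.sqrt_eq_rpow]
      exact Real.rpow_le_rpow_of_exponent_le hβ1 (by linarith)
    have e2 : 4 * E ≤ √β := Real.le_sqrt_of_sq_le (by nlinarith)
    have e3 := Real.mul_self_sqrt hβ.le
    have e4 := Real.sqrt_nonneg β
    have e5 : E * β ^ (1 - q / 2) ≤ E * √β := by gcongr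
    nlinarith [sq_nonneg E]
  have descend : ∀ n : ℕ, ∀ β, β ≤ 2 ^ n * β0 → S β → S β0 := by
    intro n
    induction n with
    | zero => exact fun β h hSβ => mono (by simpa using h) hSβ
    | succ n ih =>
      intro β h hSβ
      rcases le_total β β0 with h' | h'
      · exact mono h' hSβ
      · exact ih (β / 2) (by rw [pow_succ] at h; linarith) (half β h' hSβ)
  have start : S (((Fintype.card ι : ℝ)) ^ (1 / q)) := by
    intro F hF
    refine nrm_le_of_lintegral_le h0 (by positivity) ?_
    rw [ENNReal.ofReal_natCast]
    exact supAvg_le_card hAc hq.le hF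
  obtain ⟨n, hn⟩ := pow_unbounded_of_one_lt ((Fintype.card ι : ℝ) ^ (1 / q) / β0) (one_lt_two)
  exact descend n _ ((div_le_iff₀ hβ0').1 hn.le) start

/-- The lacunary maximal function associated with the remainders. -/
theorem lacunary_Rop {b : ℝ} (hb : 1 < b) {q : ℝ} (hq : 1 < q) (hq2 : q ≤ 2) :
    ∃ K > 0, ∀ h1 h2 : ℝ, h1 ≠ 0 → h2 ≠ 0 → ∀ {ι : Type} [Fintype ι]
      (a c : ι → ℕ), (Function.Injective fun i => (a i, c i)) → ∀ (ρ : ι → ℝ),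
      (∀ i, ρ i ∈ Icc (1:ℝ) 4) → ∀ f : G → ℝ, Nice f →
      nrm q (fun x => ⨆ i, ‖Rop b h1 h2 (a i + 1) (c i + 1) (ρ i) f x‖ₑ) ≤
        ENNReal.ofReal K * nrm q fun x => ‖f x‖ₑ := by
  obtain ⟨E, hE, HR⟩ := iSup_Rop_nrm_of_apriori hb hq hq2
  obtain ⟨K, hK, H⟩ := lacunary_maximal hb hq hq2
  exact ⟨E * K ^ (1 - q / 2), by positivity, fun h1 h2 hh1 hh2 ι _ a c hinj ρ hρ f hf =>
    HR h1 h2 hh1 hh2 a c hinj ρ hρ K hK (H h1 h2 hh1 hh2 a c hinj ρ hρ) f hf⟩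

theorem Rop_add {b : ℝ} (hb : 1 < b) {f g : G → ℝ} (hf : Nice f) (hg : Nice g) (h1 h2 : ℝ) (a c : ℕ)
    (ρ : ℝ) (x : G) :
    Rop b h1 h2 a c ρ (fun y => f y + g y) x = Rop b h1 h2 a c ρ f x + Rop b h1 h2 a c ρ g x := by
  simp only [CurveMax.Rop]
  rw [Cd_add hf hg, Cd_add (hf.Cd _ _) (hg.Cd _ _),
    avg_add (cProb_Am hb _ _ _ _ _) ((hf.Cd _ _).Cd _ _) ((hg.Cd _ _).Cd _ _)]

/-- The maximal function over finitely many differences of remainders. -/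
def diffMax {ι κ : Type} (b h1 h2 : ℝ) (a c : ι → ℕ) (ρ ρ' : κ → ι → ℝ) (f : G → ℝ) (x : G) : ℝ≥0∞ :=
  ⨆ k, ⨆ i, ‖Rop b h1 h2 (a i + 1) (c i + 1) (ρ k i) f x - Rop b h1 h2 (a i + 1) (c i + 1) (ρ' k i) f x‖ₑ

theorem measurable_diffMax {ι κ : Type} [Countable ι] [Countable κ] {b : ℝ} (hb : 1 < b) (h1 h2 : ℝ)
    (a c : ι → ℕ) (ρ ρ' : κ → ι → ℝ) {f : G → ℝ} (hf : Nice f) :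
    Measurable (diffMax b h1 h2 a c ρ ρ' f) :=
  Measurable.iSup fun _ => Measurable.iSup fun _ =>
    ((hf.Rop hb _ _ _ _ _).sub (hf.Rop hb _ _ _ _ _)).1.enorm

theorem lintegral_iSup_rpow_le {κ : Type*} [Fintype κ] {q : ℝ} (hq : 0 < q) {F : κ → G → ℝ≥0∞}
    (hF : ∀ k, Measurable (F k)) {N : ℝ} (hN : (Fintype.card κ : ℝ) ≤ N) {X : ℝ≥0∞}
    (h : ∀ k, ∫⁻ x, F k x ^ q ≤ X) : ∫⁻ x, (⨆ k, F k x) ^ q ≤ ENNReal.ofReal N * X := by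
  calc ∫⁻ x, (⨆ k, F k x) ^ q ≤ ∫⁻ x, ∑ k, F k x ^ q := by
        refine lintegral_mono fun x => ?_
        simp only
        rw [iSup_rpow _ hq]
        exact iSup_le fun k => Finset.single_le_sum (f := fun k => F k x ^ q) (fun _ _ => zero_le)
          (Finset.mem_univ k)
    _ = ∑ k, ∫⁻ x, F k x ^ q := lintegral_finsetSum _ fun k _ => (hF k).pow_const q
    _ ≤ ∑ k : κ, X := Finset.sum_le_sum fun k _ => h k
    _ = (Fintype.card κ : ℝ≥0∞) * X := by simp
    _ ≤ _ := by
        refine mul_le_mul_left ?_ _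
        rw [← ENNReal.ofReal_natCast]
        exact ENNReal.ofReal_le_ofReal hN

theorem diffMax_L2 {b : ℝ} (hb : 1 < b) {η : ℝ} (hη : 0 < η) (hη2 : η ≤ 1 / 2) :
    ∃ C > 0, ∀ h1 h2 : ℝ, h1 ≠ 0 → h2 ≠ 0 → ∀ {ι κ : Type} [Fintype ι] [Fintype κ] (a c : ι → ℕ),
      (Function.Injective fun i => (a i, c i)) → ∀ (ρ ρ' : κ → ι → ℝ),
      (∀ k i, ρ k i ∈ Icc (1:ℝ) 4) → (∀ k i, ρ' k i ∈ Icc (1:ℝ) 4) →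
      ∀ δ : ℝ, 0 < δ → (∀ k i, |ρ k i - ρ' k i| ≤ 4 * δ) →
      ∀ N : ℝ, 0 < N → (Fintype.card κ : ℝ) ≤ N → ∀ f : G → ℝ, Nice f →
      ∫⁻ x, diffMax b h1 h2 a c ρ ρ' f x ^ (2:ℝ) ≤
        ENNReal.ofReal (N * (C * δ ^ (1 - 2 * η))) * ∫⁻ x, ‖f x‖ₑ ^ (2:ℝ) := by
  obtain ⟨C, hC, H⟩ := difference_L2 hb hη hη2
  refine ⟨C * 4 ^ (1 - 2 * η), by positivity, ?_⟩
  intro h1 h2 hh1 hh2 ι κ _ _ a c hinj ρ ρ' hρ hρ' δ hδ hd N hN hcard f hf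
  have hn : ∀ k i, Nice fun x => Rop b h1 h2 (a i + 1) (c i + 1) (ρ k i) f x -
      Rop b h1 h2 (a i + 1) (c i + 1) (ρ' k i) f x := fun k i =>
    (hf.Rop hb _ _ _ _ _).sub (hf.Rop hb _ _ _ _ _)
  rw [ENNReal.ofReal_mul hN.le, mul_assoc]
  refine lintegral_iSup_rpow_le (by norm_num) (fun k => Measurable.iSup fun i => (hn k i).1.enorm)
    hcard fun k => ?_
  have key := H h1 h2 hh1 hh2 (fun i => a i + 1) (fun i => c i + 1)
    (fun i k h => hinj (by simpa using h)) (ρ k) (ρ' k) (hρ k) (hρ' k) (4 * δ) (hd k) f hf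
  rw [Real.mul_rpow (by norm_num) hδ.le, ← mul_assoc] at key
  simp only [ENNReal.rpow_two (‖f _‖ₑ)]
  refine le_trans ((lintegral_mono fun x => iSup_sq_le_sum _).trans (le_of_eq ?_)) key
  rw [lintegral_finsetSum]
  exact fun i _ => ((hn k i).1.enorm).pow_const 2

theorem diffMax_Lq {b : ℝ} (hb : 1 < b) {q : ℝ} (hq : 1 < q) (hq2 : q ≤ 2) :
    ∃ C > 0, ∀ h1 h2 : ℝ, h1 ≠ 0 → h2 ≠ 0 → ∀ {ι κ : Type} [Fintype ι] [Fintype κ] (a c : ι → ℕ),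
      (Function.Injective fun i => (a i, c i)) → ∀ (ρ ρ' : κ → ι → ℝ),
      (∀ k i, ρ k i ∈ Icc (1:ℝ) 4) → (∀ k i, ρ' k i ∈ Icc (1:ℝ) 4) →
      ∀ N : ℝ, 0 < N → (Fintype.card κ : ℝ) ≤ N → ∀ f : G → ℝ, Nice f →
      ∫⁻ x, diffMax b h1 h2 a c ρ ρ' f x ^ q ≤
        ENNReal.ofReal (N * C) * ∫⁻ x, ‖f x‖ₑ ^ q := by
  obtain ⟨K, hK, H⟩ := lacunary_Rop hb hq hq2
  refine ⟨(K + K) ^ q, by positivity, ?_⟩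
  intro h1 h2 hh1 hh2 ι κ _ _ a c hinj ρ ρ' hρ hρ' N hN hcard f hf
  rw [ENNReal.ofReal_mul hN.le, mul_assoc]
  refine lintegral_iSup_rpow_le (by linarith) (fun k => Measurable.iSup fun i =>
    ((hf.Rop hb _ _ _ _ _).sub (hf.Rop hb _ _ _ _ _)).1.enorm) hcard fun k => ?_
  refine lintegral_le_of_nrm_le (by linarith) (by positivity) ?_
  have m : ∀ ρ : ι → ℝ, Measurable fun x => ⨆ i, ‖Rop b h1 h2 (a i + 1) (c i + 1) (ρ i) f x‖ₑ :=
    fun ρ => Measurable.iSup fun i => (hf.Rop hb _ _ _ _ _).1.enorm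
  calc _ ≤ nrm q (fun x => (⨆ i, ‖Rop b h1 h2 (a i + 1) (c i + 1) (ρ k i) f x‖ₑ) +
          ⨆ i, ‖Rop b h1 h2 (a i + 1) (c i + 1) (ρ' k i) f x‖ₑ) := by
        refine nrm_mono (by linarith) fun x => iSup_le fun i => enorm_sub_le.trans (add_le_add ?_ ?_)
        · exact le_iSup (fun i => ‖Rop b h1 h2 (a i + 1) (c i + 1) (ρ k i) f x‖ₑ) i
        · exact le_iSup (fun i => ‖Rop b h1 h2 (a i + 1) (c i + 1) (ρ' k i) f x‖ₑ) i
    _ ≤ _ := nrm_add_le hq.le (m _) (m _)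
    _ ≤ _ := by
        rw [ENNReal.ofReal_add hK.le hK.le, add_mul]
        exact add_le_add (H h1 h2 hh1 hh2 a c hinj (ρ k) (hρ k) f hf)
          (H h1 h2 hh1 hh2 a c hinj (ρ' k) (hρ' k) f hf)

theorem diffMax_Lp {b : ℝ} (hb : 1 < b) {p : ℝ} (hp : 1 < p) (hp2 : p ≤ 2) {σ : ℝ} (hσ : 0 < σ) :
    ∃ C > 0, ∀ h1 h2 : ℝ, h1 ≠ 0 → h2 ≠ 0 → ∀ {ι κ : Type} [Fintype ι] [Fintype κ] (a c : ι → ℕ),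
      (Function.Injective fun i => (a i, c i)) → ∀ (ρ ρ' : κ → ι → ℝ),
      (∀ k i, ρ k i ∈ Icc (1:ℝ) 4) → (∀ k i, ρ' k i ∈ Icc (1:ℝ) 4) →
      ∀ δ : ℝ, 0 < δ → δ ≤ 1 → (∀ k i, |ρ k i - ρ' k i| ≤ 4 * δ) →
      ∀ N : ℝ, 0 < N → (Fintype.card κ : ℝ) ≤ N → ∀ f : G → ℝ, Nice f →
      ∫⁻ x, diffMax b h1 h2 a c ρ ρ' f x ^ p ≤
        ENNReal.ofReal (C * (N * δ ^ (p - 1 - σ))) * ∫⁻ x, ‖f x‖ₑ ^ p := by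
  have hη : 0 < min (σ / 4) (1 / 2) := lt_min (by positivity) (by norm_num)
  have hησ := min_le_left (σ / 4) (1 / 2)
  obtain ⟨C2, hC2, H2⟩ := diffMax_L2 hb hη (min_le_right _ _)
  set η := min (σ / 4) (1 / 2)
  rcases hp2.eq_or_lt with rfl | hp2
  · refine ⟨C2, hC2, ?_⟩
    intro h1 h2 hh1 hh2 ι κ _ _ a c hinj ρ ρ' hρ hρ' δ hδ hδ1 hd N hN hcard f hf
    refine (H2 h1 h2 hh1 hh2 a c hinj ρ ρ' hρ hρ' δ hδ hd N hN hcard f hf).trans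
      (mul_le_mul_left (ENNReal.ofReal_le_ofReal ?_) _)
    rw [mul_left_comm]
    gcongr 2
    exact Real.rpow_le_rpow_of_exponent_ge hδ hδ1 (by linarith)
  set s := min (σ / 2) ((p - 1) / 2) with hs
  have hs0 : 0 < s := lt_min (by positivity) (by linarith)
  have hs1 : s ≤ σ / 2 := min_le_left _ _
  have hs2 : s ≤ (p - 1) / 2 := min_le_right _ _
  obtain ⟨C1, hC1, H1⟩ := diffMax_Lq hb (q := 1 + s) (by linarith) (by linarith)
  obtain ⟨C3, hC3, H3⟩ := marcinkiewicz (p0 := 1 + s) (by linarith) (by linarith : 1 + s < p) hp2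
  set e := (p - (1 + s)) / (2 - (1 + s)) with he
  have hd0 : 0 < 2 - (1 + s) := by linarith
  have hee : (2 - p) / (2 - (1 + s)) = 1 - e := by rw [he]; field_simp; ring
  have he0 : p - 1 - s ≤ e := by
    rw [he, le_div_iff₀ hd0]; nlinarith
  have he1 : e ≤ 1 := by rw [he, div_le_one hd0]; linarith
  rw [hee] at H3
  refine ⟨C3 * C1 ^ (1 - e) * C2 ^ e, by positivity, ?_⟩
  intro h1 h2 hh1 hh2 ι κ _ _ a c hinj ρ ρ' hρ hρ' δ hδ hδ1 hd N hN hcard f hf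
  have key := H3 (diffMax b h1 h2 a c ρ ρ') (fun f hf => measurable_diffMax hb h1 h2 a c ρ ρ' hf) ?_
    (N * C1) (N * (C2 * δ ^ (1 - 2 * η))) (by positivity) (by positivity)
    (fun f hf => H1 h1 h2 hh1 hh2 a c hinj ρ ρ' hρ hρ' N hN hcard f hf)
    (fun f hf => H2 h1 h2 hh1 hh2 a c hinj ρ ρ' hρ hρ' δ hδ hd N hN hcard f hf) f hf
  · refine key.trans (mul_le_mul_left (ENNReal.ofReal_le_ofReal ?_) _)
    have hNe : N ^ (1 - e) * N ^ e = N := by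
      rw [← Real.rpow_add hN]; norm_num
    rw [Real.mul_rpow hN.le hC1.le, Real.mul_rpow hN.le (by positivity),
      Real.mul_rpow hC2.le (by positivity), ← Real.rpow_mul hδ.le]
    calc C3 * (N ^ (1 - e) * C1 ^ (1 - e)) * (N ^ e * (C2 ^ e * δ ^ ((1 - 2 * η) * e)))
        = C3 * C1 ^ (1 - e) * C2 ^ e * ((N ^ (1 - e) * N ^ e) * δ ^ ((1 - 2 * η) * e)) := by ring
      _ ≤ _ := by
        rw [hNe]
        gcongr 2
        refine Real.rpow_le_rpow_of_exponent_ge hδ hδ1 ?_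
        nlinarith
  · intro f g hf hg x
    refine iSup_le fun k => iSup_le fun i => ?_
    rw [Rop_add hb hf hg, Rop_add hb hf hg, add_sub_add_comm]
    refine (enorm_add_le _ _).trans (add_le_add ?_ ?_)
    · exact le_iSup₂ (f := fun k i => ‖Rop b h1 h2 (a i + 1) (c i + 1) (ρ k i) f x -
        Rop b h1 h2 (a i + 1) (c i + 1) (ρ' k i) f x‖ₑ) k i
    · exact le_iSup₂ (f := fun k i => ‖Rop b h1 h2 (a i + 1) (c i + 1) (ρ k i) g x -
        Rop b h1 h2 (a i + 1) (c i + 1) (ρ' k i) g x‖ₑ) k i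

/-- Maximal function of the pieces `Rop` over a finite net of dilation parameters. -/
def netMax {ι : Type} (b h1 h2 : ℝ) (a c : ι → ℕ) {n : ℕ} (v : ι → Fin n → ℝ) (f : G → ℝ) (x : G) :
    ℝ≥0∞ :=
  ⨆ i, ⨆ e, ‖Rop b h1 h2 (a i + 1) (c i + 1) (v i e) f x‖ₑ

theorem measurable_netMax {ι : Type} [Countable ι] {b : ℝ} (hb : 1 < b) (h1 h2 : ℝ)
    (a c : ι → ℕ) {n : ℕ} (v : ι → Fin n → ℝ) {f : G → ℝ} (hf : Nice f) :
    Measurable (netMax b h1 h2 a c v f) :=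
  Measurable.iSup fun _ => Measurable.iSup fun _ => (hf.Rop hb _ _ _ _ _).1.enorm

theorem netMax_le_add {ι : Type} (b h1 h2 : ℝ) (a c : ι → ℕ) {n m : ℕ} (v : ι → Fin n → ℝ)
    (w : ι → Fin m → ℝ) (π : ι → Fin m → Fin n) (f : G → ℝ) (x : G) :
    netMax b h1 h2 a c w f x ≤ netMax b h1 h2 a c v f x +
      diffMax b h1 h2 a c (fun k i => w i k) (fun k i => v i (π i k)) f x := by
  refine iSup_le fun i => iSup_le fun e => ?_
  set R := Rop b h1 h2 (a i + 1) (c i + 1) (w i e) f x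
  set R' := Rop b h1 h2 (a i + 1) (c i + 1) (v i (π i e)) f x with hR'
  have e1 : R = R' + (R - R') := by ring
  rw [e1]
  refine (enorm_add_le _ _).trans (add_le_add ?_ ?_)
  · exact le_iSup₂_of_le (f := fun i e => ‖Rop b h1 h2 (a i + 1) (c i + 1) (v i e) f x‖ₑ)
      i (π i e) le_rfl
  · exact le_iSup₂_of_le (f := fun k i => ‖Rop b h1 h2 (a i + 1) (c i + 1) (w i k) f x -
      Rop b h1 h2 (a i + 1) (c i + 1) (v i (π i k)) f x‖ₑ) e i le_rfl

theorem rpow_net_gain {p ε D : ℝ} (hp : 1 < p) (hp2 : p ≤ 2) (hε : 0 < ε) (hD : 1 ≤ D) {C : ℝ}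
    (hC : 0 < C) (l : ℕ) :
    (C * (D ^ p * 2 ^ (((l:ℝ) + 1) * (p - 1 - ε * p)) *
      ((2:ℝ) ^ (-(l:ℝ))) ^ (p - 1 - ε * p / 2))) ^ (1 / p) ≤
      (2 * C) ^ (1 / p) * D * ((2:ℝ) ^ (-(ε / 2))) ^ l := by
  have hD0 : 0 < D := by linarith
  have e : ((2 * C) ^ (1 / p) * D * ((2:ℝ) ^ (-(ε / 2))) ^ l) =
      (2 * C * (D ^ p * 2 ^ (-(l * ε * p / 2)))) ^ (1 / p) := by
    rw [Real.mul_rpow (x := 2 * C) (by positivity) (by positivity),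
      Real.mul_rpow (x := D ^ p) (by positivity) (by positivity), ← Real.rpow_mul hD0.le, mul_one_div_cancel (by linarith), Real.rpow_one,
      ← Real.rpow_mul (by norm_num), ← Real.rpow_natCast, ← Real.rpow_mul (by norm_num), mul_assoc]
    congr 3
    field_simp
  rw [e]
  refine Real.rpow_le_rpow (by positivity) ?_ (by positivity)
  have e2 : D ^ p * (2:ℝ) ^ (((l:ℝ) + 1) * (p - 1 - ε * p)) *
      ((2:ℝ) ^ (-(l:ℝ))) ^ (p - 1 - ε * p / 2) =
      2 ^ (p - 1 - ε * p) * (D ^ p * 2 ^ (-(l * ε * p / 2))) := by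
    rw [← Real.rpow_mul (by norm_num), mul_assoc, ← Real.rpow_add (by norm_num), mul_left_comm,
      ← Real.rpow_add (by norm_num)]
    congr 2
    ring
  have e3 : (2:ℝ) ^ (p - 1 - ε * p) ≤ 2 := by
    refine (Real.rpow_le_rpow_of_exponent_le (by norm_num) (y := p - 1 - ε * p) (z := 1) ?_).trans_eq
      (Real.rpow_one _)
    nlinarith
  rw [e2, mul_comm 2 C, mul_assoc]
  rw [mul_assoc C 2]
  exact mul_le_mul_of_nonneg_left (mul_le_mul_of_nonneg_right e3 (by positivity)) hC.le

theorem netMax_nrm {b : ℝ} (hb : 1 < b) {p : ℝ} (hp : 1 < p) (hp2 : p ≤ 2) {ε : ℝ} (hε : 0 < ε) :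
    ∃ K > 0, ∀ h1 h2 : ℝ, h1 ≠ 0 → h2 ≠ 0 → ∀ {ι : Type} [Fintype ι] (a c : ι → ℕ),
      (Function.Injective fun i => (a i, c i)) → ∀ (n : ℕ → ℕ) (v : ∀ l, ι → Fin (n l) → ℝ)
      (ρ0 : ι → ℝ), (∀ l i e, v l i e ∈ Icc (1:ℝ) 4) → (∀ i, ρ0 i ∈ Icc (1:ℝ) 4) →
      (∀ i e, v 0 i e = ρ0 i) →
      (∀ l i e, ∃ e', |v (l + 1) i e - v l i e'| ≤ 4 * 2 ^ (-(l:ℝ))) →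
      ∀ D : ℝ, 1 ≤ D → (∀ l, (n (l + 1) : ℝ) ≤ D ^ p * 2 ^ (((l:ℝ) + 1) * (p - 1 - ε * p))) →
      ∀ f : G → ℝ, Nice f → ∀ L, nrm p (netMax b h1 h2 a c (v L) f) ≤
        ENNReal.ofReal (K * D) * nrm p fun x => ‖f x‖ₑ := by
  have h0 : 0 < p := by linarith
  obtain ⟨K0, hK0, HR⟩ := lacunary_Rop hb hp hp2
  obtain ⟨C3, hC3, HD⟩ := diffMax_Lp hb hp hp2 (σ := ε * p / 2) (by positivity)
  obtain ⟨θ, hθ⟩ : ∃ θ, θ = (2:ℝ) ^ (-(ε / 2)) := ⟨_, rfl⟩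
  have hθ0 : 0 < θ := by rw [hθ]; positivity
  have hθ1 : θ < 1 := by
    rw [hθ]
    exact Real.rpow_lt_one_of_one_lt_of_neg (by norm_num) (by linarith)
  obtain ⟨M, hM⟩ : ∃ M, M = (2 * C3) ^ (1 / p) := ⟨_, rfl⟩
  have hM0 : 0 < M := by rw [hM]; positivity
  have hθ' : 0 < 1 - θ := by linarith
  refine ⟨K0 + M / (1 - θ), by positivity, ?_⟩
  intro h1 h2 hh1 hh2 ι _ a c hinj n v ρ0 hv hρ0 hv0 hpar D hD hn f hf
  choose π hπ using hpar
  have hD0 : 0 < D := by linarith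
  have net : ∀ L, nrm p (netMax b h1 h2 a c (v L) f) ≤
      ENNReal.ofReal (K0 + M * D * ∑ l ∈ Finset.range L, θ ^ l) * nrm p fun x => ‖f x‖ₑ := by
    intro L
    induction L with
    | zero =>
      rw [Finset.sum_range_zero, mul_zero, add_zero]
      refine le_trans (nrm_mono h0 fun x => ?_) (HR h1 h2 hh1 hh2 a c hinj ρ0 hρ0 f hf)
      refine iSup_mono fun i => iSup_le fun e => ?_
      rw [hv0]
    | succ L ih =>
      have hN : 0 < D ^ p * (2:ℝ) ^ (((L:ℝ) + 1) * (p - 1 - ε * p)) := by positivity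
      have hd : (0:ℝ) < 2 ^ (-(L:ℝ)) := by positivity
      have hd1 : (2:ℝ) ^ (-(L:ℝ)) ≤ 1 :=
        Real.rpow_le_one_of_one_le_of_nonpos (by norm_num) (neg_nonpos.2 L.cast_nonneg)
      have hcard : (Fintype.card (Fin (n (L + 1))) : ℝ) ≤
          D ^ p * (2:ℝ) ^ (((L:ℝ) + 1) * (p - 1 - ε * p)) := by
        rw [Fintype.card_fin]
        exact hn L
      have step' := nrm_le_of_lintegral_le h0
        (mul_nonneg hC3.le (mul_nonneg hN.le (Real.rpow_nonneg hd.le _)))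
        (HD h1 h2 hh1 hh2 (κ := Fin (n (L + 1))) a c hinj (fun k i => v (L + 1) i k)
        (fun k i => v L i (π L i k)) (fun k i => hv _ _ _) (fun k i => hv _ _ _) _ hd hd1
        (fun k i => hπ L i k) _ hN hcard f hf)
      have hS : 0 ≤ ∑ l ∈ Finset.range L, θ ^ l := Finset.sum_nonneg fun _ _ => pow_nonneg hθ0.le _
      have gain := rpow_net_gain hp hp2 hε hD hC3 L
      rw [← hM, ← hθ] at gain
      rw [Finset.sum_range_succ, mul_add, ← add_assoc, ENNReal.ofReal_add
        (add_nonneg hK0.le (mul_nonneg (mul_nonneg hM0.le hD0.le) hS))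
        (mul_nonneg (mul_nonneg hM0.le hD0.le) (pow_nonneg hθ0.le _)), add_mul]
      exact (nrm_mono h0 (netMax_le_add b h1 h2 a c (v L) (v (L + 1)) (π L) f)).trans
        ((nrm_add_le hp.le (measurable_netMax hb h1 h2 a c _ hf)
          (measurable_diffMax hb h1 h2 a c _ _ hf)).trans (add_le_add ih (step'.trans
            (mul_le_mul_left (ENNReal.ofReal_le_ofReal gain) _))))
  refine fun L => (net L).trans (mul_le_mul_left (ENNReal.ofReal_le_ofReal ?_) _)
  have h1 : ∑ l ∈ Finset.range L, θ ^ l ≤ 1 / (1 - θ) := by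
    have := Summable.sum_le_tsum (Finset.range L) (fun i _ => pow_nonneg hθ0.le i)
      (summable_geometric_of_lt_one hθ0.le hθ1)
    rwa [tsum_geometric_of_lt_one hθ0.le hθ1, ← one_div] at this
  have h2 : M * D * ∑ l ∈ Finset.range L, θ ^ l ≤ M * D * (1 / (1 - θ)) :=
    mul_le_mul_of_nonneg_left h1 (mul_nonneg hM0.le hD0.le)
  have h3 : K0 ≤ K0 * D := le_mul_of_one_le_right hK0.le hD
  have h4 : (K0 + M / (1 - θ)) * D = K0 * D + M * D * (1 / (1 - θ)) := by ring
  linarith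

/-- Chaining over nets of dilation parameters. -/
theorem net_maximal {b : ℝ} (hb : 1 < b) {p : ℝ} (hp : 1 < p) (hp2 : p ≤ 2) {ε : ℝ} (hε : 0 < ε) :
    ∃ C > 0, ∀ h1 h2 : ℝ, h1 ≠ 0 → h2 ≠ 0 → ∀ {ι : Type} [Fintype ι] (a c : ι → ℕ),
      (Function.Injective fun i => (a i, c i)) → ∀ (n : ℕ → ℕ) (v : ∀ l, ι → Fin (n l) → ℝ)
      (ρ0 : ι → ℝ), (∀ l i e, v l i e ∈ Icc (1:ℝ) 4) → (∀ i, ρ0 i ∈ Icc (1:ℝ) 4) →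
      (∀ i e, v 0 i e = ρ0 i) →
      (∀ l i e, ∃ e', |v (l + 1) i e - v l i e'| ≤ 4 * 2 ^ (-(l:ℝ))) →
      ∀ D : ℝ, 1 ≤ D → (∀ l, (n (l + 1) : ℝ) ≤ D ^ p * 2 ^ (((l:ℝ) + 1) * (p - 1 - ε * p))) →
      ∀ (L : ℕ) (F : G → ℝ≥0∞), Measurable F →
        nrm p (supAvg (fun k : ι × Fin (n L) =>
          Am b h1 h2 (a k.1 + 1) (c k.1 + 1) (v L k.1 k.2)) F) ≤ ENNReal.ofReal (C * D) * nrm p F := by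
  have h0 : 0 < p := by linarith
  obtain ⟨K1, hK1, HA⟩ := lavg_Am_le hb
  obtain ⟨K2, hK2, HM⟩ := errMD_nrm hp
  obtain ⟨K, hK, HN⟩ := netMax_nrm hb hp hp2 hε
  refine ⟨K1 * K2 + K, by positivity, ?_⟩
  intro h1 h2 hh1 hh2 ι _ a c hinj n v ρ0 hv hρ0 hv0 hpar D hD hn L F hF
  refine nrm_supAvg_of_nice (fun k => cProb_Am hb _ _ _ _ _) h0 (fun f hf hf0 => ?_) hF
  have mf : Measurable fun x => ‖f x‖ₑ := hf.1.enorm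
  calc _ ≤ nrm p (fun x => ENNReal.ofReal K1 * errMD h1 h2 (fun y => ‖f y‖ₑ) x +
          netMax b h1 h2 a c (v L) f x) := by
        refine nrm_mono h0 fun x => iSup_le fun k => ?_
        refine ((HA h1 h2 (a k.1) (c k.1) _ (hv L k.1 k.2) f hf x).1 hf0).trans (add_le_add ?_ ?_)
        · exact mul_le_mul_right le_self_add _
        · exact le_iSup₂_of_le (f := fun i e => ‖Rop b h1 h2 (a i + 1) (c i + 1) (v L i e) f x‖ₑ)
            k.1 k.2 le_rfl
    _ ≤ ENNReal.ofReal K1 * nrm p (errMD h1 h2 fun y => ‖f y‖ₑ) +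
          nrm p (netMax b h1 h2 a c (v L) f) := by
        rw [← nrm_const_mul h0 _ (measurable_errMD h1 h2 mf)]
        exact nrm_add_le hp.le ((measurable_errMD h1 h2 mf).const_mul _)
          (measurable_netMax hb h1 h2 a c _ hf)
    _ ≤ ENNReal.ofReal K1 * (ENNReal.ofReal K2 * nrm p fun y => ‖f y‖ₑ) +
          ENNReal.ofReal (K * D) * nrm p fun y => ‖f y‖ₑ :=
        add_le_add (mul_le_mul_right (HM h1 h2 hh1 hh2 _ mf) _)
          (HN h1 h2 hh1 hh2 a c hinj n v ρ0 hv hρ0 hv0 hpar D hD hn f hf L)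
    _ ≤ _ := by
        rw [add_mul _ _ D, ENNReal.ofReal_add (by positivity) (by positivity), add_mul,
          ← mul_assoc, ← ENNReal.ofReal_mul hK1.le]
        exact add_le_add (mul_le_mul_left (ENNReal.ofReal_le_ofReal
          (le_mul_of_one_le_right (by positivity) hD)) _) le_rfl

theorem exists_cover {A : Set ℝ} (hA : A ⊆ Icc 1 2) {δ : ℝ} (hδ : 0 < δ) :
    ∃ F : Finset ℝ, F.card ≤ ⌊1 / δ⌋₊ + 1 ∧ A ⊆ ⋃ a ∈ F, Icc a (a + δ) := by
  refine ⟨(Finset.range (⌊1 / δ⌋₊ + 1)).image fun j : ℕ => 1 + j * δ,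
    Finset.card_image_le.trans_eq (Finset.card_range _), fun y hy => ?_⟩
  obtain ⟨h1, h2⟩ := hA hy
  have h0 : 0 ≤ (y - 1) / δ := div_nonneg (by linarith) hδ.le
  refine mem_iUnion₂.2 ⟨1 + ⌊(y - 1) / δ⌋₊ * δ, Finset.mem_image.2 ⟨_, Finset.mem_range.2 ?_, rfl⟩, ?_⟩
  · refine Nat.lt_succ_of_le (Nat.floor_le_floor ?_)
    gcongr
    linarith
  · have h3 := Nat.floor_le h0
    have h4 := (Nat.lt_floor_add_one ((y - 1) / δ)).le
    rw [le_div_iff₀ hδ] at h3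
    rw [div_le_iff₀ hδ] at h4
    constructor <;> linarith

theorem covN_spec {A : Set ℝ} (hA : A ⊆ Icc 1 2) {δ : ℝ} (hδ : 0 < δ) :
    ∃ F : Finset ℝ, F.card = covN A δ ∧ A ⊆ ⋃ a ∈ F, Icc a (a + δ) := by
  obtain ⟨F, -, hF⟩ := exists_cover hA hδ
  exact Nat.sInf_mem (s := {n : ℕ | ∃ F : Finset ℝ, F.card = n ∧ A ⊆ ⋃ a ∈ F, Icc a (a + δ)})
    ⟨F.card, F, rfl, hF⟩

theorem covN_le {A : Set ℝ} (hA : A ⊆ Icc 1 2) {δ : ℝ} (hδ : 0 < δ) :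
    covN A δ ≤ ⌊1 / δ⌋₊ + 1 := by
  obtain ⟨F, h, hF⟩ := exists_cover hA hδ
  exact (Nat.sInf_le (s := {n : ℕ | ∃ F : Finset ℝ, F.card = n ∧ A ⊆ ⋃ a ∈ F, Icc a (a + δ)})
    ⟨F, rfl, hF⟩).trans h

theorem covN_pos {A : Set ℝ} (hA : A ⊆ Icc 1 2) (hne : A.Nonempty) {δ : ℝ} (hδ : 0 < δ) :
    0 < covN A δ := by
  obtain ⟨F, h, hF⟩ := covN_spec hA hδ
  obtain ⟨y, hy⟩ := hne
  obtain ⟨a, ha, -⟩ := mem_iUnion₂.1 (hF hy)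
  exact h ▸ Finset.card_pos.2 ⟨a, ha⟩

theorem UrSet_subset (U : Set ℝ) (r : ℝ) : UrSet U r ⊆ Icc 1 2 := fun _ h => h.1

/-- A set that is covered by `N` intervals of length `δ` has a `δ`-net of `N` of its points. -/
theorem exists_net {A : Set ℝ} (hA : A ⊆ Icc 1 2) (hne : A.Nonempty) {δ : ℝ} (hδ : 0 < δ) {N : ℕ}
    (hN : covN A δ ≤ N) :
    ∃ w : Fin N → ℝ, (∀ e, w e ∈ A) ∧ ∀ y ∈ A, ∃ e, |y - w e| ≤ δ := by
  obtain ⟨F, h, hF⟩ := covN_spec hA hδ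
  obtain ⟨y0, hy0⟩ := hne
  let g : ℝ → ℝ := fun a => if h : (A ∩ Icc a (a + δ)).Nonempty then h.some else y0
  have hg : ∀ a, g a ∈ A := by
    intro a
    by_cases h : (A ∩ Icc a (a + δ)).Nonempty
    · simp only [g, dif_pos h]
      exact h.some_mem.1
    · simpa only [g, dif_neg h] using hy0
  let j : Fin N → ℝ := fun e => if h : (e:ℕ) < F.card then (F.equivFin.symm ⟨e, h⟩ : ℝ) else 0
  refine ⟨fun e => g (j e), fun e => hg _, fun y hy => ?_⟩
  obtain ⟨a, ha, hya⟩ := mem_iUnion₂.1 (hF hy)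
  have hlt := (F.equivFin ⟨a, ha⟩).2
  refine ⟨⟨F.equivFin ⟨a, ha⟩, hlt.trans_le (h.trans_le hN)⟩, ?_⟩
  have hj : j ⟨F.equivFin ⟨a, ha⟩, hlt.trans_le (h.trans_le hN)⟩ = a := by
    simp [j]
  have hn : (A ∩ Icc a (a + δ)).Nonempty := ⟨y, hy, hya⟩
  have hm : g a ∈ Icc a (a + δ) := by
    simp only [g, dif_pos hn]
    exact hn.some_mem.2
  dsimp only
  rw [hj, abs_le]
  constructor <;> linarith [hm.1, hm.2, hya.1, hya.2]

theorem bddAbove_covN (U : Set ℝ) {δ : ℝ} (hδ : 0 < δ) {p : ℝ} (hp : 0 < p) :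
    BddAbove (range fun r : {r : ℝ // 0 < r} => (covN (UrSet U (r : ℝ)) δ : ℝ) ^ (1 / p)) := by
  refine ⟨((⌊1 / δ⌋₊ + 1 : ℕ) : ℝ) ^ (1 / p), ?_⟩
  rintro _ ⟨r, rfl⟩
  exact Real.rpow_le_rpow (Nat.cast_nonneg _) (Nat.cast_le.2 (covN_le (UrSet_subset U r) hδ))
    (by positivity)

theorem covN_rpow_le_Kp (U : Set ℝ) {δ : ℝ} (hδ : 0 < δ) {p : ℝ} (hp : 0 < p) {r : ℝ} (hr : 0 < r) :
    δ ^ (1 - 1 / p) * (covN (UrSet U r) δ : ℝ) ^ (1 / p) ≤ Kp U δ p :=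
  mul_le_mul_of_nonneg_left (le_ciSup (bddAbove_covN U hδ hp) ⟨r, hr⟩) (by positivity)

theorem covN_le_of_Kp_le {U : Set ℝ} {p ε D : ℝ} (hp : 0 < p) (hD : 0 ≤ D) {δ : ℝ} (hδ : 0 < δ)
    (h : δ ^ (-ε) * Kp U δ p ≤ D) {r : ℝ} (hr : 0 < r) :
    (covN (UrSet U r) δ : ℝ) ≤ D ^ p * δ ^ (-(p - 1 - ε * p)) := by
  have h1 := covN_rpow_le_Kp U hδ hp hr
  have h2 : (covN (UrSet U r) δ : ℝ) ^ (1 / p) ≤ D * δ ^ (ε - (1 - 1 / p)) := by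
    have e1 : δ ^ (-ε) * (δ ^ (1 - 1 / p) * (covN (UrSet U r) δ : ℝ) ^ (1 / p)) ≤ D :=
      (mul_le_mul_of_nonneg_left h1 (by positivity)).trans h
    rw [← mul_assoc, ← Real.rpow_add hδ] at e1
    have e2 := mul_le_mul_of_nonneg_right e1 (Real.rpow_nonneg hδ.le (ε - (1 - 1 / p)))
    rwa [mul_right_comm, ← Real.rpow_add hδ, show -ε + (1 - 1 / p) + (ε - (1 - 1 / p)) = 0 by ring,
      Real.rpow_zero, one_mul] at e2
  have h3 := Real.rpow_le_rpow (by positivity) h2 hp.le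
  rw [← Real.rpow_mul (Nat.cast_nonneg _), one_div_mul_cancel hp.ne', Real.rpow_one,
    Real.mul_rpow hD (by positivity), ← Real.rpow_mul hδ.le] at h3
  refine h3.trans_eq ?_
  congr 2
  field_simp
  ring

theorem exists_dyadic {U : Set ℝ} {u : ℝ} (hu : u ∈ U) (h0 : 0 < u) :
    ∃ n : ℤ, ∃ w ∈ UrSet U ((2:ℝ) ^ n), u = 2 ^ n * w := by
  obtain ⟨n, h1, h2⟩ := exists_mem_Ico_zpow h0 (by norm_num : (1:ℝ) < 2)
  have hn : (0:ℝ) < 2 ^ n := by positivity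
  have e : u = 2 ^ n * (u / 2 ^ n) := by field_simp
  refine ⟨n, u / 2 ^ n, ⟨⟨?_, ?_⟩, ?_⟩, e⟩
  · rwa [le_div_iff₀ hn, one_mul]
  · rw [div_le_iff₀ hn]
    rw [zpow_add_one₀ (by norm_num)] at h2
    linarith
  · rwa [← e]

/-- Nested nets in the dyadic pieces of `U`, with the cardinalities controlled by `Kp`. -/
theorem exists_dyadic_nets {U : Set ℝ} (hne : U.Nonempty) (hU : U ⊆ Ioi 0) {p ε D : ℝ} (hp : 0 < p)
    (hD : 0 ≤ D) (hK : ∀ δ : ℝ, 0 < δ → δ < 1 → δ ^ (-ε) * Kp U δ p ≤ D) :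
    ∃ (n : ℕ → ℕ) (w : ∀ l, ℤ → Fin (n l) → ℝ) (w0 : ℤ → ℝ), (∀ l j e, w l j e ∈ Icc (1:ℝ) 2) ∧
      (∀ j, w0 j ∈ Icc (1:ℝ) 2) ∧ (∀ j e, w 0 j e = w0 j) ∧
      (∀ l j e, ∃ e', |w (l + 1) j e - w l j e'| ≤ 2 ^ (-(l:ℝ))) ∧
      (∀ l, (n (l + 1) : ℝ) ≤ D ^ p * 2 ^ (((l:ℝ) + 1) * (p - 1 - ε * p))) ∧
      ∀ j, ∀ y ∈ UrSet U ((2:ℝ) ^ j), ∀ l, ∃ e, |y - w l j e| ≤ 2 ^ (-(l:ℝ)) := by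
  obtain ⟨u, hu⟩ := hne
  obtain ⟨n0, y0, hy0, -⟩ := exists_dyadic hu (hU hu)
  let A : ℤ → Set ℝ := fun j =>
    if (UrSet U ((2:ℝ) ^ j)).Nonempty then UrSet U ((2:ℝ) ^ j) else UrSet U ((2:ℝ) ^ n0)
  have hA : ∀ j, ∃ j' : ℤ, A j = UrSet U ((2:ℝ) ^ j') := by
    intro j
    by_cases h : (UrSet U ((2:ℝ) ^ j)).Nonempty
    · exact ⟨j, if_pos h⟩
    · exact ⟨n0, if_neg h⟩
  have hAne : ∀ j, (A j).Nonempty := by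
    intro j
    by_cases h : (UrSet U ((2:ℝ) ^ j)).Nonempty
    · simp only [A, if_pos h]; exact h
    · simp only [A, if_neg h]; exact ⟨y0, hy0⟩
  have hAs : ∀ j, A j ⊆ Icc 1 2 := by
    intro j
    obtain ⟨j', h⟩ := hA j
    exact h ▸ UrSet_subset _ _
  let n : ℕ → ℕ := fun l => if l = 0 then 1 else ⌊D ^ p * (2:ℝ) ^ ((l:ℝ) * (p - 1 - ε * p))⌋₊
  have net : ∀ l j, ∃ w : Fin (n l) → ℝ, (∀ e, w e ∈ A j) ∧
      ∀ y ∈ A j, ∃ e, |y - w e| ≤ 2 ^ (-(l:ℝ)) := by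
    intro l j
    by_cases hl : l = 0
    · subst hl
      obtain ⟨y, hy⟩ := hAne j
      refine ⟨fun _ => y, fun _ => hy, fun z hz => ⟨⟨0, Nat.one_pos⟩, ?_⟩⟩
      have h1 := hAs j hy
      have h2 := hAs j hz
      rw [Nat.cast_zero, neg_zero, Real.rpow_zero, abs_le]
      constructor <;> linarith [h1.1, h1.2, h2.1, h2.2]
    · have hd : (0:ℝ) < 2 ^ (-(l:ℝ)) := by positivity
      have hl' : (0:ℝ) < l := Nat.cast_pos.2 (Nat.pos_of_ne_zero hl)
      refine exists_net (hAs j) (hAne j) hd ?_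
      obtain ⟨j', hj'⟩ := hA j
      have := covN_le_of_Kp_le hp hD hd
        (hK _ hd (Real.rpow_lt_one_of_one_lt_of_neg (by norm_num) (by linarith)))
        (r := (2:ℝ) ^ j') (by positivity)
      rw [← Real.rpow_mul (by norm_num), neg_mul_neg] at this
      simp only [n, if_neg hl]
      rw [hj']
      exact Nat.le_floor this
  choose w hw1 hw2 using net
  refine ⟨n, w, fun j => w 0 j ⟨0, Nat.one_pos⟩, fun l j e => hAs j (hw1 l j e),
    fun j => hAs j (hw1 _ _ _), fun j e => ?_, fun l j e => hw2 l j _ (hw1 _ _ _), fun l => ?_,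
    fun j y hy l => hw2 l j y ?_⟩
  · congr 1
    exact Fin.ext (Nat.lt_one_iff.1 e.2)
  · simp only [n, if_neg (Nat.succ_ne_zero l)]
    have := Nat.floor_le (a := D ^ p * (2:ℝ) ^ (((l + 1 : ℕ):ℝ) * (p - 1 - ε * p))) (by positivity)
    push_cast at this ⊢
    exact this
  · simp only [A]
    rwa [if_pos ⟨y, hy⟩]

/-- The average over the piece `t ∈ [2^k, 2^(k+1)]` of the curve `(t, u c t^b)`. -/
def dyadicPiece (b c : ℝ) (k : ℤ) (u : ℝ) : Measure G := cur b (2 ^ k) (u * (c * ((2:ℝ) ^ k) ^ b))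

theorem two_pow_toNat_mul {k m : ℤ} (h : 0 ≤ k + m) :
    (2:ℝ) ^ ((k + m).toNat + 1) * 2 ^ (-m - 1) = 2 ^ k := by
  rw [← zpow_natCast, ← zpow_add₀ (by norm_num)]
  congr 1
  push_cast
  rw [Int.toNat_of_nonneg h]
  ring

theorem two_rpow_fract_mem (t : ℝ) {w : ℝ} (hw : w ∈ Icc (1:ℝ) 2) :
    (2:ℝ) ^ Int.fract t * w ∈ Icc (1:ℝ) 4 := by
  have h1 : (1:ℝ) ≤ 2 ^ Int.fract t := Real.one_le_rpow (by norm_num) (Int.fract_nonneg t)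
  have h2 : (2:ℝ) ^ Int.fract t ≤ 2 :=
    (Real.rpow_le_rpow_of_exponent_le (by norm_num) (Int.fract_lt_one t).le).trans_eq (Real.rpow_one 2)
  constructor <;> nlinarith [hw.1, hw.2]

theorem Am_eq_dyadicPiece (b cp : ℝ) {k n N M : ℤ} (hk : 0 ≤ k + N) (hn : 0 ≤ n + ⌊(k:ℝ) * b⌋ + M)
    (w : ℝ) :
    Am b (2 ^ (-N - 1)) (cp * 2 ^ (-M - 1)) ((k + N).toNat + 1) ((n + ⌊(k:ℝ) * b⌋ + M).toNat + 1)
      ((2:ℝ) ^ Int.fract ((k:ℝ) * b) * w) = dyadicPiece b cp k (2 ^ n * w) := by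
  rw [Am, dyadicPiece, two_pow_toNat_mul hk]
  congr 1
  have e1 := two_pow_toNat_mul hn
  have e2 : ((2:ℝ) ^ k) ^ b = 2 ^ ⌊(k:ℝ) * b⌋ * (2:ℝ) ^ Int.fract ((k:ℝ) * b) := by
    rw [← Real.rpow_intCast, ← Real.rpow_mul (by norm_num), ← Real.rpow_intCast,
      ← Real.rpow_add (by norm_num), Int.floor_add_fract]
  rw [mul_left_comm ((2:ℝ) ^ _) cp, e1, zpow_add₀ (by norm_num), e2]
  ring

theorem dyadic_net_maximal {b : ℝ} (hb : 1 < b) {p : ℝ} (hp : 1 < p) (hp2 : p ≤ 2) {ε : ℝ}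
    (hε : 0 < ε) :
    ∃ C > 0, ∀ cp : ℝ, cp ≠ 0 → ∀ (n : ℕ → ℕ) (w : ∀ l, ℤ → Fin (n l) → ℝ) (w0 : ℤ → ℝ),
      (∀ l j e, w l j e ∈ Icc (1:ℝ) 2) → (∀ j, w0 j ∈ Icc (1:ℝ) 2) → (∀ j e, w 0 j e = w0 j) →
      (∀ l j e, ∃ e', |w (l + 1) j e - w l j e'| ≤ 2 ^ (-(l:ℝ))) →
      ∀ D : ℝ, 1 ≤ D → (∀ l, (n (l + 1) : ℝ) ≤ D ^ p * 2 ^ (((l:ℝ) + 1) * (p - 1 - ε * p))) →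
      ∀ (N : ℕ) (F : G → ℝ≥0∞), Measurable F →
        nrm p (supAvg (fun k : (↥(Finset.Icc (-N:ℤ) N) × ↥(Finset.Icc (-N:ℤ) N)) × Fin (n N) =>
          dyadicPiece b cp k.1.1 (2 ^ (k.1.2:ℤ) * w N k.1.2 k.2)) F) ≤
          ENNReal.ofReal (C * D) * nrm p F := by
  obtain ⟨C, hC, H⟩ := net_maximal hb hp hp2 hε
  refine ⟨C, hC, fun cp hcp n w w0 hw hw0 hw0' hpar D hD hn N F hF => ?_⟩
  obtain ⟨M, hM⟩ : ∃ M : ℤ, M = N - ⌊((-N:ℤ):ℝ) * b⌋ := ⟨_, rfl⟩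
  have hk : ∀ k : ↥(Finset.Icc (-N:ℤ) N), 0 ≤ (k:ℤ) + N := fun k => by
    have := Finset.mem_Icc.1 k.2
    omega
  have hm : ∀ i : ↥(Finset.Icc (-N:ℤ) N) × ↥(Finset.Icc (-N:ℤ) N),
      0 ≤ (i.2:ℤ) + ⌊((i.1:ℤ):ℝ) * b⌋ + M := fun i => by
    have h1 := Finset.mem_Icc.1 i.1.2
    have h2 := Finset.mem_Icc.1 i.2.2
    have h3 : ⌊((-N:ℤ):ℝ) * b⌋ ≤ ⌊((i.1:ℤ):ℝ) * b⌋ :=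
      Int.floor_le_floor (mul_le_mul_of_nonneg_right (Int.cast_le.2 h1.1) (by linarith))
    omega
  have key := H (2 ^ (-(N:ℤ) - 1)) (cp * 2 ^ (-M - 1)) (by positivity)
    (mul_ne_zero hcp (by positivity))
    (ι := ↥(Finset.Icc (-N:ℤ) N) × ↥(Finset.Icc (-N:ℤ) N))
    (fun i => ((i.1:ℤ) + N).toNat) (fun i => ((i.2:ℤ) + ⌊((i.1:ℤ):ℝ) * b⌋ + M).toNat)
    (fun i j hij => ?_) n (fun l i e => (2:ℝ) ^ Int.fract (((i.1:ℤ):ℝ) * b) * w l i.2 e)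
    (fun i => (2:ℝ) ^ Int.fract (((i.1:ℤ):ℝ) * b) * w0 i.2)
    (fun l i e => two_rpow_fract_mem _ (hw _ _ _)) (fun i => two_rpow_fract_mem _ (hw0 _))
    (fun i e => by rw [hw0']) (fun l i e => ?_) D hD hn N F hF
  · simp only [Am_eq_dyadicPiece b cp (hk _) (hm _)] at key
    exact key
  · obtain ⟨h1, h2⟩ := Prod.mk.inj hij
    have e1 : (i.1:ℤ) = j.1 := by
      have := hk i.1
      have := hk j.1
      omega
    have e2 : (i.2:ℤ) = j.2 := by
      have h3 := hm i
      have h4 := hm j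
      rw [e1] at h3
      simp only [e1] at h2
      omega
    exact Prod.ext (Subtype.ext e1) (Subtype.ext e2)
  · obtain ⟨e', he'⟩ := hpar l i.2 e
    refine ⟨e', ?_⟩
    rw [← mul_sub, abs_mul, abs_of_pos (by positivity)]
    have h1 := (two_rpow_fract_mem (((i.1:ℤ):ℝ) * b) (w := 1) (by norm_num)).2
    rw [mul_one] at h1
    exact mul_le_mul h1 he' (abs_nonneg _) (by norm_num)

/-- The supremum over `u ∈ U` and `k ∈ ℤ` of the averages over the dyadic pieces of the curve. -/
def dyadicSup (b c : ℝ) (U : Set ℝ) (F : G → ℝ≥0∞) (x : G) : ℝ≥0∞ :=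
  ⨆ u : U, ⨆ k : ℤ, lavg (dyadicPiece b c k u) F x

theorem lavg_dyadicPiece_le_liminf {b c : ℝ} {k : ℤ} {F : G → ℝ≥0∞} (hF : Continuous F) {u : ℕ → ℝ}
    {v : ℝ} (hu : Tendsto u atTop (𝓝 v)) (x : G) :
    lavg (dyadicPiece b c k v) F x ≤ liminf (fun N => lavg (dyadicPiece b c k (u N)) F x) atTop := by
  simp only [dyadicPiece, lavg_cur hF.measurable]
  refine le_trans (lintegral_mono fun s => ?_) (lintegral_liminf_le fun N => ?_)
  · have h : Tendsto (fun N => F (x - (s * 2 ^ k, s ^ b * (u N * (c * ((2:ℝ) ^ k) ^ b))))) atTop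
        (𝓝 (F (x - (s * 2 ^ k, s ^ b * (v * (c * ((2:ℝ) ^ k) ^ b)))))) := by
      refine (hF.tendsto _).comp (tendsto_const_nhds.sub ?_)
      exact tendsto_const_nhds.prodMk_nhds ((hu.mul_const _).const_mul _)
    exact h.liminf_eq.ge
  · refine hF.measurable.comp (measurable_const.sub ?_)
    exact (measurable_id.mul_const _).prodMk ((measurable_id.pow_const b).mul_const _)

theorem dyadicSup_nrm {b : ℝ} (hb : 1 < b) {p : ℝ} (hp : 1 < p) (hp2 : p ≤ 2) {ε : ℝ} (hε : 0 < ε) :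
    ∃ C > 0, ∀ cp : ℝ, cp ≠ 0 → ∀ U : Set ℝ, U.Nonempty → U ⊆ Ioi 0 → ∀ D : ℝ, 1 ≤ D →
      (∀ δ : ℝ, 0 < δ → δ < 1 → δ ^ (-ε) * Kp U δ p ≤ D) → ∀ F : G → ℝ≥0∞, Continuous F →
      nrm p (dyadicSup b cp U F) ≤ ENNReal.ofReal (C * D) * nrm p F := by
  have h0 : 0 < p := by linarith
  obtain ⟨C, hC, H⟩ := dyadic_net_maximal hb hp hp2 hε
  refine ⟨C, hC, fun cp hcp U hne hU D hD hK F hF => ?_⟩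
  obtain ⟨n, w, w0, hw, hw0, hw0', hpar, hn, hnet⟩ :=
    exists_dyadic_nets hne hU h0 (by linarith) hK
  have key := fun N => (nrm_le_iff h0).1
    (H cp hcp n w w0 hw hw0 hw0' hpar D hD hn N F hF.measurable)
  set S : ℕ → G → ℝ≥0∞ := fun N =>
    supAvg (fun k : (↥(Finset.Icc (-N:ℤ) N) × ↥(Finset.Icc (-N:ℤ) N)) × Fin (n N) =>
      dyadicPiece b cp k.1.1 (2 ^ (k.1.2:ℤ) * w N k.1.2 k.2)) F with hS
  have hSm : ∀ N, Measurable (S N) := fun N =>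
    measurable_supAvg (fun k => cProb_cur (by linarith) _ _) hF.measurable
  have hle : ∀ x, dyadicSup b cp U F x ≤ liminf (fun N => S N x) atTop := by
    refine fun x => iSup_le fun u => iSup_le fun k => ?_
    obtain ⟨j, y, hy, huy⟩ := exists_dyadic u.2 (hU u.2)
    choose e he using hnet j y hy
    have lim : Tendsto (fun N => (2:ℝ) ^ j * w N j (e N)) atTop (𝓝 u) := by
      rw [huy]
      refine Tendsto.const_mul _ (tendsto_iff_dist_tendsto_zero.2 ?_)
      refine squeeze_zero (fun _ => dist_nonneg) (fun N => ?_)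
        (tendsto_pow_atTop_nhds_zero_of_lt_one (r := (1/2:ℝ)) (by norm_num) (by norm_num))
      rw [dist_comm, Real.dist_eq]
      refine (he N).trans_eq ?_
      rw [Real.rpow_neg (by norm_num), Real.rpow_natCast, one_div, inv_pow]
    refine (lavg_dyadicPiece_le_liminf hF lim x).trans (liminf_le_liminf ?_)
    filter_upwards [eventually_ge_atTop (max k.natAbs j.natAbs)] with N hN
    have h1 := (le_max_left _ _).trans hN
    have h2 := (le_max_right _ _).trans hN
    exact le_iSup_of_le (f := fun k : (↥(Finset.Icc (-N:ℤ) N) × ↥(Finset.Icc (-N:ℤ) N)) × Fin (n N) =>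
      lavg (dyadicPiece b cp k.1.1 (2 ^ (k.1.2:ℤ) * w N k.1.2 k.2)) F x)
      ((⟨k, Finset.mem_Icc.2 (by omega)⟩, ⟨j, Finset.mem_Icc.2 (by omega)⟩), e N) le_rfl
  rw [nrm_le_iff h0]
  calc ∫⁻ x, dyadicSup b cp U F x ^ p ≤ ∫⁻ x, liminf (fun N => S N x ^ p) atTop := by
        refine lintegral_mono fun x => (ENNReal.rpow_le_rpow (hle x) h0.le).trans_eq ?_
        exact (ENNReal.orderIsoRpow p h0).liminf_apply
    _ ≤ liminf (fun N => ∫⁻ x, S N x ^ p) atTop :=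
        lintegral_liminf_le fun N => (hSm N).pow_const p
    _ ≤ _ := by
        refine (liminf_le_liminf (Eventually.of_forall key)).trans_eq ?_
        rw [liminf_const]

theorem setLIntegral_dyadic {b c : ℝ} (k : ℤ) (u : ℝ) {F : G → ℝ≥0∞} (hF : Measurable F) (x : G) :
    ∫⁻ t in Icc ((2:ℝ) ^ k) (2 ^ (k + 1)), F (x - (t, u * (c * t ^ b))) =
      ENNReal.ofReal (2 ^ k) * lavg (dyadicPiece b c k u) F x := by
  have hk : (0:ℝ) < 2 ^ k := by positivity
  have hm : Measurable fun t : ℝ => F (x - (t, u * (c * t ^ b))) :=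
    hF.comp (measurable_const.sub (measurable_id.prodMk
      (((measurable_id.pow_const b).const_mul c).const_mul u)))
  rw [dyadicPiece, lavg_cur hF, ← lintegral_indicator measurableSet_Icc,
    ← lintegral_indicator measurableSet_Icc]
  conv_lhs => rw [← Real.smul_map_volume_mul_right hk.ne']
  rw [lintegral_smul_measure, lintegral_map (hm.indicator measurableSet_Icc) (by fun_prop),
    abs_of_pos hk, smul_eq_mul]
  congr 1
  refine lintegral_congr fun s => ?_
  by_cases hs : s ∈ Icc (1:ℝ) 2
  · have hs' : s * 2 ^ k ∈ Icc ((2:ℝ) ^ k) (2 ^ (k + 1)) := by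
      rw [zpow_add_one₀ (by norm_num)]
      constructor <;> nlinarith [hs.1, hs.2]
    rw [indicator_of_mem hs, indicator_of_mem hs', Real.mul_rpow (by linarith [hs.1]) hk.le]
    congr 3
    ring
  · have hs' : s * 2 ^ k ∉ Icc ((2:ℝ) ^ k) (2 ^ (k + 1)) := by
      rw [zpow_add_one₀ (by norm_num), mul_comm ((2:ℝ) ^ k)]
      intro h
      exact hs ⟨by nlinarith [h.1], le_of_mul_le_mul_right h.2 hk⟩
    rw [indicator_of_notMem hs, indicator_of_notMem hs']

theorem setLIntegral_Ioc_le_dyadicSup {b c : ℝ} {U : Set ℝ} {u : ℝ} (hu : u ∈ U) {R : ℝ} (hR : 0 < R)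
    {F : G → ℝ≥0∞} (hF : Measurable F) (x : G) :
    ∫⁻ t in Ioc 0 R, F (x - (t, u * (c * t ^ b))) ≤
      ENNReal.ofReal (2 * R) * dyadicSup b c U F x := by
  obtain ⟨K, hK1, hK2⟩ := exists_mem_Ico_zpow hR (by norm_num : (1:ℝ) < 2)
  have hsub : Ioc 0 R ⊆ ⋃ j : ℕ, Icc ((2:ℝ) ^ (K - j)) (2 ^ (K - j + 1)) := by
    intro t ht
    obtain ⟨m, hm1, hm2⟩ := exists_mem_Ico_zpow ht.1 (by norm_num : (1:ℝ) < 2)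
    have hmK : m < K + 1 :=
      (zpow_lt_zpow_iff_right₀ (by norm_num : (1:ℝ) < 2)).1 (hm1.trans_lt (ht.2.trans_lt hK2))
    refine mem_iUnion.2 ⟨(K - m).toNat, ?_⟩
    rw [Int.toNat_of_nonneg (by omega), sub_sub_cancel]
    exact ⟨hm1, hm2.le⟩
  have hsum : ∑' j : ℕ, ENNReal.ofReal ((2:ℝ) ^ (K - j)) = ENNReal.ofReal (2 * 2 ^ K) := by
    have e : ∀ j : ℕ, (2:ℝ) ^ (K - j) = 2 ^ K * (1 / 2) ^ j := fun j => by
      rw [zpow_sub₀ (by norm_num), zpow_natCast, one_div, inv_pow, div_eq_mul_inv]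
    simp only [e]
    rw [← ENNReal.ofReal_tsum_of_nonneg (fun j => by positivity)
      (summable_geometric_two.mul_left _), tsum_mul_left, tsum_geometric_two, mul_comm]
  calc ∫⁻ t in Ioc 0 R, F (x - (t, u * (c * t ^ b)))
      ≤ ∑' j : ℕ, ∫⁻ t in Icc ((2:ℝ) ^ (K - j)) (2 ^ (K - j + 1)), F (x - (t, u * (c * t ^ b))) :=
        (lintegral_mono_set hsub).trans (lintegral_iUnion_le _ _)
    _ ≤ ∑' j : ℕ, ENNReal.ofReal ((2:ℝ) ^ (K - j)) * dyadicSup b c U F x := by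
        refine ENNReal.tsum_le_tsum fun j => ?_
        rw [setLIntegral_dyadic _ _ hF]
        exact mul_le_mul_right (le_iSup₂_of_le
          (f := fun (u : U) (k : ℤ) => lavg (dyadicPiece b c k u) F x) ⟨u, hu⟩ (K - j) le_rfl) _
    _ ≤ _ := by
        rw [ENNReal.tsum_mul_right, hsum]
        exact mul_le_mul_left (ENNReal.ofReal_le_ofReal (by linarith)) _

theorem intervalIntegral_curve_le {b cp cm : ℝ} {U : Set ℝ} {u : ℝ} (hu : u ∈ U) {R : ℝ} (hR : 0 < R)
    {f : G → ℝ} (hf : Measurable f) (x : G) (hfin : dyadicSup b cp U (fun y => ‖f y‖ₑ) x ≠ ∞) :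
    R⁻¹ * ∫ t in (0:ℝ)..R, |f (x - (t, u * curve b cp cm t))| ≤
      2 * (dyadicSup b cp U (fun y => ‖f y‖ₑ) x).toReal := by
  have e : ∫ t in (0:ℝ)..R, |f (x - (t, u * curve b cp cm t))| =
      ∫ t in Ioc 0 R, |f (x - (t, u * (cp * t ^ b)))| := by
    rw [intervalIntegral.integral_of_le hR.le]
    refine setIntegral_congr_fun measurableSet_Ioc fun t ht => ?_
    simp only [curve, if_pos ht.1]
  have hm : Measurable fun t : ℝ => |f (x - (t, u * (cp * t ^ b)))| :=
    (hf.comp (measurable_const.sub (measurable_id.prodMk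
      (((measurable_id.pow_const b).const_mul cp).const_mul u)))).abs
  have key := setLIntegral_Ioc_le_dyadicSup (b := b) (c := cp) hu hR hf.enorm x
  rw [e, integral_eq_lintegral_of_nonneg_ae (Eventually.of_forall fun _ => abs_nonneg _)
    hm.aestronglyMeasurable, inv_mul_le_iff₀ hR]
  simp only [← Real.enorm_eq_ofReal_abs]
  refine (ENNReal.toReal_mono (ENNReal.mul_ne_top ENNReal.ofReal_ne_top hfin) key).trans_eq ?_
  rw [ENNReal.toReal_mul, ENNReal.toReal_ofReal (by positivity)]
  ring

theorem enorm_calM_le {b cp cm : ℝ} {U : Set ℝ} {f : G → ℝ} (hf : Measurable f) (x : G) :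
    ‖calM b cp cm U f x‖ₑ ≤ 2 * dyadicSup b cp U (fun y => ‖f y‖ₑ) x := by
  by_cases hfin : dyadicSup b cp U (fun y => ‖f y‖ₑ) x = ∞
  · rw [hfin, ENNReal.mul_top two_ne_zero]
    exact le_top
  have h0 : 0 ≤ calM b cp cm U f x := by
    refine Real.iSup_nonneg fun u => Real.iSup_nonneg fun R => ?_
    exact mul_nonneg (inv_nonneg.2 R.2.le)
      (intervalIntegral.integral_nonneg R.2.le fun _ _ => abs_nonneg _)
  have h1 : calM b cp cm U f x ≤ 2 * (dyadicSup b cp U (fun y => ‖f y‖ₑ) x).toReal := by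
    have hB : 0 ≤ 2 * (dyadicSup b cp U (fun y => ‖f y‖ₑ) x).toReal := by positivity
    exact Real.iSup_le (fun u => Real.iSup_le (fun R =>
      intervalIntegral_curve_le u.2 R.2 hf x hfin) hB) hB
  rw [Real.enorm_of_nonneg h0]
  refine (ENNReal.ofReal_le_ofReal h1).trans_eq ?_
  rw [ENNReal.ofReal_mul (by norm_num), ENNReal.ofReal_toReal hfin, ENNReal.ofReal_ofNat]

theorem Kp_half_lower {U : Set ℝ} (hne : U.Nonempty) (hU : U ⊆ Ioi 0) {p : ℝ} (hp : 1 < p) :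
    (1 / 2 : ℝ) ≤ Kp U (1 / 2) p := by
  obtain ⟨u, hu⟩ := hne
  obtain ⟨n, y, hy, -⟩ := exists_dyadic hu (hU hu)
  refine le_trans ?_ (covN_rpow_le_Kp U (by norm_num : (0:ℝ) < 1 / 2) (by linarith)
    (r := (2:ℝ) ^ n) (by positivity))
  have h1 : (1:ℝ) ≤ (covN (UrSet U ((2:ℝ) ^ n)) (1 / 2) : ℝ) ^ (1 / p) := by
    refine Real.one_le_rpow ?_ (by positivity)
    exact Nat.one_le_cast.2 (covN_pos (UrSet_subset _ _) ⟨y, hy⟩ (by norm_num))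
  have h2 : (1 / 2 : ℝ) ≤ (1 / 2 : ℝ) ^ (1 - 1 / p) := by
    have h3 : (0:ℝ) < 1 / p := by positivity
    exact (Real.rpow_one (1 / 2 : ℝ)).symm.trans_le
      (Real.rpow_le_rpow_of_exponent_ge (by norm_num) (by norm_num) (by linarith))
  exact h2.trans (le_mul_of_one_le_right (by positivity) h1)

theorem opNormM_le {b : ℝ} (hb : 1 < b) {p : ℝ} (hp : 1 < p) (hp2 : p ≤ 2) {ε : ℝ} (hε : 0 < ε) :
    ∃ C > 0, ∀ cp : ℝ, cp ≠ 0 → ∀ cm : ℝ, ∀ U : Set ℝ, U.Nonempty → U ⊆ Ioi 0 → ∀ D : ℝ, 1 ≤ D →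
      (∀ δ : ℝ, 0 < δ → δ < 1 → δ ^ (-ε) * Kp U δ p ≤ D) →
      opNormM b cp cm U p ≤ ENNReal.ofReal (C * D) := by
  have h0 : 0 < p := by linarith
  obtain ⟨C, hC, H⟩ := dyadicSup_nrm hb hp hp2 hε
  refine ⟨2 * C, by positivity, fun cp hcp cm U hne hU D hD hK => sInf_le fun f => ?_⟩
  have key := H cp hcp U hne hU D hD hK (fun y => ‖f y‖ₑ) f.continuous.enorm
  have hp0 : eN p ≠ 0 := by simpa [eN] using h0
  have hpt : eN p ≠ ∞ := ENNReal.ofReal_ne_top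
  have hpr : (eN p).toReal = p := ENNReal.toReal_ofReal h0.le
  rw [eLpNorm_eq_lintegral_rpow_enorm_toReal hp0 hpt, eLpNorm_eq_lintegral_rpow_enorm_toReal hp0 hpt,
    hpr]
  change nrm p (fun x => ‖calM b cp cm U f x‖ₑ) ≤ _ * nrm p fun x => ‖f x‖ₑ
  rw [nrm_le_iff h0] at key ⊢
  calc ∫⁻ x, ‖calM b cp cm U f x‖ₑ ^ p
      ≤ ∫⁻ x, 2 ^ p * dyadicSup b cp U (fun y => ‖f y‖ₑ) x ^ p := by
        refine lintegral_mono fun x => ?_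
        rw [← ENNReal.mul_rpow_of_nonneg _ _ h0.le]
        exact ENNReal.rpow_le_rpow (enorm_calM_le f.continuous.measurable x) h0.le
    _ = 2 ^ p * ∫⁻ x, dyadicSup b cp U (fun y => ‖f y‖ₑ) x ^ p :=
        lintegral_const_mul' _ _ (ENNReal.rpow_ne_top_of_nonneg h0.le ENNReal.ofNat_ne_top)
    _ ≤ 2 ^ p * (ENNReal.ofReal (C * D) ^ p * ∫⁻ x, ‖f x‖ₑ ^ p) := mul_le_mul_right key _
    _ = _ := by
        rw [← mul_assoc, ← ENNReal.mul_rpow_of_nonneg _ _ h0.le, mul_assoc 2 C,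
          ENNReal.ofReal_mul (p := 2) (by norm_num), ENNReal.ofReal_ofNat]

theorem opNormM_le_iSup {b : ℝ} (hb : 1 < b) {p : ℝ} (hp : 1 < p) (hp2 : p ≤ 2) {ε : ℝ} (hε : 0 < ε) :
    ∃ C > 0, ∀ cp : ℝ, cp ≠ 0 → ∀ cm : ℝ, ∀ U : Set ℝ, U.Nonempty → U ⊆ Ioi 0 →
      opNormM b cp cm U p ≤ ENNReal.ofReal C *
        ⨆ δ : {δ : ℝ // 0 < δ ∧ δ < 1}, ENNReal.ofReal ((δ : ℝ) ^ (-ε) * Kp U (δ : ℝ) p) := by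
  obtain ⟨C, hC, H⟩ := opNormM_le hb hp hp2 hε
  refine ⟨C * 2, by positivity, fun cp hcp cm U hne hU => ?_⟩
  set T : {δ : ℝ // 0 < δ ∧ δ < 1} → ℝ≥0∞ :=
    fun δ => ENNReal.ofReal ((δ : ℝ) ^ (-ε) * Kp U (δ : ℝ) p) with hT
  by_cases hfin : ⨆ δ, T δ = ∞
  · rw [hfin, ENNReal.mul_top (ENNReal.ofReal_pos.2 (by positivity)).ne']
    exact le_top
  have hle : ∀ δ : ℝ, 0 < δ → δ < 1 → δ ^ (-ε) * Kp U δ p ≤ (⨆ δ, T δ).toReal := fun δ h0 h1 =>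
    (ENNReal.ofReal_le_iff_le_toReal hfin).1 (le_iSup T ⟨δ, h0, h1⟩)
  have hhalf : 1 ≤ 2 * (⨆ δ, T δ).toReal := by
    have h1 := hle (1 / 2) (by norm_num) (by norm_num)
    have h2 := Kp_half_lower hne hU hp
    have h3 : (1:ℝ) ≤ (1 / 2 : ℝ) ^ (-ε) :=
      Real.one_le_rpow_of_pos_of_le_one_of_nonpos (by norm_num) (by norm_num) (by linarith)
    nlinarith
  refine (H cp hcp cm U hne hU _ hhalf fun δ h0 h1 => (hle δ h0 h1).trans ?_).trans_eq ?_
  · linarith [(⨆ δ, T δ).toReal_nonneg]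
  · rw [← mul_assoc, ENNReal.ofReal_mul (by positivity), ENNReal.ofReal_toReal hfin]

end CurveMax

theorem statement3 (b cp cm : ℝ) (hb : 1 < b) (hcp : cp ≠ 0) (hcm : cm ≠ 0) (p : ℝ) (hp1 : 1 < p) (hp2 : p ≤ 2)
    (ε : ℝ) (hε : 0 < ε) :
    ∃ C : ℝ, ∀ U : Set ℝ, U.Nonempty → U ⊆ Ioi (0:ℝ) →
      opNormM b cp cm U p
        ≤ ENNReal.ofReal C *
            ⨆ δ : {δ : ℝ // 0 < δ ∧ δ < 1},
              ENNReal.ofReal ((δ : ℝ) ^ (-ε) * Kp U (δ : ℝ) p) := by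
  obtain ⟨C, -, H⟩ := CurveMax.opNormM_le_iSup hb hp1 hp2 hε
  exact ⟨C, fun U hne hU => H cp hcp cm U hne hU⟩

end
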